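/- Let x be a normal infinite word over a finite alphabet A and y a normal infinite word over a finite alphabet B (|A|,|B| ≥ 2). Then x and y are finite-state independent if and only if for every oblivious selector with first input alphabet A and second input alphabet B whose output on (x,y) is infinite, the output S(x,y) is normal, and for every oblivious selector with first input alphabet B and second input alphabet A whose output on (y,x) is infinite, the output S(y,x) is normal. -/

import Mathlib

open Filter Topology

namespace FSI

variable {A B D Q : Type*}

/-- The prefix of length `n` of the infinite word `x`. -/
def pref (x : ℕ → A) (n : ℕ) : List A := (List.range n).map x

/-- Number of (possibly overlapping) occurrences of `u` in `w`. -/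
noncomputable def occ (w u : List A) : ℕ :=
  Nat.card {i : ℕ | i + u.length ≤ w.length ∧ (w.drop i).take u.length = u}

/-- Number of aligned occurrences of `u` in `w`. -/
noncomputable def alocc (w u : List A) : ℕ :=
  Nat.card {i : ℕ | i + u.length ≤ w.length ∧ i % u.length = 0 ∧ (w.drop i).take u.length = u}

/-- `x` is simply normal to word length `ℓ`. -/
def SimplyNormalTo [Fintype A] (x : ℕ → A) (ℓ : ℕ) : Prop :=
  ∀ u : List A, u.length = ℓ →
    Tendsto (fun n : ℕ => (alocc (pref x (n * ℓ)) u : ℝ) / n) atTop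
      (nhds ((Fintype.card A : ℝ)⁻¹ ^ ℓ))

/-- `x` is a normal infinite word. -/
def Normal [Fintype A] (x : ℕ → A) : Prop := ∀ ℓ : ℕ, 1 ≤ ℓ → SimplyNormalTo x ℓ

/-! ### Two-tape automata -/

/-- A `2`-automaton with input alphabets `A`, `B` and state set `Q`;
`none` plays the role of the empty word `ε` in transition labels. -/
structure TwoAut (A B Q : Type*) where
  init : Set Q
  trans : Set (Q × (Option A × Option B) × Q)

/-- The support of a label. -/
def lsupp (l : Option A × Option B) : Bool × Bool := (l.1.isSome, l.2.isSome)

/-- A `2`-deterministic `2`-automaton. -/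
def TwoAut.TwoDet (M : TwoAut A B Q) : Prop :=
  (∃ q₀, M.init = {q₀}) ∧
  ∀ t ∈ M.trans, ∀ t' ∈ M.trans, t.1 = t'.1 →
    lsupp t.2.1 = lsupp t'.2.1 ∧ (t.2.1 = t'.2.1 → t = t')

/-- A `1`-deterministic `2`-automaton. -/
def TwoAut.OneDet (M : TwoAut A B Q) : Prop :=
  (∃ q₀, M.init = {q₀}) ∧
  ∀ t ∈ M.trans, ∀ t' ∈ M.trans, t.1 = t'.1 →
    t.2.1.1.isSome = t'.2.1.1.isSome ∧ (t.2.1.1 = t'.2.1.1 → t = t')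

/-- `2`-completeness. -/
def TwoAut.TwoComplete (M : TwoAut A B Q) : Prop :=
  ∀ (q : Q) (l l' : Option A × Option B),
    (∃ q', (q, l, q') ∈ M.trans) → lsupp l' = lsupp l → ∃ q', (q, l', q') ∈ M.trans

/-- Every transition reads exactly one symbol. -/
def TwoAut.OneSymbol (M : TwoAut A B Q) : Prop :=
  ∀ t ∈ M.trans, lsupp t.2.1 = (true, false) ∨ lsupp t.2.1 = (false, true)

def TwoAut.Step (M : TwoAut A B Q) (p q : Q) : Prop := ∃ l, (p, l, q) ∈ M.trans

/-- There is a finite run from `p` to `q`. -/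
def TwoAut.Reaches (M : TwoAut A B Q) : Q → Q → Prop := Relation.ReflTransGen M.Step

def TwoAut.StronglyConnected (M : TwoAut A B Q) : Prop := ∀ p q, M.Reaches p q

/-- Word read on the first tape by the first `n` transitions of `γ`. -/
def in1 (γ : ℕ → Q × (Option A × Option B) × Q) (n : ℕ) : List A :=
  ((List.range n).map fun i => (γ i).2.1.1).reduceOption

/-- Word read on the second tape by the first `n` transitions of `γ`. -/
def in2 (γ : ℕ → Q × (Option A × Option B) × Q) (n : ℕ) : List B :=
  ((List.range n).map fun i => (γ i).2.1.2).reduceOption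

/-- `γ` is an infinite run of `M` (not necessarily from the initial state) whose
two input labels are the infinite words `x` and `y`. -/
def TwoAut.IsRunOn (M : TwoAut A B Q) (γ : ℕ → Q × (Option A × Option B) × Q)
    (x : ℕ → A) (y : ℕ → B) : Prop :=
  (∀ n, γ n ∈ M.trans) ∧ (∀ n, (γ n).2.2 = (γ (n + 1)).1) ∧
  (∀ n, in1 γ n = pref x (in1 γ n).length) ∧ (∀ n, in2 γ n = pref y (in2 γ n).length) ∧
  Tendsto (fun n => (in1 γ n).length) atTop atTop ∧
  Tendsto (fun n => (in2 γ n).length) atTop atTop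

/-- The pair `(x, y)` is accepted by `M`. -/
def TwoAut.Accepts (M : TwoAut A B Q) (x : ℕ → A) (y : ℕ → B) : Prop :=
  ∃ γ, (γ 0).1 ∈ M.init ∧ M.IsRunOn γ x y

/-- Number of occurrences of the state `q` among the first `n` transitions of `γ`. -/
noncomputable def stateCount (γ : ℕ → Q × (Option A × Option B) × Q) (q : Q) (n : ℕ) : ℕ :=
  Nat.card {i : ℕ | i < n ∧ (γ i).1 = q}

/-- Number of occurrences of the transition `τ` among the first `n` transitions of `γ`. -/
noncomputable def transCount (γ : ℕ → Q × (Option A × Option B) × Q)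
    (τ : Q × (Option A × Option B) × Q) (n : ℕ) : ℕ :=
  Nat.card {i : ℕ | i < n ∧ γ i = τ}

/-! ### Markov chain associated with a one-symbol automaton -/

/-- The `(p,q)` entry of the Markov matrix associated with the transition set `T`. -/
noncomputable def markovOf {S : Type*} [Fintype A] [Fintype B]
    (T : Set (S × (Option A × Option B) × S)) (p q : S) : ℝ :=
  (Nat.card {a : A | (p, (some a, none), q) ∈ T} : ℝ) / (Fintype.card A : ℝ) +
  (Nat.card {b : B | (p, (none, some b), q) ∈ T} : ℝ) / (Fintype.card B : ℝ)

/-- `π` is a stationary distribution for the transition set `T` restricted to the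
finite state set `st`. -/
def IsStationaryOn {S : Type*} [Fintype A] [Fintype B]
    (T : Set (S × (Option A × Option B) × S)) (st : Finset S) (π : S → ℝ) : Prop :=
  (∀ s ∈ st, 0 ≤ π s) ∧ (∑ s ∈ st, π s = 1) ∧
  ∀ q ∈ st, (∑ p ∈ st, π p * markovOf T p q) = π q

/-- `π` is a stationary distribution of the Markov chain associated with `M`. -/
def TwoAut.IsStationary [Fintype A] [Fintype B] [Fintype Q]
    (M : TwoAut A B Q) (π : Q → ℝ) : Prop :=
  IsStationaryOn M.trans Finset.univ π

/-- The frequency property for the pair `(x, y)`: in every strongly connected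
`2`-deterministic `2`-automaton (reading one symbol per transition), every infinite run
on a suffix of `x` and a suffix of `y` visits each state with frequency given by the
stationary distribution, and the automaton is `2`-complete. -/
def FreqProp [Fintype A] [Fintype B] (x : ℕ → A) (y : ℕ → B) : Prop :=
  ∀ (Q' : Type) [Fintype Q'] (M : TwoAut A B Q'), M.TwoDet → M.OneSymbol →
    M.StronglyConnected →
    ∀ (i j : ℕ) (γ : ℕ → Q' × (Option A × Option B) × Q'),
      M.IsRunOn γ (fun n => x (n + i)) (fun n => y (n + j)) →
      M.TwoComplete ∧
      ∃ π : Q' → ℝ, M.IsStationary π ∧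
        ∀ q, Tendsto (fun n : ℕ => (stateCount γ q n : ℝ) / n) atTop (nhds (π q))

/-! ### Conditional compressors (2-deterministic 3-automata) -/

/-- A `3`-automaton with two input tapes (alphabets `A` and `B`) and one
output tape (alphabet `D`), with a single initial state. -/
structure Comp3 (A B D Q : Type*) where
  init : Q
  trans : Set (Q × (Option A × Option B) × List D × Q)

/-- `2`-determinism for `3`-automata. -/
def Comp3.TwoDet (C : Comp3 A B D Q) : Prop :=
  ∀ t ∈ C.trans, ∀ t' ∈ C.trans, t.1 = t'.1 →
    lsupp t.2.1 = lsupp t'.2.1 ∧ (t.2.1 = t'.2.1 → t = t')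

def c3in1 (γ : ℕ → Q × (Option A × Option B) × List D × Q) (n : ℕ) : List A :=
  ((List.range n).map fun i => (γ i).2.1.1).reduceOption

def c3in2 (γ : ℕ → Q × (Option A × Option B) × List D × Q) (n : ℕ) : List B :=
  ((List.range n).map fun i => (γ i).2.1.2).reduceOption

def c3out (γ : ℕ → Q × (Option A × Option B) × List D × Q) (n : ℕ) : List D :=
  ((List.range n).map fun i => (γ i).2.2.1).flatten

/-- `γ` is the accepting run of `C` on the pair `(x, y)`. -/
def Comp3.IsAccRunOn (C : Comp3 A B D Q) (γ : ℕ → Q × (Option A × Option B) × List D × Q)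
    (x : ℕ → A) (y : ℕ → B) : Prop :=
  (γ 0).1 = C.init ∧ (∀ n, γ n ∈ C.trans) ∧ (∀ n, (γ n).2.2.2 = (γ (n + 1)).1) ∧
  (∀ n, c3in1 γ n = pref x (c3in1 γ n).length) ∧
  (∀ n, c3in2 γ n = pref y (c3in2 γ n).length) ∧
  Tendsto (fun n => (c3in1 γ n).length) atTop atTop ∧
  Tendsto (fun n => (c3in2 γ n).length) atTop atTop ∧
  Tendsto (fun n => (c3out γ n).length) atTop atTop

/-- For every fixed second input `y`, the input-output map `x ↦ C(x,y)` is one-to-one. -/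
def Comp3.OneToOne (C : Comp3 A B D Q) : Prop :=
  ∀ (x x' : ℕ → A) (y : ℕ → B) γ γ', C.IsAccRunOn γ x y → C.IsAccRunOn γ' x' y →
    (∀ n, ∃ m, c3out γ n <+: c3out γ' m) → (∀ n, ∃ m, c3out γ' n <+: c3out γ m) →
    x = x'

/-- The conditional compression ratio `ρ(x/y)`: the infimum, over all conditional
compressors, of the compression ratio of `x` given the oracle `y`. -/
noncomputable def condRho [Fintype A] [Fintype B] (x : ℕ → A) (y : ℕ → B) : ℝ :=
  sInf {r : ℝ | ∃ (m d : ℕ), 2 ≤ d ∧ ∃ C : Comp3 A B (Fin d) (Fin m),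
    C.TwoDet ∧ C.OneToOne ∧ ∃ γ, C.IsAccRunOn γ x y ∧
      r = Filter.liminf (fun n : ℕ =>
        (((c3out γ n).length : ℝ) * Real.log d) /
        (((c3in1 γ n).length : ℝ) * Real.log (Fintype.card A))) atTop}

/-! ### Compressors (one-to-one 1-deterministic 2-automata) -/

/-- A `2`-automaton with one input tape (alphabet `A`) and one output tape
(alphabet `D`), with a single initial state. -/
structure Comp2 (A D Q : Type*) where
  init : Q
  trans : Set (Q × Option A × List D × Q)

def Comp2.OneDet (C : Comp2 A D Q) : Prop :=
  ∀ t ∈ C.trans, ∀ t' ∈ C.trans, t.1 = t'.1 →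
    t.2.1.isSome = t'.2.1.isSome ∧ (t.2.1 = t'.2.1 → t = t')

def c2in (γ : ℕ → Q × Option A × List D × Q) (n : ℕ) : List A :=
  ((List.range n).map fun i => (γ i).2.1).reduceOption

def c2out (γ : ℕ → Q × Option A × List D × Q) (n : ℕ) : List D :=
  ((List.range n).map fun i => (γ i).2.2.1).flatten

def Comp2.IsAccRunOn (C : Comp2 A D Q) (γ : ℕ → Q × Option A × List D × Q)
    (x : ℕ → A) : Prop :=
  (γ 0).1 = C.init ∧ (∀ n, γ n ∈ C.trans) ∧ (∀ n, (γ n).2.2.2 = (γ (n + 1)).1) ∧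
  (∀ n, c2in γ n = pref x (c2in γ n).length) ∧
  Tendsto (fun n => (c2in γ n).length) atTop atTop ∧
  Tendsto (fun n => (c2out γ n).length) atTop atTop

def Comp2.OneToOne (C : Comp2 A D Q) : Prop :=
  ∀ (x x' : ℕ → A) γ γ', C.IsAccRunOn γ x → C.IsAccRunOn γ' x' →
    (∀ n, ∃ m, c2out γ n <+: c2out γ' m) → (∀ n, ∃ m, c2out γ' n <+: c2out γ m) →
    x = x'

/-- The compression ratio `ρ(x)`. -/
noncomputable def rho [Fintype A] (x : ℕ → A) : ℝ :=
  sInf {r : ℝ | ∃ (m d : ℕ), 2 ≤ d ∧ ∃ C : Comp2 A (Fin d) (Fin m),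
    C.OneDet ∧ C.OneToOne ∧ ∃ γ, C.IsAccRunOn γ x ∧
      r = Filter.liminf (fun n : ℕ =>
        (((c2out γ n).length : ℝ) * Real.log d) /
        (((c2in γ n).length : ℝ) * Real.log (Fintype.card A))) atTop}

/-- Finite-state independence. -/
def FSIndep [Fintype A] [Fintype B] (x : ℕ → A) (y : ℕ → B) : Prop :=
  condRho x y = rho x ∧ condRho y x = rho y ∧ 0 < rho x ∧ 0 < rho y

/-! ### Oblivious selectors with two input tapes -/

/-- Types of states of a selector. -/
inductive SelTy | I | II | III

/-- An oblivious selector with first input alphabet `A` and second input alphabet `B`: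
at a state of type I it reads the next symbol of the first input and selects it, at a
state of type II it reads the next symbol of the first input without selecting it, and
at a state of type III it reads the next symbol of the second input. -/
structure Sel2 (A B : Type*) where
  states : ℕ
  init : Fin states
  ty : Fin states → SelTy
  δa : Fin states → A → Fin states
  δb : Fin states → B → Fin states

/-- Configuration (current state, symbols read from `x`, symbols read from `y`)
after `n` steps. -/
def Sel2.cfg (S : Sel2 A B) (x : ℕ → A) (y : ℕ → B) : ℕ → Fin S.states × ℕ × ℕ
  | 0 => (S.init, 0, 0)
  | n + 1 =>
    let c := S.cfg x y n
    match S.ty c.1 with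
    | SelTy.I => (S.δa c.1 (x c.2.1), c.2.1 + 1, c.2.2)
    | SelTy.II => (S.δa c.1 (x c.2.1), c.2.1 + 1, c.2.2)
    | SelTy.III => (S.δb c.1 (y c.2.2), c.2.1, c.2.2 + 1)

/-- The word selected from `x` during the first `n` steps. -/
def Sel2.outList (S : Sel2 A B) (x : ℕ → A) (y : ℕ → B) (n : ℕ) : List A :=
  (List.range n).filterMap fun i =>
    let c := S.cfg x y i
    match S.ty c.1 with
    | SelTy.I => some (x c.2.1)
    | SelTy.II => none
    | SelTy.III => none

/-! ### Oblivious one-input selection automata -/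

/-- An oblivious selection automaton with a single input tape. -/
structure Sel1 (B : Type*) where
  states : ℕ
  init : Fin states
  sel : Fin states → Bool
  δ : Fin states → B → Fin states

/-- State after reading the first `n` symbols of `y`. -/
def Sel1.st (S : Sel1 B) (y : ℕ → B) : ℕ → Fin S.states
  | 0 => S.init
  | n + 1 => S.δ (S.st y n) (y n)

/-- The word selected from the first `n` symbols of `y`. -/
def Sel1.outList (S : Sel1 B) (y : ℕ → B) (n : ℕ) : List B :=
  (List.range n).filterMap fun i => if S.sel (S.st y i) then some (y i) else none

/-! ### Shufflers -/

/-- A shuffler over the alphabet `A`: at a state of type I it reads, outputs and moves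
on the next symbol of the first input; at a state of type II it does so with the second
input. -/
structure Shuffler (A : Type*) where
  states : ℕ
  init : Fin states
  tyI : Fin states → Bool
  δ : Fin states → A → Fin states

/-- Configuration (current state, symbols read from `x`, symbols read from `y`)
after `n` steps. -/
def Shuffler.cfg (S : Shuffler A) (x y : ℕ → A) : ℕ → Fin S.states × ℕ × ℕ
  | 0 => (S.init, 0, 0)
  | n + 1 =>
    let c := S.cfg x y n
    if S.tyI c.1 then (S.δ c.1 (x c.2.1), c.2.1 + 1, c.2.2)
    else (S.δ c.1 (y c.2.2), c.2.1, c.2.2 + 1)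

/-- The output `S(x,y)` of the shuffler `S` on inputs `x` and `y`. -/
def Shuffler.out (S : Shuffler A) (x y : ℕ → A) (n : ℕ) : A :=
  let c := S.cfg x y n
  if S.tyI c.1 then x c.2.1 else y c.2.2

/-! ### Look-ahead automata -/

/-- The transitions of the look-ahead automaton `𝒜_{k,ℓ}`. -/
def lookTrans (M : TwoAut A B Q) (k ℓ : ℕ) :
    Set ((Q × List A × List B) × (Option A × Option B) × (Q × List A × List B)) :=
  {t | (∃ (q : Q) (u : List A) (a : A), u.length < k ∧
          t = ((q, u, []), (some a, none), (q, u ++ [a], ([] : List B)))) ∨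
       (∃ (q : Q) (u : List A) (v : List B) (b : B), u.length = k ∧ v.length < ℓ ∧
          t = ((q, u, v), (none, some b), (q, u, v ++ [b]))) ∨
       (∃ (q q' : Q) (a a' : A) (u' : List A) (v : List B),
          u'.length = k - 1 ∧ v.length = ℓ ∧ (q, (some a, none), q') ∈ M.trans ∧
          t = ((q, a :: u', v), (some a', none), (q', u' ++ [a'], v))) ∨
       (∃ (q q' : Q) (b b' : B) (u : List A) (v' : List B),
          u.length = k ∧ v'.length = ℓ - 1 ∧ (q, (none, some b), q') ∈ M.trans ∧
          t = ((q, u, b :: v'), (none, some b'), (q', u, v' ++ [b'])))}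

/-- The (finite) set of states of the look-ahead automaton with full buffers,
i.e. `Q × A^k × B^ℓ`. -/
noncomputable def fullFinset (Q A B : Type*) [Fintype Q] [Fintype A] [Fintype B]
    (k ℓ : ℕ) : Finset (Q × List A × List B) :=
  letI := Classical.decEq (Q × List A × List B)
  (Finset.univ : Finset (Q × (Fin k → A) × (Fin ℓ → B))).image
    fun s => (s.1, List.ofFn s.2.1, List.ofFn s.2.2)

/-! ### Counting words and measures -/

/-- The number of words of length `n` with exactly `i` occurrences of `γ`. -/
noncomputable def Ncount (γ : List A) (i n : ℕ) : ℕ :=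
  Nat.card {w : List A // w.length = n ∧ occ w γ = i}

/-- The cylinder of infinite words starting with `w`. -/
def cylinder (w : List A) : Set (ℕ → A) := {x : ℕ → A | pref x w.length = w}

/-- The set `E_S(ε,γ,n)` of pairs of inputs for which the frequency of `γ` in the first
`n` symbols of `S(x,y)` deviates from `|A|^{-|γ|}` by less than `ε`. -/
def Eset [Fintype A] (S : Shuffler A) (ε : ℝ) (γ : List A) (n : ℕ) :
    Set ((ℕ → A) × (ℕ → A)) :=
  {p : (ℕ → A) × (ℕ → A) |
    |(occ (pref (S.out p.1 p.2) n) γ : ℝ) - (n : ℝ) / (Fintype.card A : ℝ) ^ γ.length|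
      < ε * n}

/-- The set `F(ε,t,ℓ,n)`. -/
def Fset [Fintype A] (S : ℕ → Shuffler A) (ε : ℝ) (t ℓ n : ℕ) :
    Set ((ℕ → A) × (ℕ → A)) :=
  ⋂ i ∈ Finset.Icc 1 t, ⋂ r ∈ Finset.Icc 1 ℓ,
    ⋂ γ ∈ {γ : List A | γ.length = r}, Eset (S i) ε γ n

/-- `ℓ_n = (log_{|A|} n)/3`. -/
noncomputable def ellSeq (A : Type*) [Fintype A] (n : ℕ) : ℝ :=
  Real.logb (Fintype.card A) n / 3

/-- `ε_n = 2 √((log n · log_{|A|} n)/n)`. -/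
noncomputable def epsSeq (A : Type*) [Fintype A] (n : ℕ) : ℝ :=
  2 * Real.sqrt (Real.log n * Real.logb (Fintype.card A) n / n)

/-- `F_n = F(ε_n, t_n, ℓ_n, n)` with `t_n = n`. -/
noncomputable def Fn [Fintype A] (S : ℕ → Shuffler A) (n : ℕ) :
    Set ((ℕ → A) × (ℕ → A)) :=
  Fset S (epsSeq A n) n (⌊ellSeq A n⌋).toNat n

/-- `n_start`, the least `n` such that `ε_n ≥ 6/⌊n/ℓ_n⌋`. -/
noncomputable def nStart (A : Type*) [Fintype A] : ℕ :=
  sInf {m : ℕ | 0 < ⌊(m : ℝ) / ellSeq A m⌋ ∧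
    6 / ((⌊(m : ℝ) / ellSeq A m⌋ : ℤ) : ℝ) ≤ epsSeq A m}

/-- `G_n = ⋂_{j=0}^{n} F_{|A|^{n_0+j}}` where `|A|^{n_0} = n_start`. -/
noncomputable def Gn [Fintype A] (S : ℕ → Shuffler A) (n : ℕ) :
    Set ((ℕ → A) × (ℕ → A)) :=
  ⋂ j ∈ Finset.range (n + 1), Fn S (nStart A * Fintype.card A ^ j)

section

/-! ### Concatenations of sequences of words -/

/-- The concatenation of the first `n` words of the sequence `w`. -/
def fl (w : ℕ → List A) (n : ℕ) : List A := ((List.range n).map w).flatten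

@[simp] lemma fl_zero (w : ℕ → List A) : fl w 0 = [] := rfl

lemma fl_succ (w : ℕ → List A) (n : ℕ) : fl w (n + 1) = fl w n ++ w n := by
  simp [fl, List.range_succ]

lemma fl_add (w : ℕ → List A) (m n : ℕ) :
    fl w (m + n) = fl w m ++ fl (fun i => w (m + i)) n := by
  induction n with
  | zero => simp
  | succ n ih => rw [← add_assoc, fl_succ, ih, fl_succ, List.append_assoc]

lemma fl_isPrefix (w : ℕ → List A) {m n : ℕ} (h : m ≤ n) : fl w m <+: fl w n := by
  obtain ⟨k, rfl⟩ := Nat.exists_eq_add_of_le h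
  rw [fl_add]
  exact List.prefix_append _ _

lemma fl_length_mono (w : ℕ → List A) : Monotone fun n => (fl w n).length :=
  fun _ _ h => (fl_isPrefix w h).length_le

lemma reduceOption_eq_fl (o : ℕ → Option A) (n : ℕ) :
    ((List.range n).map o).reduceOption = fl (fun i => (o i).toList) n := by
  induction n with
  | zero => rfl
  | succ n ih =>
    rw [fl_succ, ← ih, List.range_succ, List.map_append, List.reduceOption_append]
    cases h : o n <;> simp [h, List.reduceOption]

lemma filterMap_eq_fl (o : ℕ → Option A) (n : ℕ) :
    (List.range n).filterMap o = fl (fun i => (o i).toList) n := by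
  rw [← reduceOption_eq_fl, List.reduceOption, List.filterMap_map]
  rfl

@[simp] lemma pref_length (x : ℕ → A) (n : ℕ) : (pref x n).length = n := by simp [pref]

lemma pref_succ (x : ℕ → A) (n : ℕ) : pref x (n + 1) = pref x n ++ [x n] := by
  simp [pref, List.range_succ]

lemma pref_add (x : ℕ → A) (m n : ℕ) :
    pref x (m + n) = pref x m ++ pref (fun i => x (m + i)) n := by
  induction n with
  | zero => simp [pref]
  | succ n ih => rw [← add_assoc, pref_succ, ih, pref_succ, List.append_assoc]

lemma pref_isPrefix (x : ℕ → A) {m n : ℕ} (h : m ≤ n) : pref x m <+: pref x n := by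
  obtain ⟨k, rfl⟩ := Nat.exists_eq_add_of_le h
  rw [pref_add]
  exact List.prefix_append _ _

lemma pref_getElem (x : ℕ → A) (n i : ℕ) (h : i < (pref x n).length) : (pref x n)[i] = x i := by
  simp [pref]

lemma eq_pref_of_isPrefix {l l' : List A} {x : ℕ → A} (h : l <+: l')
    (h' : l' = pref x l'.length) : l = pref x l.length := by
  have h1 := List.prefix_iff_eq_take.1 h
  have h2 := List.prefix_iff_eq_take.1 (pref_isPrefix x h.length_le)
  rw [← h'] at h2
  rw [pref_length] at h2
  exact h1.trans h2.symm

/-- A growing sequence of words converges to an infinite word. -/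
lemma exists_limit (w : ℕ → List A) (h : Tendsto (fun n => (fl w n).length) atTop atTop) :
    ∃ z : ℕ → A, ∀ n, fl w n = pref z (fl w n).length := by
  have h1 : ∀ i, ∃ n, i < (fl w n).length := fun i =>
    (h.eventually (eventually_gt_atTop i)).exists
  choose N hN using h1
  refine ⟨fun i => (fl w (N i))[i]'(hN i), fun n => ?_⟩
  apply List.ext_getElem (by simp)
  intro i hi hi'
  rw [pref_getElem]
  rcases le_total n (N i) with hle | hle
  · exact (fl_isPrefix w hle).getElem hi
  · exact ((fl_isPrefix w hle).getElem (hN i)).symm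

lemma pref_injective {x y : ℕ → A} (h : ∀ n, pref x n = pref y n) : x = y := by
  funext i
  have h2 : (pref x (i + 1))[i]? = (pref y (i + 1))[i]? := by rw [h]
  simpa [pref] using h2

/-- The infinite word obtained by putting the finite word `l` in front of `γ`. -/
def app (l : List Q) (γ : ℕ → Q) : ℕ → Q :=
  match l with
  | [] => γ
  | a :: l => fun n => Nat.casesOn n a (app l γ)

lemma app_cons_succ (a : Q) (l : List Q) (γ : ℕ → Q) (n : ℕ) :
    app (a :: l) γ (n + 1) = app l γ n := rfl

lemma app_add (l : List Q) (γ : ℕ → Q) (n : ℕ) : app l γ (l.length + n) = γ n := by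
  induction l with
  | nil => simp [app]
  | cons a l ih =>
    rw [List.length_cons, show l.length + 1 + n = l.length + n + 1 by ring, app_cons_succ, ih]

lemma fl_app (f : Q → List A) (l : List Q) (γ : ℕ → Q) :
    fl (fun i => f (app l γ i)) l.length = (l.map f).flatten := by
  induction l with
  | nil => rfl
  | cons a l ih =>
    rw [List.length_cons, add_comm, fl_add]
    simp only [add_comm 1, app_cons_succ, ih]
    simp [fl, app]

lemma fl_app_add (f : Q → List A) (l : List Q) (γ : ℕ → Q) (n : ℕ) :
    fl (fun i => f (app l γ i)) (l.length + n) =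
      (l.map f).flatten ++ fl (fun i => f (γ i)) n := by
  rw [fl_add, fl_app]
  simp only [app_add]

/-! ### Runs of transition systems -/

/-- `γ` is an infinite run from `p` in the transition set `T`. -/
def RunFrom {X : Type*} (T : Set (Q × X × List D × Q)) (p : Q)
    (γ : ℕ → Q × X × List D × Q) : Prop :=
  (γ 0).1 = p ∧ (∀ n, γ n ∈ T) ∧ ∀ n, (γ n).2.2.2 = (γ (n + 1)).1

/-- `l` is a finite run from `p` to `q` in the transition set `T`. -/
def IsPath {X : Type*} (T : Set (Q × X × List D × Q)) (p : Q) :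
    List (Q × X × List D × Q) → Q → Prop
  | [], q => p = q
  | e :: l, q => e ∈ T ∧ e.1 = p ∧ IsPath T e.2.2.2 l q

variable {X : Type*} {T : Set (Q × X × List D × Q)}

lemma RunFrom.app {p q : Q} {l : List (Q × X × List D × Q)} {γ : ℕ → Q × X × List D × Q}
    (hl : IsPath T p l q) (hγ : RunFrom T q γ) : RunFrom T p (app l γ) := by
  induction l generalizing p with
  | nil => cases hl; exact hγ
  | cons e l ih =>
    obtain ⟨he, rfl, hl⟩ := hl
    obtain ⟨h0, h1, h2⟩ := ih hl
    refine ⟨rfl, fun n => ?_, fun n => ?_⟩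
    · cases n with
      | zero => exact he
      | succ n => exact h1 n
    · cases n with
      | zero => exact h0.symm
      | succ n => exact h2 n

lemma IsPath.append {p q r : Q} {l l' : List (Q × X × List D × Q)}
    (h : IsPath T p l q) (h' : IsPath T q l' r) : IsPath T p (l ++ l') r := by
  induction l generalizing p with
  | nil => cases h; exact h'
  | cons e l ih => exact ⟨h.1, h.2.1, ih h.2.2⟩

lemma RunFrom.shift {p : Q} {γ : ℕ → Q × X × List D × Q} (h : RunFrom T p γ) (t : ℕ) :
    RunFrom T (γ t).1 fun i => γ (t + i) :=
  ⟨rfl, fun _ => h.2.1 _, fun _ => h.2.2 _⟩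

lemma RunFrom.isPath {p : Q} {γ : ℕ → Q × X × List D × Q} (h : RunFrom T p γ) (n : ℕ) :
    IsPath T p (pref γ n) (γ n).1 := by
  induction n with
  | zero => exact h.1.symm
  | succ n ih =>
    rw [pref_succ]
    exact ih.append ⟨h.2.1 n, rfl, h.2.2 n⟩

/-- Lengths of two sequences of concatenations that eventually agree up to a shift and additive
constants tend to infinity simultaneously. -/
lemma tendsto_length_app {E : Type*} (f : E → List A) (l : List E) (γ : ℕ → E) (t : ℕ)
    (h : Tendsto (fun n => (fl (fun i => f (γ i)) n).length) atTop atTop) :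
    Tendsto (fun n => (fl (fun i => f (app l (fun i => γ (t + i)) i)) n).length) atTop atTop := by
  rw [← tendsto_add_atTop_iff_nat l.length]
  have h1 := (tendsto_add_atTop_iff_nat t).2 h
  refine tendsto_atTop_mono' atTop (f₁ := fun n => (fl (fun i => f (γ i)) (n + t)).length -
    (fl (fun i => f (γ i)) t).length) (Eventually.of_forall fun n => ?_)
    (tendsto_atTop_atTop.2 fun b => ?_)
  · beta_reduce
    rw [add_comm n l.length, fl_app_add, add_comm n t, fl_add]
    simp
  · obtain ⟨i, hi⟩ := tendsto_atTop_atTop.1 h1 (b + (fl (fun i => f (γ i)) t).length)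
    exact ⟨i, fun a ha => Nat.le_sub_of_add_le (hi a ha)⟩

/-- If two runs have the same tail and equal labels before it, then they have the same limit
label. -/
lemma fl_app_isPrefix {E : Type*} (f : E → List A) {l l' : List E} (γ : ℕ → E)
    (h : (l.map f).flatten = (l'.map f).flatten) (n : ℕ) :
    ∃ m, fl (fun i => f (app l γ i)) n <+: fl (fun i => f (app l' γ i)) m := by
  refine ⟨l'.length + n, ?_⟩
  rw [fl_app_add, ← h, ← fl_app_add]
  exact fl_isPrefix _ (Nat.le_add_left _ _)

end

section

/-! ### Kraft-type and Jensen-type inequalities -/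

open Classical in
/-- The finite set of words of length at most `N`. -/
noncomputable def wordsUpTo (A : Type*) [Fintype A] (N : ℕ) : Finset (List A) :=
  (Finset.range (N + 1)).biUnion fun j => Finset.univ.image (List.ofFn : (Fin j → A) → List A)

lemma mem_wordsUpTo [Fintype A] {N : ℕ} {l : List A} : l ∈ wordsUpTo A N ↔ l.length ≤ N := by
  simp only [wordsUpTo, Finset.mem_biUnion, Finset.mem_range, Finset.mem_image, Finset.mem_univ,
    true_and]
  constructor
  · rintro ⟨j, hj, f, rfl⟩
    simpa using Nat.lt_succ_iff.1 hj
  · exact fun h => ⟨l.length, Nat.lt_succ_iff.2 h, l.get, List.ofFn_get l⟩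

lemma sum_wordsUpTo_le [Fintype A] [Nonempty A] (N : ℕ) :
    ∑ l ∈ wordsUpTo A N, ((Fintype.card A : ℝ)⁻¹) ^ l.length ≤ N + 1 := by
  classical
  have hpos : (0 : ℝ) < Fintype.card A := by exact_mod_cast Fintype.card_pos
  rw [wordsUpTo]
  rw [Finset.sum_biUnion fun i _ j _ hij => ?_]
  swap
  · refine Finset.disjoint_left.2 fun l hl hl' => hij ?_
    obtain ⟨f, -, rfl⟩ := Finset.mem_image.1 hl
    obtain ⟨g, -, hg⟩ := Finset.mem_image.1 hl'
    simpa using (congrArg List.length hg).symm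
  calc _ ≤ ∑ j ∈ Finset.range (N + 1), (1 : ℝ) := by
        refine Finset.sum_le_sum fun j _ => ?_
        rw [Finset.sum_image fun f _ g _ h => List.ofFn_injective h]
        simp [hpos.ne']
    _ = N + 1 := by simp

/-- A weak form of Kraft's inequality, for pairs of words of bounded length attained boundedly
often. -/
lemma kraft {ι : Type*} [Fintype A] [Nonempty A] [Fintype B] [Nonempty B] (s : Finset ι)
    (f : ι → List A) (g : ι → List B) (M N c : ℕ) (hf : ∀ i ∈ s, (f i).length ≤ M)
    (hg : ∀ i ∈ s, (g i).length ≤ N)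
    (hc : ∀ (t : Finset ι) (v : List A) (w : List B), t ⊆ s →
      (∀ i ∈ t, f i = v ∧ g i = w) → t.card ≤ c) :
    ∑ i ∈ s, ((Fintype.card A : ℝ)⁻¹) ^ (f i).length * ((Fintype.card B : ℝ)⁻¹) ^ (g i).length ≤
      c * ((M + 1) * (N + 1)) := by
  classical
  have hA : (0 : ℝ) < Fintype.card A := by exact_mod_cast Fintype.card_pos
  have hB : (0 : ℝ) < Fintype.card B := by exact_mod_cast Fintype.card_pos
  set F : List A × List B → ℝ := fun p =>
    ((Fintype.card A : ℝ)⁻¹) ^ p.1.length * ((Fintype.card B : ℝ)⁻¹) ^ p.2.length with hF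
  have hF0 : ∀ p, 0 ≤ F p := fun p => by positivity
  have hmap : ∀ i ∈ s, (f i, g i) ∈ wordsUpTo A M ×ˢ wordsUpTo B N := fun i hi =>
    Finset.mem_product.2 ⟨mem_wordsUpTo.2 (hf i hi), mem_wordsUpTo.2 (hg i hi)⟩
  calc _ = ∑ p ∈ wordsUpTo A M ×ˢ wordsUpTo B N, ∑ i ∈ s with (f i, g i) = p, F (f i, g i) :=
        (Finset.sum_fiberwise_of_maps_to hmap _).symm
    _ ≤ ∑ p ∈ wordsUpTo A M ×ˢ wordsUpTo B N, c * F p := by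
        refine Finset.sum_le_sum fun p _ => ?_
        rw [Finset.sum_congr rfl fun i hi => by rw [(Finset.mem_filter.1 hi).2],
          Finset.sum_const, nsmul_eq_mul]
        refine mul_le_mul_of_nonneg_right ?_ (hF0 p)
        exact_mod_cast hc _ p.1 p.2 (Finset.filter_subset _ _) fun i hi =>
          Prod.ext_iff.1 (Finset.mem_filter.1 hi).2
    _ = c * ((∑ v ∈ wordsUpTo A M, ((Fintype.card A : ℝ)⁻¹) ^ v.length) *
          ∑ w ∈ wordsUpTo B N, ((Fintype.card B : ℝ)⁻¹) ^ w.length) := by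
        rw [← Finset.mul_sum, Finset.sum_mul_sum, Finset.sum_product]
    _ ≤ _ := by
        gcongr
        · exact sum_wordsUpTo_le M
        · exact sum_wordsUpTo_le N

/-- The average of a function over a finite set. -/
noncomputable def avg {ι : Type*} (s : Finset ι) (f : ι → ℝ) : ℝ := (∑ i ∈ s, f i) / s.card

section avg
variable {ι : Type*}

lemma avg_log_le {s : Finset ι} (hs : s.Nonempty) {f : ι → ℝ} (hf : ∀ i ∈ s, 0 < f i) :
    avg s (fun i => Real.log (f i)) ≤ Real.log (avg s f) := by
  have hc : (0 : ℝ) < s.card := by exact_mod_cast hs.card_pos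
  have h := strictConcaveOn_log_Ioi.concaveOn.le_map_sum (t := s) (w := fun _ => (s.card : ℝ)⁻¹)
    (p := f) (fun _ _ => by positivity) (by simp [hc.ne']) hf
  simpa [avg, div_eq_inv_mul, Finset.mul_sum] using h

lemma avg_mono {s : Finset ι} {f g : ι → ℝ} (h : ∀ i ∈ s, f i ≤ g i) : avg s f ≤ avg s g := by
  unfold avg
  gcongr with i hi
  exact h i hi

lemma avg_add (s : Finset ι) (f g : ι → ℝ) : avg s (fun i => f i + g i) = avg s f + avg s g := by
  simp only [avg, Finset.sum_add_distrib, add_div]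

lemma avg_sub (s : Finset ι) (f g : ι → ℝ) : avg s (fun i => f i - g i) = avg s f - avg s g := by
  simp only [avg, Finset.sum_sub_distrib, sub_div]

lemma avg_neg (s : Finset ι) (f : ι → ℝ) : avg s (fun i => -f i) = -avg s f := by
  simp only [avg, Finset.sum_neg_distrib, neg_div]

lemma avg_const {s : Finset ι} (hs : s.Nonempty) (c : ℝ) : avg s (fun _ => c) = c := by
  have hc : (s.card : ℝ) ≠ 0 := by exact_mod_cast hs.card_pos.ne'
  simp [avg, hc]

lemma avg_indicator [DecidableEq ι] {s : Finset ι} {j : ι} (hj : j ∈ s) (c : ℝ) :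
    avg s (fun i => if i = j then c else 0) = c / s.card := by
  simp [avg, hj]

end avg

/-! ### Elementary limits -/

lemma tendsto_log_div_atTop (a : ℝ) (ha : 0 < a) (k : ℕ) :
    Tendsto (fun N : ℕ => Real.log (a * (N + 1 : ℝ) ^ k) / N) atTop (𝓝 0) := by
  have h1 : Tendsto (fun N : ℕ => Real.log (N + 1 : ℝ) / (N + 1 : ℝ)) atTop (𝓝 0) := by
    have h := Real.isLittleO_log_id_atTop.tendsto_div_nhds_zero.comp
      (tendsto_natCast_atTop_atTop (R := ℝ))
    have h' := (tendsto_add_atTop_iff_nat 1).2 h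
    simpa [Function.comp_def] using h'
  have h2 : Tendsto (fun N : ℕ => ((N : ℝ) + 1) / N) atTop (𝓝 1) := by
    have h : Tendsto (fun N : ℕ => 1 + 1 / (N : ℝ)) atTop (𝓝 (1 + 0)) :=
      tendsto_const_nhds.add tendsto_one_div_atTop_nhds_zero_nat
    rw [add_zero] at h
    refine h.congr' ?_
    filter_upwards [eventually_gt_atTop 0] with N hN
    have : (N : ℝ) ≠ 0 := by positivity
    field_simp
  have h3 : Tendsto (fun N : ℕ => Real.log a / N) atTop (𝓝 0) :=
    tendsto_const_div_atTop_nhds_zero_nat _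
  have h4 := h3.add (((h1.mul h2).const_mul (k : ℝ)))
  simp only [zero_mul, mul_zero, add_zero] at h4
  refine h4.congr' ?_
  filter_upwards [eventually_gt_atTop 0] with N hN
  have : (N : ℝ) ≠ 0 := by positivity
  rw [Real.log_mul ha.ne' (by positivity), Real.log_pow]
  field_simp

lemma tendsto_bounded_div {f : ℕ → ℝ} {C : ℝ} (h : ∀ n, |f n| ≤ C) :
    Tendsto (fun n : ℕ => f n / n) atTop (𝓝 0) := by
  refine squeeze_zero_norm (a := fun n : ℕ => C / n) (fun n => ?_)
    (tendsto_const_div_atTop_nhds_zero_nat C)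
  rw [norm_div, Real.norm_eq_abs, Real.norm_natCast]
  gcongr
  exact h n

/-- If `g k / k → 0` then `g (c n) / n → 0` for every `c` with `c n ≤ K n`. -/
lemma tendsto_comp_div {g : ℕ → ℝ} (hg : Tendsto (fun n : ℕ => g n / n) atTop (𝓝 0))
    {c : ℕ → ℕ} {K : ℕ} (hc : ∀ n, c n ≤ K * n) :
    Tendsto (fun n : ℕ => g (c n) / n) atTop (𝓝 0) := by
  rw [Metric.tendsto_atTop]
  intro ε hε
  obtain ⟨N, hN⟩ := Metric.tendsto_atTop.1 hg (ε / (K + 1)) (by positivity)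
  set C := ∑ k ∈ Finset.range (N + 1), |g k| with hC
  have hC0 : 0 ≤ C := Finset.sum_nonneg fun _ _ => abs_nonneg _
  obtain ⟨n₀, hn₀⟩ := exists_nat_gt (C / ε)
  refine ⟨n₀ + 1, fun n hn => ?_⟩
  have hn' : (n₀ : ℝ) + 1 ≤ n := by exact_mod_cast hn
  have hnpos : (0 : ℝ) < n := by linarith [Nat.cast_nonneg (α := ℝ) n₀]
  rw [Real.dist_eq, sub_zero, abs_div, Nat.abs_cast, div_lt_iff₀ hnpos]
  by_cases h : c n ≤ N
  · have h1 : |g (c n)| ≤ C := Finset.single_le_sum (f := fun k => |g k|)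
      (fun _ _ => abs_nonneg _) (Finset.mem_range.2 (Nat.lt_succ_iff.2 h))
    have : C < ε * n := by
      have := (div_lt_iff₀ hε).1 hn₀
      nlinarith
    linarith
  · have h1 := hN (c n) (by omega)
    have hcpos : (0 : ℝ) < c n := by
      have : 0 < c n := by omega
      exact_mod_cast this
    rw [Real.dist_eq, sub_zero, abs_div, Nat.abs_cast, div_lt_iff₀ hcpos] at h1
    have h2 : (c n : ℝ) ≤ K * n := by exact_mod_cast hc n
    have h3 : ε / (K + 1) * c n ≤ ε / (K + 1) * (K * n) := by gcongr
    have h4 : ε / (K + 1) * (K * n) ≤ ε * n := by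
      rw [div_mul_eq_mul_div, div_le_iff₀ (by positivity)]
      nlinarith [mul_pos hε hnpos]
    linarith

end

section

/-! ### Equidistributed deterministic processes -/

/-- The labels `l` chosen along the sequence of states `s` behave on average as if they were
uniformly distributed over the finite sets `Λ q` of labels allowed at the states `q`. -/
def Equi {L : Type*} (Λ : Q → Finset L) (s : ℕ → Q) (l : ℕ → L) : Prop :=
  ∀ F : Q → L → ℝ, Tendsto (fun n : ℕ =>
    (∑ i ∈ Finset.range n, (F (s i) (l i) - avg (Λ (s i)) (F (s i)))) / n) atTop (𝓝 0)

open Classical in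
/-- The number of visits to `q` among the first `n` terms of `s`. -/
noncomputable def visits (s : ℕ → Q) (q : Q) (n : ℕ) : ℝ :=
  ∑ i ∈ Finset.range n, if s i = q then 1 else 0

lemma visits_nonneg (s : ℕ → Q) (q : Q) (n : ℕ) : 0 ≤ visits s q n :=
  Finset.sum_nonneg fun _ _ => by split_ifs <;> norm_num

namespace Equi
variable {L : Type*} {Λ : Q → Finset L} {s : ℕ → Q} {l : ℕ → L}

open Classical in
/-- The number of times the label `a` is chosen at `p` is asymptotically a fixed proportion of the
number of visits to `p`. -/
lemma tendsto_indicator (h : Equi Λ s l) {p : Q} {a : L} (ha : a ∈ Λ p) :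
    Tendsto (fun n : ℕ => ((∑ i ∈ Finset.range n, if s i = p ∧ l i = a then (1 : ℝ) else 0) -
      visits s p n / (Λ p).card) / n) atTop (𝓝 0) := by
  refine (h fun q' l' => if q' = p ∧ l' = a then 1 else 0).congr fun n => ?_
  rw [Finset.sum_sub_distrib]
  congr 2
  rw [visits, Finset.sum_div]
  refine Finset.sum_congr rfl fun i _ => ?_
  by_cases hi : s i = p
  · subst hi
    simpa using avg_indicator ha 1
  · simp [hi, avg]

lemma visits_tendsto_zero_of_succ (h : Equi Λ s l) (hl : ∀ i, l i ∈ Λ (s i)) {nxt : Q → L → Q}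
    (hn : ∀ i, s (i + 1) = nxt (s i) (l i)) {G : Filter ℕ} (hG : G ≤ atTop) (j : ℕ)
    (hj : Tendsto (fun n : ℕ => visits s (s (j + 1)) n / n) G (𝓝 0)) :
    Tendsto (fun n : ℕ => visits s (s j) n / n) G (𝓝 0) := by
  classical
  have h1 := (h.tendsto_indicator (hl j)).mono_left hG
  have h2 : Tendsto (fun n : ℕ => 1 / (n : ℝ)) G (𝓝 0) :=
    tendsto_one_div_atTop_nhds_zero_nat.mono_left hG
  set Λc : ℝ := ((Λ (s j)).card : ℝ) with hΛ
  have hΛpos : 0 < Λc := by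
    have : 0 < (Λ (s j)).card := Finset.card_pos.2 ⟨_, hl j⟩
    rw [hΛ]
    exact_mod_cast this
  have h3 := ((hj.add h2).sub h1).const_mul Λc
  simp only [add_zero, sub_zero, mul_zero] at h3
  refine squeeze_zero (fun n => div_nonneg (visits_nonneg _ _ _) (Nat.cast_nonneg _))
    (fun n => ?_) h3
  have h4 : (∑ i ∈ Finset.range n, if s i = s j ∧ l i = l j then (1 : ℝ) else 0) ≤
      visits s (s (j + 1)) n + 1 := by
    have h5 : visits s (s (j + 1)) (n + 1) ≤ visits s (s (j + 1)) n + 1 := by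
      rw [visits, Finset.sum_range_succ, visits]
      gcongr
      split_ifs <;> norm_num
    refine le_trans ?_ h5
    rw [visits, Finset.sum_range_succ']
    refine le_add_of_le_of_nonneg (Finset.sum_le_sum fun i _ => ?_) (by split_ifs <;> norm_num)
    split_ifs with h6 h7
    · exact le_rfl
    · exact absurd (by rw [hn, hn, h6.1, h6.2]) h7
    · norm_num
    · exact le_rfl
  rcases Nat.eq_zero_or_pos n with rfl | hn0
  · simp
  have hn0 : (0 : ℝ) < n := by exact_mod_cast hn0
  rw [← add_div, ← sub_div, ← mul_div_assoc]
  gcongr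
  rw [mul_sub, mul_sub, mul_div_cancel₀ _ hΛpos.ne']
  nlinarith

/-- States visited infinitely often are visited with positive frequency. -/
lemma exists_pos [Finite Q] (h : Equi Λ s l) (hl : ∀ i, l i ∈ Λ (s i)) {nxt : Q → L → Q}
    (hn : ∀ i, s (i + 1) = nxt (s i) (l i)) {q : Q} (hq : ∃ᶠ i in atTop, s i = q) :
    ∃ c > 0, ∀ᶠ n : ℕ in atTop, c * n ≤ visits s q n := by
  classical
  by_contra hcon
  push Not at hcon
  have hclus : MapClusterPt 0 atTop fun n : ℕ => visits s q n / n := by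
    rw [mapClusterPt_iff_frequently]
    intro S hS
    obtain ⟨ε, hε, hS⟩ := Metric.mem_nhds_iff.1 hS
    refine (hcon ε hε).mono fun n hn => hS ?_
    have hn0 : (0 : ℝ) < n := by
      rcases Nat.eq_zero_or_pos n with rfl | h0
      · simp [visits] at hn
      · exact_mod_cast h0
    rw [Metric.mem_ball, Real.dist_eq, sub_zero,
      abs_of_nonneg (div_nonneg (visits_nonneg _ _ _) hn0.le), div_lt_iff₀ hn0]
    exact hn
  obtain ⟨U, hU, hUt⟩ := mapClusterPt_iff_ultrafilter.1 hclus
  have hzero : ∀ i, Tendsto (fun n : ℕ => visits s (s i) n / n) U (𝓝 0) := by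
    intro i
    obtain ⟨j, hj, rfl⟩ := frequently_atTop.1 hq i
    obtain ⟨k, rfl⟩ := Nat.exists_eq_add_of_le hj
    clear hj hq hclus hcon
    induction k with
    | zero => exact hUt
    | succ k ih => exact ih (h.visits_tendsto_zero_of_succ hl hn hU _ hUt)
  have := Fintype.ofFinite Q
  have hz' : ∀ p, Tendsto (fun n : ℕ => visits s p n / n) U (𝓝 0) := by
    intro p
    by_cases hp : ∃ i, s i = p
    · obtain ⟨i, rfl⟩ := hp
      exact hzero i
    · push Not at hp
      simp [visits, hp]
  have hsum := tendsto_finsetSum Finset.univ fun p _ => hz' p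
  rw [Finset.sum_const_zero] at hsum
  have hone : Tendsto (fun n : ℕ => ∑ p : Q, visits s p n / n) U (𝓝 1) := by
    refine (tendsto_congr' ?_).2 tendsto_const_nhds
    filter_upwards [hU (eventually_gt_atTop 0)] with n hn0
    have hn0 : (n : ℝ) ≠ 0 := by
      have : 0 < n := hn0
      positivity
    rw [← Finset.sum_div]
    simp only [visits]
    rw [Finset.sum_comm]
    simp [hn0]
  exact zero_ne_one (tendsto_nhds_unique hsum hone)

/-- At a state visited infinitely often, every allowed label is chosen infinitely often. -/
lemma frequently_label [Finite Q] (h : Equi Λ s l) (hl : ∀ i, l i ∈ Λ (s i)) {nxt : Q → L → Q}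
    (hn : ∀ i, s (i + 1) = nxt (s i) (l i)) {q : Q} (hq : ∃ᶠ i in atTop, s i = q) {a : L}
    (ha : a ∈ Λ q) : ∃ᶠ i in atTop, s i = q ∧ l i = a := by
  classical
  obtain ⟨c, hc, hpos⟩ := h.exists_pos hl hn hq
  by_contra hcon
  obtain ⟨N, hN⟩ := eventually_atTop.1 (not_frequently.1 hcon)
  have hb : ∀ n, |∑ i ∈ Finset.range n, if s i = q ∧ l i = a then (1 : ℝ) else 0| ≤ N := by
    intro n
    rw [abs_of_nonneg (Finset.sum_nonneg fun _ _ => by split_ifs <;> norm_num),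
      Finset.sum_boole]
    have : (Finset.range n).filter (fun i => s i = q ∧ l i = a) ⊆ Finset.range N := by
      intro i hi
      by_contra hi'
      exact hN i (by simpa using hi') (Finset.mem_filter.1 hi).2
    exact_mod_cast (Finset.card_le_card this).trans (Finset.card_range N).le
  have hΛ : (0 : ℝ) < (Λ q).card := by
    have : 0 < (Λ q).card := Finset.card_pos.2 ⟨_, ha⟩
    exact_mod_cast this
  have h1 := ((tendsto_bounded_div hb).sub (h.tendsto_indicator ha)).const_mul ((Λ q).card : ℝ)
  simp only [sub_zero, mul_zero] at h1
  refine absurd (ge_of_tendsto h1 (b := c) ?_) (not_le.2 hc)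
  filter_upwards [hpos, eventually_gt_atTop 0] with n hn1 hn0
  have hn0 : (0 : ℝ) < n := by exact_mod_cast hn0
  rw [← sub_div, sub_sub_cancel, ← mul_div_assoc, mul_div_cancel₀ _ hΛ.ne', le_div_iff₀ hn0]
  exact hn1

/-- Averaging a function of the next state does not change its mean along the sequence. -/
lemma tendsto_invariant [Finite Q] (h : Equi Λ s l) {nxt : Q → L → Q}
    (hn : ∀ i, s (i + 1) = nxt (s i) (l i)) (f : Q → ℝ) :
    Tendsto (fun n : ℕ => (∑ i ∈ Finset.range n,
      (f (s i) - avg (Λ (s i)) fun a => f (nxt (s i) a))) / n) atTop (𝓝 0) := by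
  have := Fintype.ofFinite Q
  have h1 := h fun q a => f (nxt q a)
  have h2 : Tendsto (fun n : ℕ => (f (s n) - f (s 0)) / n) atTop (𝓝 0) := by
    refine tendsto_bounded_div (C := ∑ q, |f q| + ∑ q, |f q|) fun n => ?_
    refine (abs_sub _ _).trans (add_le_add ?_ ?_) <;>
    exact Finset.single_le_sum (f := fun q => |f q|) (fun _ _ => abs_nonneg _)
      (Finset.mem_univ _)
  have h3 := h1.sub h2
  rw [sub_zero] at h3
  refine h3.congr fun n => ?_
  rw [← sub_div, ← Finset.sum_range_sub (fun i => f (s i)), ← Finset.sum_sub_distrib]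
  congr 1
  refine Finset.sum_congr rfl fun i _ => ?_
  rw [← hn]
  ring

end Equi

/-! ### Deterministic machines reading two words -/

/-- A deterministic machine reading one symbol of one of its two inputs at each step. -/
structure Mach (A B Q : Type*) where
  init : Q
  rd : Q → Bool
  δa : Q → A → Q
  δb : Q → B → Q

namespace Mach

/-- Configuration (current state, symbols read from `x`, symbols read from `y`) after `n` steps. -/
def cfg (M : Mach A B Q) (x : ℕ → A) (y : ℕ → B) : ℕ → Q × ℕ × ℕ
  | 0 => (M.init, 0, 0)
  | n + 1 =>
    let c := M.cfg x y n
    if M.rd c.1 then (M.δa c.1 (x c.2.1), c.2.1 + 1, c.2.2)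
    else (M.δb c.1 (y c.2.2), c.2.1, c.2.2 + 1)

/-- The deviation from its average of `F` evaluated at the `n`-th step if that step reads from the
first input, and `0` otherwise. -/
noncomputable def dev [Fintype A] (M : Mach A B Q) (x : ℕ → A) (y : ℕ → B) (F : Q → A → ℝ)
    (n : ℕ) : ℝ :=
  let c := M.cfg x y n
  if M.rd c.1 then F c.1 (x c.2.1) - avg Finset.univ (F c.1) else 0

/-- The machine with exchanged inputs. -/
def swap (M : Mach A B Q) : Mach B A Q := ⟨M.init, fun q => !M.rd q, M.δb, M.δa⟩

@[simp] lemma swap_rd (M : Mach A B Q) (q : Q) : M.swap.rd q = !M.rd q := rfl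
@[simp] lemma swap_δa (M : Mach A B Q) : M.swap.δa = M.δb := rfl
@[simp] lemma swap_δb (M : Mach A B Q) : M.swap.δb = M.δa := rfl

variable (M : Mach A B Q) (x : ℕ → A) (y : ℕ → B)

lemma cfg_succ_of_rd {n : ℕ} (h : M.rd (M.cfg x y n).1 = true) :
    M.cfg x y (n + 1) = (M.δa (M.cfg x y n).1 (x (M.cfg x y n).2.1), (M.cfg x y n).2.1 + 1,
      (M.cfg x y n).2.2) := by
  simp [cfg, h]

lemma cfg_succ_of_not_rd {n : ℕ} (h : M.rd (M.cfg x y n).1 = false) :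
    M.cfg x y (n + 1) = (M.δb (M.cfg x y n).1 (y (M.cfg x y n).2.2), (M.cfg x y n).2.1,
      (M.cfg x y n).2.2 + 1) := by
  simp [cfg, h]

lemma swap_cfg (n : ℕ) :
    M.swap.cfg y x n = ((M.cfg x y n).1, (M.cfg x y n).2.2, (M.cfg x y n).2.1) := by
  induction n with
  | zero => rfl
  | succ n ih => cases h : M.rd (M.cfg x y n).1 <;> simp [cfg, ih, h]

end Mach

universe w in
/-- The symbols of `x` read by a finite deterministic machine with oracle `y` are asymptotically
unpredictable. -/
def Unpredictable [Fintype A] (x : ℕ → A) (y : ℕ → B) : Prop :=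
  ∀ (Q : Type w) [Finite Q] (M : Mach A B Q) (F : Q → A → ℝ),
    Tendsto (fun n : ℕ => (∑ i ∈ Finset.range n, M.dev x y F i) / n) atTop (𝓝 0)

/-- The symbol read at each step of a machine. -/
def Mach.label (M : Mach A B Q) (x : ℕ → A) (y : ℕ → B) (n : ℕ) : A ⊕ B :=
  if M.rd (M.cfg x y n).1 then .inl (x (M.cfg x y n).2.1) else .inr (y (M.cfg x y n).2.2)

/-- The symbols that can be read in a state. -/
def Mach.labels [Fintype A] [Fintype B] (M : Mach A B Q) (q : Q) : Finset (A ⊕ B) :=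
  if M.rd q then Finset.univ.map Function.Embedding.inl
  else Finset.univ.map Function.Embedding.inr

universe w in
lemma Mach.equi {Q : Type w} [Finite Q] [Fintype A] [Fintype B] (M : Mach A B Q) {x : ℕ → A}
    {y : ℕ → B} (hx : Unpredictable.{w} x y) (hy : Unpredictable.{w} y x) :
    Equi M.labels (fun n => (M.cfg x y n).1) (M.label x y) := by
  intro F
  have h := (hx Q M fun q a => F q (.inl a)).add (hy Q M.swap fun q b => F q (.inr b))
  rw [add_zero] at h
  refine h.congr fun n => ?_
  rw [← add_div, ← Finset.sum_add_distrib]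
  congr 1
  refine Finset.sum_congr rfl fun i _ => ?_
  cases hr : M.rd (M.cfg x y i).1 <;>
    simp [Mach.dev, Mach.swap_cfg, Mach.labels, Mach.label, hr, avg]

end

section

/-! ### Selected words -/

lemma fl_toList_length_le (o : ℕ → Option A) (n : ℕ) :
    (fl (fun i => (o i).toList) n).length ≤ n := by
  induction n with
  | zero => simp
  | succ n ih => rw [fl_succ]; cases o n <;> simp <;> omega

/-- Sums over the selected symbols, computed along the process or along the selected word. -/
lemma sum_selected {o : ℕ → Option A} {z : ℕ → A}
    (hz : ∀ n, fl (fun i => (o i).toList) n = pref z (fl (fun i => (o i).toList) n).length)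
    (g : ℕ → A → ℝ) (n : ℕ) :
    ∑ i ∈ Finset.range n, (o i).elim 0 (g (fl (fun i => (o i).toList) i).length) =
      ∑ j ∈ Finset.range (fl (fun i => (o i).toList) n).length, g j (z j) := by
  induction n with
  | zero => simp
  | succ n ih =>
    have h := hz (n + 1)
    rw [Finset.sum_range_succ, ih]
    rw [fl_succ] at h ⊢
    cases ho : o n with
    | none => simp
    | some a =>
      simp only [ho, Option.toList_some, List.length_append, List.length_singleton, pref_succ] at h
      rw [← hz n] at h
      simp only [List.append_cancel_left_eq, List.cons.injEq, and_true] at h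
      simp [Finset.sum_range_succ, h]

lemma abs_sum_selected_le [Fintype A] (o : ℕ → Option A) (g : A → ℝ) :
    ∃ K : ℝ, 0 ≤ K ∧ ∀ n, |∑ i ∈ Finset.range n, (o i).elim 0 g| ≤
      K * (fl (fun i => (o i).toList) n).length := by
  refine ⟨∑ a, |g a|, Finset.sum_nonneg fun _ _ => abs_nonneg _, fun n => ?_⟩
  induction n with
  | zero => simp
  | succ n ih =>
    rw [Finset.sum_range_succ, fl_succ]
    refine (abs_add_le _ _).trans ?_
    cases o n with
    | none => simpa using ih
    | some a =>
      have : |g a| ≤ ∑ a, |g a| :=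
        Finset.single_le_sum (f := fun a => |g a|) (fun _ _ => abs_nonneg _) (Finset.mem_univ a)
      simp only [Option.elim_some, Option.toList_some, List.length_append,
        List.length_singleton, Nat.cast_add, Nat.cast_one, mul_add, mul_one]
      exact add_le_add ih this

open Classical in
/-- Aligned occurrences are counted by the blocks of the infinite word. -/
lemma alocc_pref (z : ℕ → A) {u : List A} {ℓ : ℕ} (hℓ : 1 ≤ ℓ) (hu : u.length = ℓ) (m : ℕ) :
    (alocc (pref z (m * ℓ)) u : ℝ) =
      ∑ k ∈ Finset.range m, if pref (fun i => z (k * ℓ + i)) ℓ = u then (1 : ℝ) else 0 := by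
  subst hu
  rw [Finset.sum_boole, alocc]
  have h : {i : ℕ | i + u.length ≤ (pref z (m * u.length)).length ∧ i % u.length = 0 ∧
      ((pref z (m * u.length)).drop i).take u.length = u} =
      ↑(((Finset.range m).filter fun k => pref (fun i => z (k * u.length + i)) u.length = u).image
        fun k => k * u.length) := by
    have key : ∀ k < m, ((pref z (m * u.length)).drop (k * u.length)).take u.length =
        pref (fun i => z (k * u.length + i)) u.length := by
      intro k hk
      obtain ⟨r, rfl⟩ := Nat.exists_eq_add_of_le hk
      rw [show (k.succ + r) * u.length = k * u.length + (u.length + r * u.length) by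
        rw [Nat.succ_eq_add_one]; ring, pref_add, pref_add]
      rw [List.drop_left' (pref_length _ _), List.take_left' (pref_length _ _)]
    ext i
    simp only [pref_length, Set.mem_ofPred_eq, Finset.coe_image, Finset.coe_filter, Finset.mem_range,
      Set.mem_image]
    constructor
    · rintro ⟨h1, h2, h3⟩
      obtain ⟨k, rfl⟩ := Nat.dvd_of_mod_eq_zero h2
      rw [mul_comm] at h1 h3 ⊢
      have hk : k < m := by
        have : (k + 1) * u.length ≤ m * u.length := by rw [add_mul]; omega
        exact Nat.le_of_mul_le_mul_right this hℓ
      exact ⟨k, ⟨hk, by rw [← key k hk, h3]⟩, rfl⟩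
    · rintro ⟨k, ⟨hk, h⟩, rfl⟩
      refine ⟨?_, by simp, by rw [key k hk, h]⟩
      have : (k + 1) * u.length ≤ m * u.length := Nat.mul_le_mul_right _ hk
      rw [add_mul] at this
      omega
  rw [h]
  have h2 := Finset.card_image_of_injective
    ((Finset.range m).filter fun k => pref (fun i => z (k * u.length + i)) u.length = u)
    (f := fun k => k * u.length) fun a b hab => Nat.eq_of_mul_eq_mul_right hℓ hab
  rw [← h2, Nat.card_coe_set_eq, Set.ncard_coe_finset]

/-- Frequencies of symbols in normal words. -/
lemma Normal.tendsto_avg [Fintype A] {z : ℕ → A} (hz : Normal z) (g : A → ℝ) :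
    Tendsto (fun n : ℕ => (∑ j ∈ Finset.range n, g (z j)) / n) atTop
      (𝓝 (avg Finset.univ g)) := by
  classical
  have h := tendsto_finsetSum Finset.univ fun a _ => (hz 1 le_rfl [a] rfl).const_mul (g a)
  have h2 : ∑ a : A, g a * (Fintype.card A : ℝ)⁻¹ ^ 1 = avg Finset.univ g := by
    rw [← Finset.sum_mul, avg, pow_one]
    rfl
  rw [h2] at h
  refine h.congr fun n => ?_
  simp only [alocc_pref z le_rfl (List.length_singleton), Finset.sum_div, Finset.mul_sum]
  rw [Finset.sum_comm]
  refine Finset.sum_congr rfl fun i _ => ?_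
  simp [pref, div_eq_mul_inv]

/-- If all words selected from `x` with oracle `y` are normal, `x` is unpredictable. -/
lemma unpredictable_of_selectors [Fintype A] {x : ℕ → A} {y : ℕ → B}
    (h : ∀ S : Sel2 A B, Tendsto (fun n => (S.outList x y n).length) atTop atTop →
      ∀ z : ℕ → A, (∀ n, S.outList x y n = pref z (S.outList x y n).length) → Normal z) :
    Unpredictable x y := by
  classical
  intro Q _ M F
  have := Fintype.ofFinite Q
  suffices H : ∀ p : Q, Tendsto (fun n : ℕ =>
      (∑ i ∈ Finset.range n, if (M.cfg x y i).1 = p then M.dev x y F i else 0) / n) atTop (𝓝 0) by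
    have h1 := tendsto_finsetSum Finset.univ fun p _ => H p
    rw [Finset.sum_const_zero] at h1
    refine h1.congr fun n => ?_
    rw [← Finset.sum_div, Finset.sum_comm]
    simp
  intro p
  cases hp : M.rd p with
  | false =>
    refine tendsto_const_nhds.congr fun n => ?_
    rw [Finset.sum_eq_zero, zero_div]
    intro i _
    split_ifs with hi
    · simp [Mach.dev, hi, hp]
    · rfl
  | true =>
    let e := Fintype.equivFin Q
    let S : Sel2 A B := ⟨Fintype.card Q, e M.init,
      fun s => if e.symm s = p then .I else if M.rd (e.symm s) then .II else .III,
      fun s a => e (M.δa (e.symm s) a), fun s b => e (M.δb (e.symm s) b)⟩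
    have hcfg : ∀ n, S.cfg x y n = (e (M.cfg x y n).1, (M.cfg x y n).2) := by
      intro n
      induction n with
      | zero => rfl
      | succ n ih =>
        rw [Sel2.cfg, Mach.cfg]
        simp only [ih, S, Equiv.symm_apply_apply]
        by_cases h1 : (M.cfg x y n).1 = p
        · simp [h1, hp]
        · cases h2 : M.rd (M.cfg x y n).1 <;> simp [h1]
    let o : ℕ → Option A := fun i => if (M.cfg x y i).1 = p then some (x (M.cfg x y i).2.1) else none
    have hout : ∀ n, S.outList x y n = fl (fun i => (o i).toList) n := by
      intro n
      rw [Sel2.outList, ← filterMap_eq_fl]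
      congr 1
      funext i
      simp only [hcfg, S, Equiv.symm_apply_apply, o]
      split_ifs <;> rfl
    have hsum : ∀ n, ∑ i ∈ Finset.range n, (if (M.cfg x y i).1 = p then M.dev x y F i else 0) =
        ∑ i ∈ Finset.range n, (o i).elim 0 (fun a => F p a - avg Finset.univ (F p)) := by
      intro n
      refine Finset.sum_congr rfl fun i _ => ?_
      by_cases hi : (M.cfg x y i).1 = p <;> simp [o, hi, Mach.dev, hp]
    simp only [hsum]
    by_cases hinf : Tendsto (fun n => (fl (fun i => (o i).toList) n).length) atTop atTop
    · obtain ⟨z, hz⟩ := exists_limit _ hinf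
      have hn : Normal z := h S (by simpa only [hout] using hinf) z (by simpa only [hout] using hz)
      simp only [sum_selected hz (fun _ a => F p a - avg Finset.univ (F p))]
      have hlim := hn.tendsto_avg fun a => F p a - avg Finset.univ (F p)
      rw [avg_sub, avg_const ⟨z 0, Finset.mem_univ _⟩, sub_self] at hlim
      exact tendsto_comp_div (K := 1)
        (g := fun k => ∑ j ∈ Finset.range k, (F p (z j) - avg Finset.univ (F p)))
        (c := fun n => (fl (fun i => (o i).toList) n).length) hlim
        fun n => by simpa using fl_toList_length_le o n
    · have hb : ∃ C, ∀ n, (fl (fun i => (o i).toList) n).length ≤ C := by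
        by_contra hcon
        push Not at hcon
        exact hinf (tendsto_atTop_atTop_of_monotone (fl_length_mono _) fun b =>
          (hcon b).imp fun _ h => h.le)
      obtain ⟨C, hC⟩ := hb
      obtain ⟨K, hK0, hK⟩ := abs_sum_selected_le o fun a => F p a - avg Finset.univ (F p)
      refine tendsto_bounded_div (C := K * C) fun n => (hK n).trans ?_
      gcongr
      exact hC n

end

section

/-! ### Normality of selected words -/

open Classical in
/-- Tracks the position in the current block of length `ℓ` and whether the symbols of this block
read so far agree with `u`. -/
noncomputable def blockStep {ℓ : ℕ} (u : List A) (t : Fin ℓ × Bool) (a : A) : Fin ℓ × Bool :=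
  (⟨(t.1 + 1) % ℓ, Nat.mod_lt _ t.1.pos⟩,
    if t.1 + 1 = ℓ then true else t.2 && decide (u[t.1.val]? = some a))

/-- The successive values of the tracker along `z`. -/
noncomputable def blockState {ℓ : ℕ} (hℓ : 0 < ℓ) (u : List A) (z : ℕ → A) : ℕ → Fin ℓ × Bool
  | 0 => (⟨0, hℓ⟩, true)
  | n + 1 => blockStep u (blockState hℓ u z n) (z n)

lemma pref_succ_eq_take_iff (z : ℕ → A) {u : List A} {i : ℕ} (hi : i < u.length) :
    pref z (i + 1) = u.take (i + 1) ↔ pref z i = u.take i ∧ u[i]? = some (z i) := by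
  rw [pref_succ, List.take_add_one, List.getElem?_eq_getElem hi, Option.toList_some]
  constructor
  · intro h
    obtain ⟨h1, h2⟩ := List.append_inj h (by simp; omega)
    simp only [List.cons.injEq, and_true] at h2
    exact ⟨h1, by rw [h2]⟩
  · rintro ⟨h1, h2⟩
    rw [h1, Option.some.inj h2]

open Classical in
lemma blockState_eq {ℓ : ℕ} (hℓ : 0 < ℓ) {u : List A} (hu : u.length = ℓ) (z : ℕ → A) (k i : ℕ)
    (hi : i < ℓ) : blockState hℓ u z (k * ℓ + i) =
      (⟨i, hi⟩, decide (pref (fun j => z (k * ℓ + j)) i = u.take i)) := by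
  subst hu
  have step : ∀ k i (hi : i < u.length), i + 1 < u.length →
      blockState hℓ u z (k * u.length + i) =
      (⟨i, hi⟩, decide (pref (fun j => z (k * u.length + j)) i = u.take i)) →
      blockState hℓ u z (k * u.length + (i + 1)) =
      (⟨(i + 1) % u.length, Nat.mod_lt _ hℓ⟩,
        decide (pref (fun j => z (k * u.length + j)) (i + 1) = u.take (i + 1))) := by
    intro k i hi hi2 h
    rw [← add_assoc, blockState, h, blockStep]
    simp only [hi2.ne, if_false, Prod.mk.injEq, true_and]
    rw [← Bool.decide_and]
    exact decide_eq_decide.2 (pref_succ_eq_take_iff _ hi).symm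
  induction k generalizing i with
  | zero =>
    induction i with
    | zero => simp [blockState, pref]
    | succ i ih =>
      rw [step 0 i (by omega) hi (ih (by omega))]
      simp [Nat.mod_eq_of_lt hi]
  | succ k ihk =>
    induction i with
    | zero =>
      obtain ⟨r, hr⟩ := Nat.exists_eq_add_of_lt hℓ
      rw [show (k + 1) * u.length + 0 = k * u.length + r + 1 by
        rw [add_mul, one_mul]; omega, blockState, ihk r (by omega), blockStep]
      have h2 : r + 1 = u.length := by omega
      simp [pref, h2]
    | succ i ih =>
      rw [step (k + 1) i (by omega) hi (ih (by omega))]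
      simp [Nat.mod_eq_of_lt hi]

open Classical in
/-- Betting function multiplying the capital as long as the current block agrees with `u`. -/
noncomputable def blockBet [Fintype A] {ℓ : ℕ} (u : List A) (t : Fin ℓ × Bool) (a : A) : ℝ :=
  if t.2 ∧ u[t.1.val]? = some a then (Fintype.card A : ℝ) ^ (t.1.val + 1) else 0

lemma avg_blockBet [Fintype A] {ℓ : ℕ} {u : List A} (hu : u.length = ℓ) (t : Fin ℓ × Bool) :
    avg Finset.univ (blockBet u t) = if t.2 then (Fintype.card A : ℝ) ^ t.1.val else 0 := by
  classical
  obtain ⟨⟨i, hi⟩, b⟩ := t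
  subst hu
  cases b with
  | false => simp [avg, blockBet]
  | true =>
    have hA : (Fintype.card A : ℝ) ≠ 0 := by
      have : Nonempty A := ⟨u[i]⟩
      exact_mod_cast Fintype.card_ne_zero
    have h : blockBet u ((⟨i, hi⟩, true) : Fin u.length × Bool) =
        fun a => if a = u[i] then (Fintype.card A : ℝ) ^ (i + 1) else 0 := by
      funext a
      simp [blockBet, List.getElem?_eq_getElem hi, eq_comm (a := a)]
    rw [h, avg_indicator (Finset.mem_univ u[i]), pow_succ, Finset.card_univ,
      mul_div_cancel_right₀ _ hA]
    rfl

open Classical in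
lemma sum_blockBet [Fintype A] {ℓ : ℕ} (hℓ : 0 < ℓ) {u : List A} (hu : u.length = ℓ)
    (z : ℕ → A) (m : ℕ) :
    ∑ j ∈ Finset.range (m * ℓ), (blockBet u (blockState hℓ u z j) (z j) -
      avg Finset.univ (blockBet u (blockState hℓ u z j))) =
    (Fintype.card A : ℝ) ^ ℓ * alocc (pref z (m * ℓ)) u - m := by
  rw [alocc_pref z hℓ hu]
  induction m with
  | zero => simp
  | succ m ih =>
    rw [add_mul, one_mul, Finset.sum_range_add, ih, Finset.sum_range_succ]
    have h : ∀ i ∈ Finset.range ℓ, blockBet u (blockState hℓ u z (m * ℓ + i)) (z (m * ℓ + i)) -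
        avg Finset.univ (blockBet u (blockState hℓ u z (m * ℓ + i))) =
        (if pref (fun j => z (m * ℓ + j)) (i + 1) = u.take (i + 1)
          then (Fintype.card A : ℝ) ^ (i + 1) else 0) -
        (if pref (fun j => z (m * ℓ + j)) i = u.take i then (Fintype.card A : ℝ) ^ i else 0) := by
      intro i hi
      rw [Finset.mem_range] at hi
      rw [avg_blockBet hu, blockState_eq hℓ hu z m i hi]
      simp only [blockBet, decide_eq_true_eq]
      simp only [pref_succ_eq_take_iff (fun j => z (m * ℓ + j)) (hu ▸ hi : i < u.length)]
    rw [Finset.sum_congr rfl h, Finset.sum_range_sub (fun i =>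
      (if pref (fun j => z (m * ℓ + j)) i = u.take i then (Fintype.card A : ℝ) ^ i else 0))]
    have h0 : pref (fun j => z (m * ℓ + j)) 0 = u.take 0 := by simp [pref]
    rw [if_pos h0, pow_zero, List.take_of_length_le hu.le, mul_add, mul_ite, mul_one, mul_zero]
    push_cast
    ring

lemma exists_eq_of_step {f : ℕ → ℕ} (h0 : f 0 = 0) (h1 : ∀ n, f (n + 1) ≤ f n + 1)
    (h : Tendsto f atTop atTop) (k : ℕ) : ∃ n, f n = k := by
  classical
  have hex : ∃ n, k ≤ f n := (h.eventually (eventually_ge_atTop k)).exists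
  refine ⟨Nat.find hex, le_antisymm ?_ (Nat.find_spec hex)⟩
  cases hn : Nat.find hex with
  | zero => omega
  | succ n =>
    have := Nat.find_min hex (m := n) (by omega)
    have := h1 n
    omega

lemma exists_frequently_eq [Finite Q] {s : ℕ → Q} {p : ℕ → Prop} (h : ∃ᶠ n in atTop, p n) :
    ∃ q, ∃ᶠ n in atTop, p n ∧ s n = q := by
  by_contra hcon
  simp only [not_exists, not_frequently] at hcon
  refine h ?_
  filter_upwards [eventually_all.2 hcon] with n hn hp
  exact hn (s n) ⟨hp, rfl⟩

/-- Words selected from unpredictable words are normal. -/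
lemma normal_of_unpredictable [Fintype A] [Fintype B] {x : ℕ → A} {y : ℕ → B}
    (hx : Unpredictable.{0} x y) (hy : Unpredictable.{0} y x) (S : Sel2 A B)
    (hinf : Tendsto (fun n => (S.outList x y n).length) atTop atTop) {z : ℕ → A}
    (hz : ∀ n, S.outList x y n = pref z (S.outList x y n).length) : Normal z := by
  classical
  intro ℓ hℓ u hu
  let o : ℕ → Option A := fun i =>
    if S.ty (S.cfg x y i).1 = .I then some (x (S.cfg x y i).2.1) else none
  have hout : ∀ n, S.outList x y n = fl (fun i => (o i).toList) n := by
    intro n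
    rw [Sel2.outList, ← filterMap_eq_fl]
    congr 1
    funext i
    simp only [o]
    cases S.ty (S.cfg x y i).1 <;> simp
  simp only [hout] at hinf hz
  let len : ℕ → ℕ := fun n => (fl (fun i => (o i).toList) n).length
  have hlen : ∀ n, len n = (fl (fun i => (o i).toList) n).length := fun _ => rfl
  let M : Mach A B (Fin S.states × (Fin ℓ × Bool)) :=
    ⟨(S.init, (⟨0, hℓ⟩, true)), fun s => decide (S.ty s.1 ≠ .III),
      fun s a => (S.δa s.1 a, if S.ty s.1 = .I then blockStep u s.2 a else s.2),
      fun s b => (S.δb s.1 b, s.2)⟩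
  have hcfg : ∀ n, M.cfg x y n = (((S.cfg x y n).1, blockState hℓ u z (len n)),
      (S.cfg x y n).2) := by
    intro n
    induction n with
    | zero => rfl
    | succ n ih =>
      have hz1 := hz (n + 1)
      have hrd : M.rd (M.cfg x y n).1 = decide (S.ty (S.cfg x y n).1 ≠ .III) := by rw [ih]
      have hlen1 : len (n + 1) = len n + (o n).toList.length := by
        simp only [hlen, fl_succ, List.length_append]
      cases ht : S.ty (S.cfg x y n).1 with
      | I =>
        have ho : o n = some (x (S.cfg x y n).2.1) := if_pos ht
        rw [fl_succ, hz n, ho, Option.toList_some, List.length_append, pref_length,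
          List.length_singleton, pref_succ] at hz1
        simp only [List.append_cancel_left_eq, List.cons.injEq, and_true] at hz1
        rw [M.cfg_succ_of_rd x y (by simp [hrd, ht]), ih, hlen1, ho, Sel2.cfg]
        simp [M, ht, hz1, blockState, hlen]
      | II =>
        have ho : o n = none := if_neg (by simp [ht])
        rw [M.cfg_succ_of_rd x y (by simp [hrd, ht]), ih, hlen1, ho, Sel2.cfg]
        simp [M, ht]
      | III =>
        have ho : o n = none := if_neg (by simp [ht])
        rw [M.cfg_succ_of_not_rd x y (by simp [hrd, ht]), ih, hlen1, ho, Sel2.cfg]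
        simp [M, ht]
  have hdev := hx _ M fun s a => if S.ty s.1 = .I then blockBet u s.2 a else 0
  let Φ : ℕ → ℝ := fun k => ∑ j ∈ Finset.range k, (blockBet u (blockState hℓ u z j) (z j) -
      avg Finset.univ (blockBet u (blockState hℓ u z j)))
  have hΦ : Tendsto (fun n : ℕ => Φ (len n) / n) atTop (𝓝 0) := by
    refine hdev.congr fun n => ?_
    congr 1
    refine Eq.trans ?_ (sum_selected hz (fun j a => blockBet u (blockState hℓ u z j) a -
      avg Finset.univ (blockBet u (blockState hℓ u z j))) n)
    refine Finset.sum_congr rfl fun i _ => ?_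
    simp only [Mach.dev, hcfg, M]
    cases ht : S.ty (S.cfg x y i).1 <;> simp [ht, o, avg, hlen]
  obtain ⟨c, hc, hclen⟩ : ∃ c > 0, ∀ᶠ n : ℕ in atTop, c * n ≤ (len n : ℝ) := by
    have hfreq : ∃ᶠ i in atTop, S.ty (S.cfg x y i).1 = .I := by
      intro hcon
      obtain ⟨N, hN⟩ := eventually_atTop.1 hcon
      obtain ⟨n, hn⟩ := ((eventually_ge_atTop N).and
        (hinf.eventually (eventually_gt_atTop (len N)))).exists
      obtain ⟨k, rfl⟩ := Nat.exists_eq_add_of_le hn.1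
      refine hn.2.ne' ?_
      clear hn
      induction k with
      | zero => rfl
      | succ k ih =>
        rw [← add_assoc, hlen, fl_succ]
        simp only [o, if_neg (hN (N + k) (by omega)), Option.toList_none, List.append_nil]
        exact ih
    obtain ⟨q, hq⟩ := exists_frequently_eq (s := fun n => (M.cfg x y n).1) hfreq
    have hqI : S.ty q.1 = .I := by
      obtain ⟨i, hi, rfl⟩ := hq.exists
      rw [hcfg]
      exact hi
    obtain ⟨c, hc, h⟩ := (M.equi hx hy).exists_pos
      (nxt := fun q l => Sum.elim (M.δa q) (M.δb q) l)
      (fun i => by cases h : M.rd (M.cfg x y i).1 <;> simp [Mach.labels, Mach.label, h])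
      (fun i => by cases h : M.rd (M.cfg x y i).1 <;> simp [Mach.cfg, Mach.label, h])
      (hq.mono fun n hn => hn.2)
    refine ⟨c, hc, h.mono fun n hn => hn.trans ?_⟩
    clear hn
    induction n with
    | zero => simp [visits]
    | succ n ih =>
      rw [visits, Finset.sum_range_succ, ← visits]
      simp only [hlen, fl_succ, List.length_append, Nat.cast_add]
      refine add_le_add ih ?_
      split_ifs with hi
      · rw [hcfg] at hi
        have : S.ty (S.cfg x y n).1 = .I := by rw [← hqI, ← hi]
        simp [o, this]
      · positivity
  have hΦ2 : Tendsto (fun n : ℕ => Φ (len n) / len n) atTop (𝓝 0) := by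
    have h := hΦ.abs.div_const c
    rw [abs_zero, zero_div] at h
    refine squeeze_zero_norm' ?_ h
    filter_upwards [hclen, eventually_gt_atTop 0] with n hn hn0
    have hn0 : (0 : ℝ) < n := by exact_mod_cast hn0
    rw [Real.norm_eq_abs, abs_div, abs_div, div_div, Nat.abs_cast, Nat.abs_cast, mul_comm (n : ℝ) c]
    gcongr
  have hstep : ∀ n, len (n + 1) ≤ len n + 1 := by
    intro n
    simp only [hlen, fl_succ, List.length_append]
    cases o n <;> simp
  choose N hN using exists_eq_of_step (f := len) rfl hstep hinf
  have hNtop : Tendsto (fun m => N (m * ℓ)) atTop atTop := by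
    refine tendsto_atTop_mono (fun m => ?_) tendsto_id
    calc m ≤ m * ℓ := Nat.le_mul_of_pos_right _ hℓ
      _ = len (N (m * ℓ)) := (hN _).symm
      _ ≤ _ := fl_toList_length_le o _
  have h1 := hΦ2.comp hNtop
  have hA : (Fintype.card A : ℝ) ≠ 0 := by
    have : Nonempty A := ⟨z 0⟩
    exact_mod_cast Fintype.card_ne_zero
  have h2 := ((h1.const_mul (ℓ : ℝ)).add_const 1).const_mul ((Fintype.card A : ℝ)⁻¹ ^ ℓ)
  simp only [mul_zero, zero_add, mul_one] at h2
  refine h2.congr' ?_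
  filter_upwards [eventually_gt_atTop 0] with m hm
  have hm : (m : ℝ) ≠ 0 := by positivity
  have hℓ' : (ℓ : ℝ) ≠ 0 := by positivity
  simp only [Function.comp, hN, Φ, sum_blockBet hℓ hu, Nat.cast_mul]
  rw [inv_pow]
  field_simp
  ring

end

section

/-! ### First passage under iteration -/

open Classical in
/-- The first state satisfying `P` among the iterates `q, f q, f (f q), …`. -/
noncomputable def firstPassage (P : Q → Prop) (f : Q → Q) (q : Q) : Option Q :=
  if h : ∃ t, P (f^[t] q) then some (f^[Nat.find h] q) else none

lemma firstPassage_of {P : Q → Prop} (f : Q → Q) {q : Q} (h : P q) :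
    firstPassage P f q = some q := by
  classical
  have hex : ∃ t, P (f^[t] q) := ⟨0, h⟩
  rw [firstPassage, dif_pos hex, (Nat.find_eq_zero hex).2 h]
  rfl

lemma firstPassage_of_not {P : Q → Prop} (f : Q → Q) {q : Q} (h : ¬ P q) :
    firstPassage P f (f q) = firstPassage P f q := by
  classical
  by_cases hex : ∃ t, P (f^[t] (f q))
  · have hex' : ∃ t, P (f^[t] q) := hex.imp' Nat.succ fun t ht => ht
    have hfind : Nat.find hex' = Nat.find hex + 1 := Nat.find_comp_succ hex' hex h
    rw [firstPassage, dif_pos hex, firstPassage, dif_pos hex', hfind]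
    rfl
  · have hex' : ¬ ∃ t, P (f^[t] q) := by
      rintro ⟨t, ht⟩
      cases t with
      | zero => exact h ht
      | succ t => exact hex ⟨t, ht⟩
    rw [firstPassage, dif_neg hex, firstPassage, dif_neg hex']

/-! ### Labels of conditional compressors -/

/-- The labels with given support. -/
def labelsOf (A B : Type*) [Fintype A] [Fintype B] (τ : Bool × Bool) :
    Finset (Option A × Option B) :=
  Finset.univ.filter fun l => lsupp l = τ

@[simp] lemma mem_labelsOf [Fintype A] [Fintype B] {τ : Bool × Bool} {l : Option A × Option B} :
    l ∈ labelsOf A B τ ↔ lsupp l = τ := by simp [labelsOf]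

section labels
variable [Fintype A] [Fintype B]

lemma sum_labelsOf (τ : Bool × Bool) (G : Option A × Option B → ℝ) :
    ∑ l ∈ labelsOf A B τ, G l = ∑ o : Option A, ∑ o' : Option B,
      if lsupp (o, o') = τ then G (o, o') else 0 := by
  rw [labelsOf, Finset.sum_filter, Fintype.sum_prod_type]

lemma sum_labelsOf_tf (G : Option A × Option B → ℝ) :
    ∑ l ∈ labelsOf A B (true, false), G l = ∑ a, G (some a, none) := by
  simp [sum_labelsOf, lsupp]

lemma sum_labelsOf_ft (G : Option A × Option B → ℝ) :
    ∑ l ∈ labelsOf A B (false, true), G l = ∑ b, G (none, some b) := by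
  simp [sum_labelsOf, lsupp]

lemma sum_labelsOf_ff (G : Option A × Option B → ℝ) :
    ∑ l ∈ labelsOf A B (false, false), G l = G (none, none) := by
  simp [sum_labelsOf, lsupp]

lemma sum_labelsOf_tt (G : Option A × Option B → ℝ) :
    ∑ l ∈ labelsOf A B (true, true), G l = ∑ a, ∑ b, G (some a, some b) := by
  simp [sum_labelsOf, lsupp]

lemma card_labelsOf {τ : Bool × Bool} {l : Option A × Option B} (h : lsupp l = τ) :
    ((labelsOf A B τ).card : ℝ) =
      (Fintype.card A : ℝ) ^ l.1.toList.length * (Fintype.card B : ℝ) ^ l.2.toList.length := by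
  rw [Finset.card_eq_sum_ones, Nat.cast_sum]
  subst h
  obtain ⟨_ | a, _ | b⟩ := l
  · simpa [lsupp] using sum_labelsOf_ff (A := A) (B := B) fun _ => 1
  · simpa [lsupp] using sum_labelsOf_ft (A := A) (B := B) fun _ => 1
  · simpa [lsupp] using sum_labelsOf_tf (A := A) (B := B) fun _ => 1
  · simpa [lsupp] using sum_labelsOf_tt (A := A) (B := B) fun _ => 1

lemma avg_labelsOf_tf (G : Option A × Option B → ℝ) :
    avg (labelsOf A B (true, false)) G = avg Finset.univ fun a => G (some a, none) := by
  have h := sum_labelsOf_tf (A := A) (B := B) fun _ => 1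
  rw [← Nat.cast_one, ← Nat.cast_sum, ← Finset.card_eq_sum_ones, ← Nat.cast_sum,
    ← Finset.card_eq_sum_ones] at h
  rw [avg, avg, sum_labelsOf_tf, h]

lemma avg_labelsOf_ft (G : Option A × Option B → ℝ) :
    avg (labelsOf A B (false, true)) G = avg Finset.univ fun b => G (none, some b) := by
  have h := sum_labelsOf_ft (A := A) (B := B) fun _ => 1
  rw [← Nat.cast_one, ← Nat.cast_sum, ← Finset.card_eq_sum_ones, ← Nat.cast_sum,
    ← Finset.card_eq_sum_ones] at h
  rw [avg, avg, sum_labelsOf_ft, h]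

lemma avg_labelsOf_ff (G : Option A × Option B → ℝ) :
    avg (labelsOf A B (false, false)) G = G (none, none) := by
  rw [avg, sum_labelsOf_ff, card_labelsOf (τ := (false, false)) (l := (none, none)) rfl]
  simp

lemma avg_labelsOf_tt (G : Option A × Option B → ℝ) :
    avg (labelsOf A B (true, true)) G =
      avg Finset.univ fun a => avg Finset.univ fun b => G (some a, some b) := by
  rcases isEmpty_or_nonempty A with hA | ⟨⟨a⟩⟩
  · simp [avg, sum_labelsOf_tt]
  rcases isEmpty_or_nonempty B with hB | ⟨⟨b⟩⟩
  · simp [avg, sum_labelsOf_tt]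
  rw [avg, sum_labelsOf_tt, card_labelsOf (τ := (true, true)) (l := (some a, some b)) rfl]
  simp only [avg, ← Finset.sum_div, div_div, Finset.card_univ]
  simp [mul_comm]

end labels

namespace Comp3
variable (C : Comp3 A B D Q)

open Classical in
/-- The support of the transitions leaving `q`. -/
noncomputable def ty (q : Q) : Bool × Bool :=
  if h : ∃ t ∈ C.trans, t.1 = q then lsupp h.choose.2.1 else (true, false)

open Classical in
/-- The output and end state of the transition leaving `q` with label `l`. -/
noncomputable def edge (q : Q) (l : Option A × Option B) : List D × Q :=
  if h : ∃ r, (q, l, r) ∈ C.trans then h.choose else ([], q)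

variable {C}

lemma ty_eq (hC : C.TwoDet) {t : Q × (Option A × Option B) × List D × Q} (ht : t ∈ C.trans) :
    lsupp t.2.1 = C.ty t.1 := by
  have h : ∃ t' ∈ C.trans, t'.1 = t.1 := ⟨t, ht, rfl⟩
  rw [ty, dif_pos h]
  exact (hC _ ht _ h.choose_spec.1 h.choose_spec.2.symm).1

lemma edge_eq (hC : C.TwoDet) {t : Q × (Option A × Option B) × List D × Q} (ht : t ∈ C.trans) :
    C.edge t.1 t.2.1 = t.2.2 := by
  have h : ∃ r, (t.1, t.2.1, r) ∈ C.trans := ⟨t.2.2, ht⟩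
  rw [edge, dif_pos h]
  have := (hC _ ht _ h.choose_spec rfl).2 rfl
  exact (congrArg (fun t => t.2.2) this).symm

variable (C)

/-- The state reached after the transitions without input from a state. -/
noncomputable def closure (q : Q) : Option (Q × Option A) :=
  (firstPassage (fun q => C.ty q ≠ (false, false)) (fun q => (C.edge q (none, none)).2) q).map
    fun q => (q, none)

/-- A machine simulating the reading of the inputs by the compressor. A symbol of the first input
is remembered when symbols of both inputs are read in a single transition. -/
noncomputable def mach : Mach A B (Option (Q × Option A)) where
  init := C.closure C.init
  rd
    | some (q, none) => (C.ty q).1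
    | some (_, some _) => false
    | none => true
  δa
    | some (q, none), a => if (C.ty q).2 then some (q, some a)
      else C.closure (C.edge q (some a, none)).2
    | s, _ => s
  δb
    | some (q, o), b => C.closure (C.edge q (o, some b)).2
    | none, _ => none

@[simp] lemma mach_rd_none (q : Q) : C.mach.rd (some (q, none)) = (C.ty q).1 := rfl

@[simp] lemma mach_rd_some (q : Q) (a : A) : C.mach.rd (some (q, some a)) = false := rfl

@[simp] lemma mach_δa (q : Q) (a : A) : C.mach.δa (some (q, none)) a =
    if (C.ty q).2 then some (q, some a) else C.closure (C.edge q (some a, none)).2 := rfl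

@[simp] lemma mach_δb (q : Q) (o : Option A) (b : B) : C.mach.δb (some (q, o)) b =
    C.closure (C.edge q (o, some b)).2 := rfl

lemma closure_of_ne {q : Q} (h : C.ty q ≠ (false, false)) : C.closure q = some (q, none) := by
  rw [closure, firstPassage_of (P := fun q => C.ty q ≠ (false, false)) _ h]
  rfl

lemma closure_of_eq {q : Q} (h : C.ty q = (false, false)) :
    C.closure (C.edge q (none, none)).2 = C.closure q := by
  rw [closure, firstPassage_of_not (P := fun q => C.ty q ≠ (false, false))
    (fun q => (C.edge q (none, none)).2) (not_not.2 h), ← closure]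

/-- Transfer of a function of the transitions of the compressor to the simulating machine. -/
noncomputable def machFun [Fintype B] (F : Q → Option A × Option B → ℝ) :
    Option (Q × Option A) → A ⊕ B → ℝ
  | some (q, none), .inl a => if (C.ty q).2 then avg Finset.univ fun b => F q (some a, some b)
      else F q (some a, none)
  | some (q, o), .inr b => F q (o, some b)
  | _, _ => 0

universe w in
/-- The run of a compressor on mutually unpredictable words is equidistributed. -/
lemma equi {A : Type w} [Fintype A] [Fintype B] {m : ℕ} {C : Comp3 A B D (Fin m)}
    (hC : C.TwoDet) {x : ℕ → A} {y : ℕ → B} (hx : Unpredictable.{w} x y)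
    (hy : Unpredictable.{w} y x) {γ : ℕ → Fin m × (Option A × Option B) × List D × Fin m}
    (hγ : C.IsAccRunOn γ x y) :
    Equi (fun q => labelsOf A B (C.ty q)) (fun n => (γ n).1) (fun n => (γ n).2.1) := by
  intro F
  obtain ⟨hinit, htr, hnext, hin1, hin2, -, -, -⟩ := hγ
  simp only [c3in1, c3in2, reduceOption_eq_fl] at hin1 hin2
  set M := C.mach with hM
  set G := C.machFun F with hG
  set S : ℕ → ℝ := fun t => ∑ i ∈ Finset.range t, (G (M.cfg x y i).1 (M.label x y i) -
    avg (M.labels (M.cfg x y i).1) (G (M.cfg x y i).1)) with hS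
  have hSlim : Tendsto (fun t : ℕ => S t / t) atTop (𝓝 0) := M.equi hx hy G
  have key : ∀ n, ∃ t ≤ 2 * n, M.cfg x y t = (C.closure (γ n).1,
      (fl (fun i => (γ i).2.1.1.toList) n).length, (fl (fun i => (γ i).2.1.2.toList) n).length) ∧
      S t = ∑ i ∈ Finset.range n, (F (γ i).1 (γ i).2.1 -
        avg (labelsOf A B (C.ty (γ i).1)) (F (γ i).1)) := by
    intro n
    induction n with
    | zero => exact ⟨0, le_rfl, by rw [hinit]; rfl, rfl⟩
    | succ n ih =>
      obtain ⟨t, ht, hcfg, hsum⟩ := ih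
      have h1 := hin1 (n + 1)
      have h2 := hin2 (n + 1)
      have hty := ty_eq hC (htr n)
      have hed := edge_eq hC (htr n)
      have hnx : (C.edge (γ n).1 (γ n).2.1).2 = (γ (n + 1)).1 := by rw [hed, hnext]
      rw [Finset.sum_range_succ, ← hsum, ← hnx]
      rw [fl_succ, hin1 n, List.length_append, pref_length] at h1
      rw [fl_succ, hin2 n, List.length_append, pref_length] at h2
      simp only [fl_succ, List.length_append]
      generalize (γ n).1 = q at *
      generalize (γ n).2.1 = l at *
      have hS1 : ∀ t, S (t + 1) = S t + (G (M.cfg x y t).1 (M.label x y t) -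
          avg (M.labels (M.cfg x y t).1) (G (M.cfg x y t).1)) :=
        fun t => Finset.sum_range_succ _ _
      obtain ⟨_ | a, _ | b⟩ := l
      · have hty : C.ty q = (false, false) := hty.symm
        refine ⟨t, by omega, ?_, ?_⟩
        · rw [C.closure_of_eq hty, hcfg]; rfl
        · rw [hty, avg_labelsOf_ff]; simp
      · have hty : C.ty q = (false, true) := hty.symm
        rw [C.closure_of_ne (by simp [hty])] at hcfg
        simp only [Option.toList_some, List.length_singleton, pref_succ,
          List.append_cancel_left_eq, List.cons.injEq, and_true] at h2
        have hrd : M.rd (M.cfg x y t).1 = false := by rw [hcfg]; simp [hM, hty]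
        refine ⟨t + 1, by omega, ?_, ?_⟩
        · rw [M.cfg_succ_of_not_rd x y hrd, hcfg]
          simp [hM, h2]
        · rw [hS1, hty, avg_labelsOf_ft, Mach.label, Mach.labels, hrd]
          simp only [hcfg]; simp [hG, machFun, avg, h2]
      · have hty : C.ty q = (true, false) := hty.symm
        rw [C.closure_of_ne (by simp [hty])] at hcfg
        simp only [Option.toList_some, List.length_singleton, pref_succ,
          List.append_cancel_left_eq, List.cons.injEq, and_true] at h1
        have hrd : M.rd (M.cfg x y t).1 = true := by rw [hcfg]; simp [hM, hty]
        refine ⟨t + 1, by omega, ?_, ?_⟩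
        · rw [M.cfg_succ_of_rd x y hrd, hcfg]
          simp [hM, h1, hty]
        · rw [hS1, hty, avg_labelsOf_tf, Mach.label, Mach.labels, hrd]
          simp only [hcfg]; simp [hG, machFun, avg, h1, hty]
      · have hty : C.ty q = (true, true) := hty.symm
        rw [C.closure_of_ne (by simp [hty])] at hcfg
        simp only [Option.toList_some, List.length_singleton, pref_succ,
          List.append_cancel_left_eq, List.cons.injEq, and_true] at h1 h2
        have hrd : M.rd (M.cfg x y t).1 = true := by rw [hcfg]; simp [hM, hty]
        have hcfg' : M.cfg x y (t + 1) = (some (q, some a),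
            (fl (fun i => (γ i).2.1.1.toList) n).length + 1,
            (fl (fun i => (γ i).2.1.2.toList) n).length) := by
          rw [M.cfg_succ_of_rd x y hrd, hcfg]
          simp [hM, h1, hty]
        have hrd' : M.rd (M.cfg x y (t + 1)).1 = false := by rw [hcfg']; simp [hM]
        refine ⟨t + 1 + 1, by omega, ?_, ?_⟩
        · rw [M.cfg_succ_of_not_rd x y hrd', hcfg']
          simp [hM, h2]
        · rw [hS1, hS1, hty, avg_labelsOf_tt, Mach.label, Mach.labels, hrd, Mach.label,
            Mach.labels, hrd']
          simp only [hcfg, hcfg']; simp [hG, machFun, avg, h1, h2, hty]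
          ring
  choose t ht hcfg hsum using key
  exact (tendsto_comp_div hSlim ht).congr fun n => by rw [hsum]

end Comp3

end

section

/-! ### Lower bound for compression ratios -/

/-- Word read on the first tape along a finite run. -/
def path1 (p : List (Q × (Option A × Option B) × List D × Q)) : List A :=
  (p.map fun e => e.2.1.1.toList).flatten

/-- Word read on the second tape along a finite run. -/
def path2 (p : List (Q × (Option A × Option B) × List D × Q)) : List B :=
  (p.map fun e => e.2.1.2.toList).flatten

/-- Word written along a finite run. -/
def pathOut (p : List (Q × (Option A × Option B) × List D × Q)) : List D :=
  (p.map fun e => e.2.2.1).flatten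

lemma flatten_map_toList_length_le {E : Type*} (f : E → Option A) (p : List E) :
    (p.map fun e => (f e).toList).flatten.length ≤ p.length := by
  induction p with
  | nil => simp
  | cons e p ih =>
    simp only [List.map_cons, List.flatten_cons, List.length_append, List.length_cons]
    have : (f e).toList.length ≤ 1 := by cases f e <;> simp
    omega

lemma toList_inj_of_isSome {o o' : Option A} (h : o.isSome = o'.isSome) {u v : List A}
    (h' : o.toList ++ u = o'.toList ++ v) : o = o' ∧ u = v := by
  cases o <;> cases o' <;> simp_all

/-- In a `2`-deterministic automaton a finite run is determined by its length, its starting point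
and the words read. -/
lemma path_unique {C : Comp3 A B D Q} (hC : C.TwoDet) {q r r' : Q}
    {p p' : List (Q × (Option A × Option B) × List D × Q)} (hp : IsPath C.trans q p r)
    (hp' : IsPath C.trans q p' r') (hlen : p.length = p'.length) (h1 : path1 p = path1 p')
    (h2 : path2 p = path2 p') : p = p' := by
  induction p generalizing p' q with
  | nil => cases p' <;> simp_all
  | cons e p ih =>
    obtain _ | ⟨e', p'⟩ := p'
    · simp at hlen
    obtain ⟨he, rfl, hp⟩ := hp
    obtain ⟨he', heq, hp'⟩ := hp'
    have hdet := hC e he e' he' heq.symm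
    simp only [lsupp, Prod.mk.injEq] at hdet
    simp only [path1, path2, List.map_cons, List.flatten_cons] at h1 h2
    obtain ⟨ha, h1⟩ := toList_inj_of_isSome hdet.1.1 h1
    obtain ⟨hb, h2⟩ := toList_inj_of_isSome hdet.1.2 h2
    obtain rfl := hdet.2 (Prod.ext ha hb)
    rw [ih hp hp' (by simpa using hlen) (List.append_cancel_left h1)
      (List.append_cancel_left h2)]

lemma fl_app_append_isPrefix {E : Type*} (f : E → List A) (l₀ : List E) {l l' : List E} (γ : ℕ → E)
    (h : (l.map f).flatten = (l'.map f).flatten) (n : ℕ) :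
    ∃ m, fl (fun i => f (app (l₀ ++ l) γ i)) n <+: fl (fun i => f (app (l₀ ++ l') γ i)) m :=
  fl_app_isPrefix f γ (by rw [List.map_append, List.map_append, List.flatten_append,
    List.flatten_append, h]) n

section splice
variable {C : Comp3 A B D Q} {x : ℕ → A} {y : ℕ → B}
  {γ : ℕ → Q × (Option A × Option B) × List D × Q}

lemma c3in1_eq (γ : ℕ → Q × (Option A × Option B) × List D × Q) :
    c3in1 γ = fl fun i => (γ i).2.1.1.toList := funext fun n => reduceOption_eq_fl _ n

lemma c3in2_eq (γ : ℕ → Q × (Option A × Option B) × List D × Q) :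
    c3in2 γ = fl fun i => (γ i).2.1.2.toList := funext fun n => reduceOption_eq_fl _ n

lemma c3out_eq (γ : ℕ → Q × (Option A × Option B) × List D × Q) :
    c3out γ = fl fun i => (γ i).2.2.1 := rfl

/-- A finite run between states visited by an accepting run is determined by its two
endpoints, its length, the word read on the second tape, the output and the length of the word
read on the first tape. -/
lemma path_unique_of_oneToOne (hC : C.TwoDet) (hinj : C.OneToOne) (hγ : C.IsAccRunOn γ x y)
    {i₀ i₁ : ℕ} {p p' : List (Q × (Option A × Option B) × List D × Q)}
    (hp : IsPath C.trans (γ i₀).1 p (γ i₁).1) (hp' : IsPath C.trans (γ i₀).1 p' (γ i₁).1)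
    (hlen : p.length = p'.length) (h1 : (path1 p).length = (path1 p').length)
    (h2 : path2 p = path2 p') (ho : pathOut p = pathOut p') : p = p' := by
  obtain ⟨hinit, htr, hnext, -, -, ht1, ht2, hto⟩ := hγ
  rw [c3in1_eq] at ht1
  rw [c3in2_eq] at ht2
  rw [c3out_eq] at hto
  have hrun : RunFrom C.trans C.init γ := ⟨hinit, htr, hnext⟩
  set δ : List (Q × (Option A × Option B) × List D × Q) → ℕ → _ := fun p =>
    app (pref γ i₀ ++ p) fun i => γ (i₁ + i) with hδ
  have hδrun : ∀ {p}, IsPath C.trans (γ i₀).1 p (γ i₁).1 → RunFrom C.trans C.init (δ p) :=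
    fun hp => RunFrom.app ((hrun.isPath i₀).append hp) (hrun.shift i₁)
  have hl1 : ∀ p, Tendsto (fun n => (c3in1 (δ p) n).length) atTop atTop := fun p => by
    rw [c3in1_eq]; exact tendsto_length_app (fun e => e.2.1.1.toList) _ γ i₁ ht1
  have hl2 : ∀ p, Tendsto (fun n => (c3in2 (δ p) n).length) atTop atTop := fun p => by
    rw [c3in2_eq]; exact tendsto_length_app (fun e => e.2.1.2.toList) _ γ i₁ ht2
  have hlo : ∀ p, Tendsto (fun n => (c3out (δ p) n).length) atTop atTop := fun p => by
    rw [c3out_eq]; exact tendsto_length_app (fun e => e.2.2.1) _ γ i₁ hto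
  have hz : ∀ p, ∃ z, ∀ n, c3in1 (δ p) n = pref z (c3in1 (δ p) n).length := fun p => by
    have := hl1 p
    rw [c3in1_eq] at this ⊢
    exact exists_limit _ this
  obtain ⟨z, hz1⟩ := hz p
  obtain ⟨z', hz1'⟩ := hz p'
  obtain ⟨v, hv⟩ : ∃ v, ∀ n, c3in2 (δ p') n = pref v (c3in2 (δ p') n).length := by
    have := hl2 p'
    rw [c3in2_eq] at this ⊢
    exact exists_limit _ this
  have hv' : ∀ n, c3in2 (δ p) n = pref v (c3in2 (δ p) n).length := fun n => by
    obtain ⟨m, hm⟩ := fl_app_append_isPrefix (fun e => e.2.1.2.toList) (pref γ i₀)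
      (fun i => γ (i₁ + i)) h2 n
    rw [c3in2_eq] at hv ⊢
    exact eq_pref_of_isPrefix hm (hv m)
  have hzz : z = z' := hinj z z' v (δ p) (δ p')
    ⟨(hδrun hp).1, (hδrun hp).2.1, (hδrun hp).2.2, hz1, hv', hl1 p, hl2 p, hlo p⟩
    ⟨(hδrun hp').1, (hδrun hp').2.1, (hδrun hp').2.2, hz1', hv, hl1 p', hl2 p', hlo p'⟩
    (fl_app_append_isPrefix (fun e : Q × (Option A × Option B) × List D × Q => e.2.2.1) _ _ ho)
    (fl_app_append_isPrefix (fun e : Q × (Option A × Option B) × List D × Q => e.2.2.1) _ _ ho.symm)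
  subst hzz
  have hin : ∀ p, c3in1 (δ p) (pref γ i₀ ++ p).length = path1 (pref γ i₀) ++ path1 p := fun p => by
    rw [c3in1_eq]
    simp only [hδ]
    rw [fl_app (fun e : Q × (Option A × Option B) × List D × Q => e.2.1.1.toList), List.map_append, List.flatten_append]
    rfl
  have e1 := hz1 (pref γ i₀ ++ p).length
  have e2 := hz1' (pref γ i₀ ++ p').length
  rw [hin, List.length_append] at e1 e2
  rw [← h1, ← e1] at e2
  exact path_unique hC hp hp' hlen (List.append_cancel_left e2).symm h2

end splice

namespace Comp3
variable [Fintype A] [Fintype B] (C : Comp3 A B D Q)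

open Classical in
/-- The finite runs of length `N` from `q`. -/
noncomputable def paths : ℕ → Q → Finset (List (Q × (Option A × Option B) × List D × Q))
  | 0, _ => {[]}
  | N + 1, q => (labelsOf A B (C.ty q)).biUnion fun l =>
      (paths N (C.edge q l).2).image fun p => (q, l, C.edge q l) :: p

/-- The compression gain of the transition leaving `q` with label `l`. -/
noncomputable def gain [Fintype D] (q : Q) (l : Option A × Option B) : ℝ :=
  l.1.toList.length * Real.log (Fintype.card A) -
    (C.edge q l).1.length * Real.log (Fintype.card D)

/-- The expected compression gain of random runs of length `N` from `q`. -/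
noncomputable def meanGain [Fintype D] : ℕ → Q → ℝ
  | 0, _ => 0
  | N + 1, q => avg (labelsOf A B (C.ty q)) fun l => C.gain q l + meanGain N (C.edge q l).2

/-- The Kraft sum of the runs of length `N` from `q`. -/
noncomputable def kraftSum [Fintype D] : ℕ → Q → ℝ
  | 0, _ => 1
  | N + 1, q => ∑ l ∈ labelsOf A B (C.ty q), (Fintype.card B : ℝ)⁻¹ ^ l.2.toList.length *
      (Fintype.card D : ℝ)⁻¹ ^ (C.edge q l).1.length * kraftSum N (C.edge q l).2

variable {C}

lemma isPath_of_mem_paths {R : Set Q}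
    (hR : ∀ q ∈ R, ∀ l ∈ labelsOf A B (C.ty q), (q, l, C.edge q l) ∈ C.trans ∧ (C.edge q l).2 ∈ R)
    {N : ℕ} {q : Q} (hq : q ∈ R) {p : List (Q × (Option A × Option B) × List D × Q)}
    (hp : p ∈ C.paths N q) : p.length = N ∧ ∃ r ∈ R, IsPath C.trans q p r := by
  induction N generalizing q p with
  | zero =>
    rw [paths, Finset.mem_singleton] at hp
    subst hp
    exact ⟨rfl, q, hq, rfl⟩
  | succ N ih =>
    classical
    simp only [paths, Finset.mem_biUnion, Finset.mem_image] at hp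
    obtain ⟨l, hl, p, hp, rfl⟩ := hp
    obtain ⟨h1, h2⟩ := hR q hq l hl
    obtain ⟨hlen, r, hr, hpath⟩ := ih h2 hp
    exact ⟨by simp [hlen], r, hr, h1, rfl, hpath⟩

lemma kraftSum_eq [Fintype D] (N : ℕ) (q : Q) : C.kraftSum N q = ∑ p ∈ C.paths N q,
    (Fintype.card B : ℝ)⁻¹ ^ (path2 p).length * (Fintype.card D : ℝ)⁻¹ ^ (pathOut p).length := by
  induction N generalizing q with
  | zero => simp [kraftSum, paths, path2, pathOut]
  | succ N ih =>
    classical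
    rw [kraftSum, paths, Finset.sum_biUnion]
    · refine Finset.sum_congr rfl fun l _ => ?_
      rw [Finset.sum_image (by simp), ih, Finset.mul_sum]
      refine Finset.sum_congr rfl fun p _ => ?_
      simp only [path2, pathOut, List.map_cons, List.flatten_cons, List.length_append, pow_add]
      ring
    · intro l _ l' _ hll
      refine Finset.disjoint_left.2 fun p hp hp' => hll ?_
      obtain ⟨p₁, -, rfl⟩ := Finset.mem_image.1 hp
      obtain ⟨p₂, -, h⟩ := Finset.mem_image.1 hp'
      simp only [List.cons.injEq, Prod.mk.injEq] at h
      exact h.1.2.1.symm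

lemma length_pathOut_le {K : ℕ} (hK : ∀ q l, (C.edge q l).1.length ≤ K) {N : ℕ} {q : Q}
    {p : List (Q × (Option A × Option B) × List D × Q)} (hp : p ∈ C.paths N q) :
    (pathOut p).length ≤ K * N := by
  induction N generalizing q p with
  | zero => simp_all [paths, pathOut]
  | succ N ih =>
    classical
    simp only [paths, Finset.mem_biUnion, Finset.mem_image] at hp
    obtain ⟨l, -, p, hp, rfl⟩ := hp
    have h1 := ih hp
    have h2 := hK q l
    simp only [pathOut, List.map_cons, List.flatten_cons, List.length_append, mul_add] at h1 ⊢
    omega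

lemma labelsOf_nonempty [Nonempty A] [Nonempty B] (τ : Bool × Bool) :
    (labelsOf A B τ).Nonempty := by
  obtain ⟨a⟩ := ‹Nonempty A›
  obtain ⟨b⟩ := ‹Nonempty B›
  refine ⟨(if τ.1 then some a else none, if τ.2 then some b else none), ?_⟩
  obtain ⟨_ | _, _ | _⟩ := τ <;> simp [lsupp]

variable [Nonempty B] [Fintype D] [Nonempty D]

lemma kraftSum_pos [Nonempty A] (N : ℕ) (q : Q) : 0 < C.kraftSum N q := by
  have hB : (0 : ℝ) < Fintype.card B := by exact_mod_cast Fintype.card_pos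
  have hD : (0 : ℝ) < Fintype.card D := by exact_mod_cast Fintype.card_pos
  induction N generalizing q with
  | zero => exact one_pos
  | succ N ih =>
    refine Finset.sum_pos (fun l _ => ?_) (labelsOf_nonempty _)
    have := ih (C.edge q l).2
    positivity

/-- The expected gain is bounded by the logarithm of the Kraft sum. -/
lemma meanGain_le [Nonempty A] (N : ℕ) (q : Q) : C.meanGain N q ≤ Real.log (C.kraftSum N q) := by
  have hA : (0 : ℝ) < Fintype.card A := by exact_mod_cast Fintype.card_pos
  have hB : (0 : ℝ) < Fintype.card B := by exact_mod_cast Fintype.card_pos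
  have hD : (0 : ℝ) < Fintype.card D := by exact_mod_cast Fintype.card_pos
  induction N generalizing q with
  | zero => simp [meanGain, kraftSum]
  | succ N ih =>
    set f : Option A × Option B → ℝ := fun l => (Fintype.card A : ℝ) ^ l.1.toList.length *
      (Fintype.card D : ℝ)⁻¹ ^ (C.edge q l).1.length * C.kraftSum N (C.edge q l).2 with hf
    have hpos : ∀ l, 0 < f l := fun l => by
      have := C.kraftSum_pos N (C.edge q l).2
      positivity
    have hlog : ∀ l, Real.log (f l) = C.gain q l + Real.log (C.kraftSum N (C.edge q l).2) := by
      intro l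
      have := C.kraftSum_pos N (C.edge q l).2
      rw [hf]
      dsimp only
      rw [Real.log_mul (by positivity) this.ne', Real.log_mul (by positivity) (by positivity),
        Real.log_pow, Real.log_pow, Real.log_inv, gain]
      ring
    calc C.meanGain (N + 1) q
        ≤ avg (labelsOf A B (C.ty q)) fun l => Real.log (f l) :=
          avg_mono fun l _ => by rw [hlog]; exact add_le_add_right (ih _) _
      _ ≤ Real.log (avg (labelsOf A B (C.ty q)) f) :=
          avg_log_le (labelsOf_nonempty _) fun l _ => hpos l
      _ = _ := by
          congr 1
          rw [avg, kraftSum, Finset.sum_div]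
          refine Finset.sum_congr rfl fun l hl => ?_
          rw [card_labelsOf (mem_labelsOf.1 hl), hf]
          simp only [inv_pow]
          field_simp

lemma kraftSum_le [Fintype Q] {x : ℕ → A} {y : ℕ → B}
    {γ : ℕ → Q × (Option A × Option B) × List D × Q} (hC : C.TwoDet) (hinj : C.OneToOne)
    (hγ : C.IsAccRunOn γ x y) {R : Set Q} (hv : ∀ q ∈ R, ∃ i, (γ i).1 = q)
    (hR : ∀ q ∈ R, ∀ l ∈ labelsOf A B (C.ty q), (q, l, C.edge q l) ∈ C.trans ∧ (C.edge q l).2 ∈ R)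
    {K : ℕ} (hK : ∀ q l, (C.edge q l).1.length ≤ K) (N : ℕ) {q : Q} (hq : q ∈ R) :
    C.kraftSum N q ≤ Fintype.card Q * (K + 1) * (N + 1 : ℝ) ^ 3 := by
  classical
  have hpath : ∀ p ∈ C.paths N q, p.length = N ∧ ∃ r ∈ R, IsPath C.trans q p r :=
    fun p hp => isPath_of_mem_paths hR hq hp
  have hlen := fun p hp => (hpath p hp).1
  have : Nonempty Q := ⟨q⟩
  have hpath := fun p hp => (hpath p hp).2
  choose! e he hpath using hpath
  rw [kraftSum_eq]
  refine (kraft _ path2 pathOut N (K * N) (Fintype.card Q * (N + 1)) (fun p hp => ?_)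
    (fun p hp => length_pathOut_le hK hp) fun t v w ht hvw => ?_).trans ?_
  · exact (flatten_map_toList_length_le _ _).trans (hlen p hp).le
  · rw [← Finset.card_univ, ← Finset.card_range (N + 1), ← Finset.card_product]
    refine Finset.card_le_card_of_injOn (fun p => (e p, (path1 p).length)) (fun p hp => ?_)
      fun p hp p' hp' h => ?_
    · simp only [Finset.coe_product, Finset.coe_univ, Finset.coe_range, Set.mem_prod,
        Set.mem_univ, Set.mem_Iio, true_and, Nat.lt_succ_iff]
      exact (flatten_map_toList_length_le _ _).trans (hlen p (ht hp)).le
    · simp only [Prod.mk.injEq] at h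
      obtain ⟨i₀, hi₀⟩ := hv q hq
      obtain ⟨i₁, hi₁⟩ := hv _ (he p (ht hp))
      have hp1 := hpath p (ht hp)
      have hp2 := hpath p' (ht hp')
      rw [← h.1] at hp2
      rw [← hi₀, ← hi₁] at hp1 hp2
      exact path_unique_of_oneToOne hC hinj hγ hp1 hp2
        ((hlen p (ht hp)).trans (hlen p' (ht hp')).symm) h.2
        ((hvw p hp).1.trans (hvw p' hp').1.symm) ((hvw p hp).2.trans (hvw p' hp').2.symm)
  · push_cast
    have h1 : (0 : ℝ) ≤ N := N.cast_nonneg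
    have h2 : (0 : ℝ) ≤ K := K.cast_nonneg
    have h3 : (0 : ℝ) ≤ Fintype.card Q := Nat.cast_nonneg _
    calc (Fintype.card Q * (N + 1) * ((N + 1) * (K * N + 1)) : ℝ)
        = Fintype.card Q * (N + 1) ^ 2 * (K * N + 1) := by ring
      _ ≤ Fintype.card Q * (N + 1) ^ 2 * ((K + 1) * (N + 1)) := by
          gcongr
          nlinarith
      _ = _ := by ring

end Comp3

end

section

lemma exists_sum_le {f : ℕ → ℝ} {b : ℝ} (h : ∀ᶠ i in atTop, f i ≤ b) :
    ∃ K, ∀ n : ℕ, ∑ i ∈ Finset.range n, f i ≤ b * n + K := by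
  obtain ⟨N, hN⟩ := eventually_atTop.1 h
  refine ⟨∑ i ∈ Finset.range N, |f i - b|, fun n => ?_⟩
  have h1 : ∑ i ∈ Finset.range n, (f i - b) ≤ ∑ i ∈ Finset.range N, |f i - b| := by
    rcases le_total n N with hn | hn
    · calc _ ≤ ∑ i ∈ Finset.range n, |f i - b| := Finset.sum_le_sum fun _ _ => le_abs_self _
        _ ≤ _ := Finset.sum_le_sum_of_subset_of_nonneg (by simpa using hn) fun _ _ _ => abs_nonneg _
    · rw [← Finset.sum_range_add_sum_Ico _ hn]
      have h2 : ∑ i ∈ Finset.Ico N n, (f i - b) ≤ 0 := Finset.sum_nonpos fun i hi => by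
        linarith [hN i (Finset.mem_Ico.1 hi).1]
      have h3 : ∑ i ∈ Finset.range N, (f i - b) ≤ ∑ i ∈ Finset.range N, |f i - b| :=
        Finset.sum_le_sum fun _ _ => le_abs_self _
      linarith
  rw [Finset.sum_sub_distrib, Finset.sum_const, Finset.card_range, nsmul_eq_mul] at h1
  linarith [mul_comm (n : ℝ) b]

lemma length_fl (w : ℕ → List A) (n : ℕ) :
    ((fl w n).length : ℝ) = ∑ i ∈ Finset.range n, ((w i).length : ℝ) := by
  induction n with
  | zero => simp
  | succ n ih => rw [fl_succ, List.length_append, Nat.cast_add, ih, Finset.sum_range_succ]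

namespace Comp3

lemma tendsto_meanGain [Fintype A] [Fintype B] [Fintype D] [Finite Q] (C : Comp3 A B D Q)
    {s : ℕ → Q} {l : ℕ → Option A × Option B}
    (h : Equi (fun q => labelsOf A B (C.ty q)) s l)
    (hn : ∀ i, s (i + 1) = (C.edge (s i) (l i)).2) (N : ℕ) :
    Tendsto (fun n : ℕ => (N * ∑ i ∈ Finset.range n, C.gain (s i) (l i) -
      ∑ i ∈ Finset.range n, C.meanGain N (s i)) / n) atTop (𝓝 0) := by
  induction N with
  | zero => simp [meanGain]
  | succ N ih =>
    have h1 := h fun q l => C.gain q l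
    have h2 := h.tendsto_invariant (nxt := fun q l => (C.edge q l).2) hn (C.meanGain N)
    have h3 := (ih.add h1).add h2
    rw [add_zero, add_zero] at h3
    refine h3.congr fun n => ?_
    simp only [meanGain, avg_add, Finset.sum_sub_distrib, Finset.sum_add_distrib, Nat.cast_add,
      Nat.cast_one]
    ring

variable [Fintype A] [Fintype B] [Finite Q]
  {C : Comp3 A B D Q} {x : ℕ → A} {y : ℕ → B}
  {γ : ℕ → Q × (Option A × Option B) × List D × Q}

lemma exists_le_in1 (hC : C.TwoDet) (hγ : C.IsAccRunOn γ x y)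
    (h : Equi (fun q => labelsOf A B (C.ty q)) (fun n => (γ n).1) fun n => (γ n).2.1) :
    ∃ c > 0, ∀ᶠ n : ℕ in atTop, c * n ≤ ((c3in1 γ n).length : ℝ) := by
  have hl : ∀ i, (γ i).2.1 ∈ labelsOf A B (C.ty (γ i).1) := fun i =>
    mem_labelsOf.2 (ty_eq hC (hγ.2.1 i))
  have hn : ∀ i, (γ (i + 1)).1 = (C.edge (γ i).1 (γ i).2.1).2 := fun i => by
    rw [edge_eq hC (hγ.2.1 i), hγ.2.2.1]
  have hfreq : ∃ᶠ i in atTop, ∃ q, (γ i).1 = q ∧ (C.ty q).1 = true := by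
    by_contra hcon
    obtain ⟨N, hN⟩ := eventually_atTop.1 (not_frequently.1 hcon)
    have hbd : ∀ n, (c3in1 γ n).length ≤ N := by
      intro n
      rw [c3in1_eq]
      rcases le_total n N with hnN | hnN
      · exact (flatten_map_toList_length_le (fun i => (γ i).2.1.1) _).trans (by simpa using hnN)
      · obtain ⟨k, rfl⟩ := Nat.exists_eq_add_of_le hnN
        induction k with
        | zero =>
          exact (flatten_map_toList_length_le (fun i => (γ i).2.1.1) _).trans (by simp)
        | succ k ih =>
          rw [← add_assoc, fl_succ, List.length_append]
          have h1 := hN (N + k) (by omega)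
          have h2 : (γ (N + k)).2.1.1 = none := by
            by_contra h3
            refine h1 ⟨_, rfl, ?_⟩
            rw [← ty_eq hC (hγ.2.1 (N + k))]
            exact Option.isSome_iff_ne_none.2 h3
          rw [h2]
          simpa using ih (by omega)
    obtain ⟨n, hn⟩ := (hγ.2.2.2.2.2.1.eventually_gt_atTop N).exists
    exact absurd (hbd n) (by omega)
  obtain ⟨q, hq⟩ : ∃ q, ∃ᶠ i in atTop, (γ i).1 = q ∧ (C.ty q).1 = true := by
    by_contra hcon
    push Not at hcon
    refine hfreq ?_
    have h1 := eventually_all.2 hcon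
    filter_upwards [h1] with i hi
    rintro ⟨q, h2, h3⟩
    exact hi q h2 h3
  have hqt : (C.ty q).1 = true := hq.exists.choose_spec.2
  obtain ⟨c, hc, hev⟩ := h.exists_pos hl (nxt := fun q l => (C.edge q l).2) hn
    (hq.mono fun _ h => h.1)
  refine ⟨c, hc, hev.mono fun n hn => hn.trans ?_⟩
  rw [c3in1_eq, length_fl, visits]
  refine Finset.sum_le_sum fun i _ => ?_
  split_ifs with hi
  · have h1 := ty_eq hC (hγ.2.1 i)
    rw [hi] at h1
    rw [← h1] at hqt
    obtain ⟨a, ha⟩ := Option.isSome_iff_exists.1 hqt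
    simp [ha]
  · positivity

variable [Nonempty A] [Nonempty B] [Fintype D] [Nonempty D]

/-- The compression gain along an equidistributed accepting run is sublinear. -/
lemma eventually_gain_le (hC : C.TwoDet) (hinj : C.OneToOne) (hγ : C.IsAccRunOn γ x y)
    (h : Equi (fun q => labelsOf A B (C.ty q)) (fun n => (γ n).1) fun n => (γ n).2.1)
    {ε : ℝ} (hε : 0 < ε) : ∀ᶠ n : ℕ in atTop,
      (c3in1 γ n).length * Real.log (Fintype.card A) -
        (c3out γ n).length * Real.log (Fintype.card D) ≤ ε * n := by
  have := Fintype.ofFinite Q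
  have hl : ∀ i, (γ i).2.1 ∈ labelsOf A B (C.ty (γ i).1) := fun i =>
    mem_labelsOf.2 (ty_eq hC (hγ.2.1 i))
  have hed : ∀ i, C.edge (γ i).1 (γ i).2.1 = (γ i).2.2 := fun i => edge_eq hC (hγ.2.1 i)
  have hn : ∀ i, (γ (i + 1)).1 = (C.edge (γ i).1 (γ i).2.1).2 := fun i => by
    rw [hed, hγ.2.2.1]
  set R : Set Q := {q | ∃ᶠ i in atTop, (γ i).1 = q} with hRdef
  have hRev : ∀ᶠ i in atTop, (γ i).1 ∈ R := by
    have : ∀ᶠ i in atTop, ∀ q ∉ R, (γ i).1 ≠ q := by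
      rw [eventually_all]
      intro q
      by_cases hq : q ∈ R
      · simp [hq]
      · simpa [hq] using not_frequently.1 hq
    filter_upwards [this] with i hi
    by_contra hcon
    exact hi _ hcon rfl
  have hR : ∀ q ∈ R, ∀ l ∈ labelsOf A B (C.ty q),
      (q, l, C.edge q l) ∈ C.trans ∧ (C.edge q l).2 ∈ R := by
    intro q hq l hlq
    have hfreq : ∃ᶠ i in atTop, (γ i).1 = q ∧ (γ i).2.1 = l :=
      h.frequently_label hl (nxt := fun q l => (C.edge q l).2) hn hq hlq
    constructor
    · obtain ⟨i, rfl, rfl⟩ := hfreq.exists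
      rw [hed]
      exact hγ.2.1 i
    · refine ((tendsto_add_atTop_nat 1).frequently (p := fun i => (γ i).1 = (C.edge q l).2)
        (hfreq.mono ?_))
      rintro i ⟨rfl, rfl⟩
      exact hn i
  obtain ⟨K, hK⟩ : ∃ K, ∀ q l, (C.edge q l).1.length ≤ K := by
    obtain ⟨K, hK⟩ := (Set.finite_range
      fun p : Q × (Option A × Option B) => (C.edge p.1 p.2).1.length).bddAbove
    exact ⟨K, fun q l => hK ⟨(q, l), rfl⟩⟩
  obtain ⟨i₀, hi₀⟩ := hRev.exists
  have : Nonempty Q := ⟨(γ i₀).1⟩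
  have hQ : (0 : ℝ) < Fintype.card Q := by exact_mod_cast Fintype.card_pos
  have hc : (0 : ℝ) < Fintype.card Q * (K + 1) := by positivity
  obtain ⟨N, hN, hN0⟩ := (((tendsto_log_div_atTop _ hc 3).eventually_lt_const
    (half_pos hε)).and (eventually_gt_atTop 0)).exists
  have hNpos : (0 : ℝ) < N := by exact_mod_cast hN0
  obtain ⟨K', hK'⟩ := exists_sum_le (f := fun i => C.meanGain N (γ i).1)
    (b := Real.log (Fintype.card Q * (K + 1) * (N + 1 : ℝ) ^ 3)) <| hRev.mono fun i hi =>
      (C.meanGain_le N _).trans <| Real.log_le_log (C.kraftSum_pos N _) <|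
        C.kraftSum_le hC hinj hγ (fun q hq => hq.exists) hR hK N hi
  have hlim := (C.tendsto_meanGain h hn N).eventually_lt_const (show 0 < N * (ε / 4) by positivity)
  have hK'' := (tendsto_natCast_atTop_atTop (R := ℝ)).eventually_ge_atTop (K' / (N * (ε / 4)))
  filter_upwards [hlim, hK'', eventually_gt_atTop 0] with n h1 h2 h3
  have hn0 : (0 : ℝ) < n := by exact_mod_cast h3
  rw [div_lt_iff₀ hn0] at h1
  rw [div_le_iff₀ (by positivity)] at h2
  rw [div_lt_iff₀ hNpos] at hN
  have h4 := hK' n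
  have hsum : ((c3in1 γ n).length * Real.log (Fintype.card A) -
      (c3out γ n).length * Real.log (Fintype.card D) : ℝ) =
      ∑ i ∈ Finset.range n, C.gain (γ i).1 (γ i).2.1 := by
    simp only [c3in1_eq, c3out_eq, length_fl, gain, hed, Finset.sum_sub_distrib, Finset.sum_mul]
  rw [hsum]
  have h5 : (N : ℝ) * ∑ i ∈ Finset.range n, C.gain (γ i).1 (γ i).2.1 ≤ N * (ε * n) := by
    have h6 : Real.log (Fintype.card Q * (K + 1) * (N + 1 : ℝ) ^ 3) * n ≤ ε / 2 * N * n := by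
      gcongr
    linarith
  exact le_of_mul_le_mul_left h5 hNpos

/-- An equidistributed accepting run is not compressed. -/
lemma one_le_liminf (hA : 2 ≤ Fintype.card A) (hC : C.TwoDet) (hinj : C.OneToOne)
    (hγ : C.IsAccRunOn γ x y)
    (h : Equi (fun q => labelsOf A B (C.ty q)) (fun n => (γ n).1) fun n => (γ n).2.1) :
    1 ≤ liminf (fun n : ℕ => (((c3out γ n).length : ℝ) * Real.log (Fintype.card D)) /
      (((c3in1 γ n).length : ℝ) * Real.log (Fintype.card A))) atTop := by
  have hlogA : 0 < Real.log (Fintype.card A) := Real.log_pos (by exact_mod_cast hA)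
  have hlogD : 0 ≤ Real.log (Fintype.card D) := Real.log_natCast_nonneg _
  obtain ⟨c, hc, hin⟩ := exists_le_in1 hC hγ h
  obtain ⟨K, hK⟩ : ∃ K, ∀ q l, (C.edge q l).1.length ≤ K := by
    obtain ⟨K, hK⟩ := (Set.finite_range
      fun p : Q × (Option A × Option B) => (C.edge p.1 p.2).1.length).bddAbove
    exact ⟨K, fun q l => hK ⟨(q, l), rfl⟩⟩
  have hout : ∀ n, ((c3out γ n).length : ℝ) ≤ K * n := fun n => by
    rw [c3out_eq, length_fl]
    calc _ ≤ ∑ i ∈ Finset.range n, (K : ℝ) := Finset.sum_le_sum fun i _ => by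
          rw [← edge_eq hC (hγ.2.1 i)]
          exact_mod_cast hK _ _
      _ = _ := by simp [mul_comm]
  have hcob : IsCoboundedUnder (· ≥ ·) atTop fun n : ℕ =>
      (((c3out γ n).length : ℝ) * Real.log (Fintype.card D)) /
      (((c3in1 γ n).length : ℝ) * Real.log (Fintype.card A)) := by
    refine IsBoundedUnder.isCoboundedUnder_ge ⟨K * Real.log (Fintype.card D) /
      (c * Real.log (Fintype.card A)), ?_⟩
    rw [eventually_map]
    filter_upwards [hin, eventually_gt_atTop 0] with n hn hn0
    have hn0 : (0 : ℝ) < n := by exact_mod_cast hn0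
    have h1 : (0 : ℝ) < (c3in1 γ n).length := lt_of_lt_of_le (by positivity) hn
    rw [div_le_div_iff₀ (by positivity) (by positivity)]
    calc ((c3out γ n).length : ℝ) * Real.log (Fintype.card D) * (c * Real.log (Fintype.card A))
        ≤ (K * n) * Real.log (Fintype.card D) * (c * Real.log (Fintype.card A)) := by
          gcongr
          exact hout n
      _ = K * Real.log (Fintype.card D) * ((c * n) * Real.log (Fintype.card A)) := by ring
      _ ≤ _ := by gcongr
  refine le_of_forall_pos_sub_le fun ε hε => ?_
  refine le_liminf_of_le hcob ?_
  filter_upwards [hin, eventually_gt_atTop 0, eventually_gain_le hC hinj hγ h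
    (show 0 < ε * (c * Real.log (Fintype.card A)) by positivity)] with n hn hn0 hg
  have hn0 : (0 : ℝ) < n := by exact_mod_cast hn0
  have h1 : (0 : ℝ) < (c3in1 γ n).length := lt_of_lt_of_le (by positivity) hn
  rw [le_div_iff₀ (by positivity)]
  have h2 : ε * (c * Real.log (Fintype.card A)) * n ≤
      ε * ((c3in1 γ n).length * Real.log (Fintype.card A)) := by
    rw [mul_assoc, show c * Real.log (Fintype.card A) * n =
      c * n * Real.log (Fintype.card A) by ring]
    gcongr
  linarith

end Comp3

end

section

/-! ### Normal words are unpredictable without oracle -/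

lemma pref_cons (x : ℕ → A) (n : ℕ) : pref x (n + 1) = x 0 :: pref (fun i => x (i + 1)) n := by
  simp [pref, List.range_succ_eq_map, Function.comp_def]

open Classical in
/-- The finite words of given length. -/
noncomputable def wordsOf (A : Type*) [Fintype A] : ℕ → Finset (List A)
  | 0 => {[]}
  | L + 1 => Finset.univ.biUnion fun a => (wordsOf A L).image fun u => a :: u

/-- The sum of `G` along the run of a deterministic automaton reading a word. -/
def runSum (δ : Q → A → Q) (G : Q → A → ℝ) : Q → List A → ℝ
  | _, [] => 0
  | q, a :: u => G q a + runSum δ G (δ q a) u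

lemma runSum_pref {δ : Q → A → Q} (G : Q → A → ℝ) {r : ℕ → Q} {x : ℕ → A}
    (hr : ∀ j, r (j + 1) = δ (r j) (x j)) (n : ℕ) :
    runSum δ G (r 0) (pref x n) = ∑ j ∈ Finset.range n, G (r j) (x j) := by
  induction n generalizing r x with
  | zero => rfl
  | succ n ih =>
    rw [pref_cons, runSum, ← hr 0, ih (r := fun i => r (i + 1)) (x := fun i => x (i + 1))
      fun j => hr (j + 1), Finset.sum_range_succ', add_comm]

section wordsOf
variable [Fintype A]

lemma sum_wordsOf_succ (L : ℕ) (f : List A → ℝ) :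
    ∑ u ∈ wordsOf A (L + 1), f u = ∑ a, ∑ u ∈ wordsOf A L, f (a :: u) := by
  classical
  rw [wordsOf, Finset.sum_biUnion]
  · exact Finset.sum_congr rfl fun a _ => Finset.sum_image (by simp)
  · intro a _ a' _ h
    refine Finset.disjoint_left.2 fun u hu hu' => h ?_
    obtain ⟨v, -, rfl⟩ := Finset.mem_image.1 hu
    obtain ⟨v', -, hv⟩ := Finset.mem_image.1 hu'
    exact (List.cons.inj hv).1.symm

lemma mem_wordsOf {L : ℕ} {u : List A} : u ∈ wordsOf A L ↔ u.length = L := by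
  induction L generalizing u with
  | zero => simp [wordsOf]
  | succ L ih =>
    simp only [wordsOf, Finset.mem_biUnion, Finset.mem_univ, true_and, Finset.mem_image, ih]
    cases u <;> simp

lemma card_wordsOf (L : ℕ) : ((wordsOf A L).card : ℝ) = (Fintype.card A : ℝ) ^ L := by
  induction L with
  | zero => simp [wordsOf]
  | succ L ih =>
    have h := sum_wordsOf_succ (A := A) L fun _ => 1
    simp only [Finset.sum_const, nsmul_eq_mul, mul_one, Finset.card_univ] at h
    rw [h, ih, pow_succ, mul_comm]

variable {δ : Q → A → Q} {G : Q → A → ℝ}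

lemma sum_runSum (hG : ∀ q, ∑ a, G q a = 0) (L : ℕ) (q : Q) :
    ∑ u ∈ wordsOf A L, runSum δ G q u = 0 := by
  induction L generalizing q with
  | zero => simp [wordsOf, runSum]
  | succ L ih =>
    rw [sum_wordsOf_succ]
    simp only [runSum, Finset.sum_add_distrib, ih, Finset.sum_const, ← Finset.smul_sum, hG,
      smul_zero, add_zero]

/-- The increments along random runs are orthogonal. -/
lemma sum_runSum_sq_le (hG : ∀ q, ∑ a, G q a = 0) {K : ℝ} (hK : ∀ q a, |G q a| ≤ K) (L : ℕ)
    (q : Q) : ∑ u ∈ wordsOf A L, runSum δ G q u ^ 2 ≤ (Fintype.card A : ℝ) ^ L * (K ^ 2 * L) := by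
  induction L generalizing q with
  | zero => simp [wordsOf, runSum]
  | succ L ih =>
    rw [sum_wordsOf_succ]
    have h : ∀ a : A, ∑ u ∈ wordsOf A L, runSum δ G q (a :: u) ^ 2 ≤
        (Fintype.card A : ℝ) ^ L * (K ^ 2 * (L + 1)) := by
      intro a
      have h1 : ∑ u ∈ wordsOf A L, runSum δ G q (a :: u) ^ 2 =
          (Fintype.card A : ℝ) ^ L * G q a ^ 2 + 2 * G q a *
            ∑ u ∈ wordsOf A L, runSum δ G (δ q a) u +
          ∑ u ∈ wordsOf A L, runSum δ G (δ q a) u ^ 2 := by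
        rw [← card_wordsOf, ← nsmul_eq_mul, ← Finset.sum_const, Finset.mul_sum,
          ← Finset.sum_add_distrib, ← Finset.sum_add_distrib]
        refine Finset.sum_congr rfl fun u _ => ?_
        rw [runSum]
        ring
      rw [h1, sum_runSum hG, mul_zero, add_zero]
      have h2 : G q a ^ 2 ≤ K ^ 2 := sq_le_sq' (neg_le_of_abs_le (hK q a)) (le_of_abs_le (hK q a))
      have h3 := ih (δ q a)
      have h4 : (Fintype.card A : ℝ) ^ L * G q a ^ 2 ≤ (Fintype.card A : ℝ) ^ L * K ^ 2 := by
        gcongr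
      linarith
    calc _ ≤ ∑ a : A, (Fintype.card A : ℝ) ^ L * (K ^ 2 * (L + 1)) :=
          Finset.sum_le_sum fun a _ => h a
      _ = _ := by
          rw [Finset.sum_const, nsmul_eq_mul, Finset.card_univ]
          push_cast
          ring

lemma sum_abs_runSum_le (hG : ∀ q, ∑ a, G q a = 0) {K : ℝ} (hK0 : 0 ≤ K)
    (hK : ∀ q a, |G q a| ≤ K) (L : ℕ) (q : Q) :
    ∑ u ∈ wordsOf A L, |runSum δ G q u| ≤ (Fintype.card A : ℝ) ^ L * (K * √L) := by
  refine abs_le_of_sq_le_sq' ?_ (by positivity) |>.2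
  have h := sq_sum_le_card_mul_sum_sq (s := wordsOf A L) (f := fun u => |runSum δ G q u|)
  simp only [sq_abs] at h
  rw [card_wordsOf] at h
  refine h.trans ?_
  calc _ ≤ (Fintype.card A : ℝ) ^ L * ((Fintype.card A : ℝ) ^ L * (K ^ 2 * L)) := by
        gcongr
        exact sum_runSum_sq_le hG hK L q
    _ = _ := by
        rw [mul_pow, mul_pow, Real.sq_sqrt L.cast_nonneg]
        ring

lemma Normal.tendsto_blocks {x : ℕ → A} (hx : Normal x) {L : ℕ} (hL : 1 ≤ L) (W : List A → ℝ) :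
    Tendsto (fun m : ℕ => (∑ k ∈ Finset.range m, W (pref (fun i => x (k * L + i)) L)) / m) atTop
      (𝓝 (∑ u ∈ wordsOf A L, W u * (Fintype.card A : ℝ)⁻¹ ^ L)) := by
  classical
  refine (tendsto_finsetSum _ fun u hu => (hx L hL u (mem_wordsOf.1 hu)).const_mul (W u)).congr
    fun m => ?_
  calc _ = ∑ u ∈ wordsOf A L, W u * ((∑ k ∈ Finset.range m,
        if pref (fun i => x (k * L + i)) L = u then (1 : ℝ) else 0) / m) :=
        Finset.sum_congr rfl fun u hu => by rw [alocc_pref x hL (mem_wordsOf.1 hu)]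
    _ = _ := by
        simp only [← mul_div_assoc, ← Finset.sum_div, Finset.mul_sum]
        rw [Finset.sum_comm]
        congr 1
        refine Finset.sum_congr rfl fun k _ => ?_
        simp [mem_wordsOf]

lemma sum_range_mul_blocks (f : ℕ → ℝ) (L m : ℕ) :
    ∑ j ∈ Finset.range (m * L), f j =
      ∑ k ∈ Finset.range m, ∑ i ∈ Finset.range L, f (k * L + i) := by
  induction m with
  | zero => simp
  | succ m ih => rw [add_mul, one_mul, Finset.sum_range_add, ih, Finset.sum_range_succ]

/-- A finite automaton reading a normal word does not predict its symbols. -/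
lemma Normal.tendsto_runSum [Finite Q] {x : ℕ → A} (hx : Normal x) {r : ℕ → Q}
    (hr : ∀ j, r (j + 1) = δ (r j) (x j)) (hG : ∀ q, ∑ a, G q a = 0) :
    Tendsto (fun n : ℕ => (∑ j ∈ Finset.range n, G (r j) (x j)) / n) atTop (𝓝 0) := by
  have := Fintype.ofFinite Q
  obtain ⟨K, hK0, hK⟩ : ∃ K, 0 ≤ K ∧ ∀ q a, |G q a| ≤ K := by
    obtain ⟨K, hK⟩ := (Set.finite_range fun p : Q × A => |G p.1 p.2|).bddAbove
    have h : ∀ q a, |G q a| ≤ K := fun q a => hK ⟨(q, a), rfl⟩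
    exact ⟨K, (abs_nonneg _).trans (h (r 0) (x 0)), h⟩
  rw [Metric.tendsto_atTop]
  intro ε hε
  simp only [dist_zero_right, Real.norm_eq_abs]
  have hApos : (0 : ℝ) < Fintype.card A := by
    have : Nonempty A := ⟨x 0⟩
    exact_mod_cast Fintype.card_pos
  obtain ⟨L, hL, hL1⟩ : ∃ L : ℕ, Fintype.card Q * (K * √L) ≤ ε / 4 * L ∧ 1 ≤ L := by
    have h1 : Tendsto (fun L : ℕ => √(L : ℝ)) atTop atTop :=
      Real.tendsto_sqrt_atTop.comp tendsto_natCast_atTop_atTop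
    obtain ⟨L, h2, h3⟩ := ((h1.eventually_ge_atTop (Fintype.card Q * K / (ε / 4))).and
      (eventually_ge_atTop 1)).exists
    refine ⟨L, ?_, h3⟩
    rw [div_le_iff₀ (by positivity)] at h2
    calc Fintype.card Q * (K * √L) = Fintype.card Q * K * √L := by ring
      _ ≤ √L * (ε / 4) * √L := by gcongr
      _ = ε / 4 * (√L * √L) := by ring
      _ = _ := by rw [Real.mul_self_sqrt L.cast_nonneg]
  have hLpos : (0 : ℝ) < L := by exact_mod_cast hL1
  set W : List A → ℝ := fun u => ∑ q, |runSum δ G q u| with hW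
  have hlim : ∑ u ∈ wordsOf A L, W u * (Fintype.card A : ℝ)⁻¹ ^ L < ε / 2 * L := by
    rw [← Finset.sum_mul, hW, Finset.sum_comm]
    calc _ ≤ (∑ q : Q, (Fintype.card A : ℝ) ^ L * (K * √L)) * (Fintype.card A : ℝ)⁻¹ ^ L := by
          gcongr with q
          exact sum_abs_runSum_le hG hK0 hK L q
      _ = Fintype.card Q * (K * √L) := by
          rw [Finset.sum_const, nsmul_eq_mul, Finset.card_univ, inv_pow]
          field_simp
      _ ≤ ε / 4 * L := hL
      _ < _ := by linarith [mul_pos hε hLpos]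
  have hblock := (Nat.tendsto_div_const_atTop (by omega : L ≠ 0)).eventually
    (((hx.tendsto_blocks hL1 W).eventually_lt_const hlim).and (eventually_gt_atTop 0))
  have hlarge := (tendsto_natCast_atTop_atTop (R := ℝ)).eventually_gt_atTop (K * L / (ε / 2))
  refine eventually_atTop.1 ?_
  filter_upwards [hblock, hlarge, eventually_gt_atTop 0] with n ⟨h1, h2⟩ h3 hn
  have hn0 : (0 : ℝ) < n := by exact_mod_cast hn
  have hm0 : (0 : ℝ) < (n / L : ℕ) := by exact_mod_cast h2
  rw [div_lt_iff₀ hm0] at h1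
  rw [div_lt_iff₀ (by positivity)] at h3
  have hdecomp : n = n / L * L + n % L := (Nat.div_add_mod' n L).symm
  have hmain : |∑ j ∈ Finset.range (n / L * L), G (r j) (x j)| ≤
      ∑ k ∈ Finset.range (n / L), W (pref (fun i => x (k * L + i)) L) := by
    rw [sum_range_mul_blocks]
    refine (Finset.abs_sum_le_sum_abs _ _).trans (Finset.sum_le_sum fun k _ => ?_)
    rw [← runSum_pref (δ := δ) G (r := fun i => r (k * L + i)) (x := fun i => x (k * L + i))
      (fun j => hr _) L]
    exact Finset.single_le_sum (f := fun q => |runSum δ G q (pref (fun i => x (k * L + i)) L)|)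
      (fun _ _ => abs_nonneg _) (Finset.mem_univ (r (k * L + 0)))
  have hrest : |∑ j ∈ Finset.range (n % L), G (r (n / L * L + j)) (x (n / L * L + j))| ≤ K * L := by
    refine (Finset.abs_sum_le_sum_abs _ _).trans ?_
    calc _ ≤ ∑ j ∈ Finset.range (n % L), K := Finset.sum_le_sum fun j _ => hK _ _
      _ = K * (n % L : ℕ) := by rw [Finset.sum_const, Finset.card_range, nsmul_eq_mul, mul_comm]
      _ ≤ K * L := by
          gcongr
          exact (Nat.mod_lt n (by omega)).le
  have htotal : |∑ j ∈ Finset.range n, G (r j) (x j)| < ε / 2 * L * (n / L : ℕ) + K * L := by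
    conv_lhs => rw [hdecomp, Finset.sum_range_add]
    exact (abs_add_le _ _).trans_lt (by linarith)
  rw [abs_div, Nat.abs_cast, div_lt_iff₀ hn0]
  have hdiv : (L : ℝ) * (n / L : ℕ) ≤ n := by exact_mod_cast Nat.mul_div_le n L
  have : ε / 2 * L * (n / L : ℕ) ≤ ε / 2 * n := by
    rw [mul_assoc]
    gcongr
  linarith

end wordsOf

universe w in
/-- Normal words are unpredictable with a trivial oracle. -/
lemma Normal.unpredictable [Fintype A] {x : ℕ → A} (hx : Normal x) :
    Unpredictable.{w} x fun _ => () := by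
  intro Q _ M F
  have hA : (Fintype.card A : ℝ) ≠ 0 := by
    have : Nonempty A := ⟨x 0⟩
    exact_mod_cast Fintype.card_ne_zero
  set fp : Q → Option Q := firstPassage (fun q => M.rd q = true) fun q => M.δb q () with hfp
  set r : ℕ → Option Q := fun j =>
    Nat.rec (fp M.init) (fun j s => s.bind fun q => fp (M.δa q (x j))) j with hr
  set G : Option Q → A → ℝ := fun s a =>
    s.elim 0 fun q => F q a - avg Finset.univ (F q) with hGdef
  have hG : ∀ s, ∑ a, G s a = 0 := by
    rintro (_ | q)
    · simp [hGdef]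
    · simp only [hGdef, Option.elim_some, Finset.sum_sub_distrib, Finset.sum_const, nsmul_eq_mul,
        avg, Finset.card_univ]
      field_simp
      simp
  have hlim := hx.tendsto_runSum (δ := fun s a => s.bind fun q => fp (M.δa q a)) (r := r)
    (fun _ => rfl) hG
  have key : ∀ n, (M.cfg x (fun _ => ()) n).2.1 ≤ 1 * n ∧
      fp (M.cfg x (fun _ => ()) n).1 = r (M.cfg x (fun _ => ()) n).2.1 ∧
      ∑ i ∈ Finset.range n, M.dev x (fun _ => ()) F i =
        ∑ j ∈ Finset.range (M.cfg x (fun _ => ()) n).2.1, G (r j) (x j) := by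
    intro n
    induction n with
    | zero => exact ⟨le_rfl, rfl, rfl⟩
    | succ n ih =>
      obtain ⟨h1, h2, h3⟩ := ih
      cases hrd : M.rd (M.cfg x (fun _ => ()) n).1
      · rw [Finset.sum_range_succ, h3, M.cfg_succ_of_not_rd x _ hrd]
        refine ⟨by dsimp only; omega, ?_, by simp [Mach.dev, hrd]⟩
        rw [← h2]
        exact firstPassage_of_not (P := fun q => M.rd q = true) _ (by simp [hrd])
      · have h4 : r (M.cfg x (fun _ => ()) n).2.1 = some (M.cfg x (fun _ => ()) n).1 := by
          rw [← h2]
          exact firstPassage_of (P := fun q => M.rd q = true) _ hrd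
        rw [Finset.sum_range_succ, h3, M.cfg_succ_of_rd x _ hrd]
        refine ⟨by dsimp only; omega, ?_, ?_⟩
        · change _ = (r (M.cfg x (fun _ => ()) n).2.1).bind _
          rw [h4]
          rfl
        · rw [Finset.sum_range_succ, h4]
          simp [Mach.dev, hrd, hGdef]
  exact (tendsto_comp_div (g := fun k => ∑ j ∈ Finset.range k, G (r j) (x j)) hlim
    (c := fun n => (M.cfg x (fun _ => ()) n).2.1) (K := 1) fun n => (key n).1).congr fun n => by
      rw [(key n).2.2]

universe w in
/-- The trivial word is unpredictable. -/
lemma unpredictable_unit (x : ℕ → A) : Unpredictable.{w} (fun _ => () : ℕ → Unit) x := by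
  intro Q _ M F
  simp [Mach.dev, avg]

end

section

/-! ### Compression ratios -/

section ratios

universe u v
variable {A : Type u} {B : Type v}

lemma liminf_nonneg {f : ℕ → ℝ} (h : ∀ n, 0 ≤ f n) : 0 ≤ liminf f atTop := by
  rw [liminf_eq]
  exact Real.sSup_nonneg' ⟨0, Eventually.of_forall h, le_rfl⟩

lemma fl_singleton (x : ℕ → A) (n : ℕ) : fl (fun i => [x i]) n = pref x n := by
  induction n with
  | zero => rfl
  | succ n ih => rw [fl_succ, ih, pref_succ]

/-- Two infinite words whose prefixes are prefixes of one another coincide. -/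
lemma eq_of_prefixes {x x' : ℕ → A} (h : ∀ n, ∃ m, pref x n <+: pref x' m) : x = x' :=
  pref_injective fun n => by
    obtain ⟨m, hm⟩ := h n
    simpa using eq_pref_of_isPrefix hm (by simp)

lemma prefixes_of_map {e : A → D} (he : Function.Injective e) {x x' : ℕ → A} {u u' : ℕ → List A}
    (hu : ∀ n, u n = pref x (u n).length) (hu' : ∀ n, u' n = pref x' (u' n).length)
    (hlen : Tendsto (fun n => (u n).length) atTop atTop)
    (h : ∀ n, ∃ m, (u n).map e <+: (u' m).map e) : x = x' := by
  refine eq_of_prefixes fun n => ?_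
  obtain ⟨k, hk⟩ := (hlen.eventually_ge_atTop n).exists
  obtain ⟨m, hm⟩ := h k
  refine ⟨(u' m).length, ?_⟩
  rw [← hu' m]
  refine (pref_isPrefix x hk).trans ?_
  rw [← hu k]
  rw [List.prefix_iff_eq_take, ← List.map_take, List.length_map] at hm
  rw [List.prefix_iff_eq_take]
  exact List.map_injective_iff.2 he hm

variable [Fintype A]

lemma liminf_ratio_eq_one (hA : 2 ≤ Fintype.card A) {f g : ℕ → ℕ} (h : ∀ n, f n = g n)
    (hg : Tendsto g atTop atTop) :
    1 = liminf (fun n : ℕ => ((f n : ℝ) * Real.log (Fintype.card A)) /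
      ((g n : ℝ) * Real.log (Fintype.card A))) atTop := by
  have hlogA : 0 < Real.log (Fintype.card A) := Real.log_pos (by exact_mod_cast hA)
  have h1 : (fun n : ℕ => ((f n : ℝ) * Real.log (Fintype.card A)) /
      ((g n : ℝ) * Real.log (Fintype.card A))) =ᶠ[atTop] fun _ => 1 := by
    filter_upwards [hg.eventually_gt_atTop 0] with n hn
    have : (0 : ℝ) < g n := by exact_mod_cast hn
    rw [h, div_self (by positivity)]
  rw [liminf_congr h1, liminf_const]

lemma condRho_le [Fintype B] {x : ℕ → A} {y : ℕ → B} {m d : ℕ} (hd : 2 ≤ d) {C : Comp3 A B (Fin d) (Fin m)}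
    (hC : C.TwoDet) (hinj : C.OneToOne) {γ : _} (hγ : C.IsAccRunOn γ x y) :
    condRho x y ≤ Filter.liminf (fun n : ℕ => (((c3out γ n).length : ℝ) * Real.log d) /
        (((c3in1 γ n).length : ℝ) * Real.log (Fintype.card A))) atTop := by
  refine csInf_le ⟨0, ?_⟩ ⟨m, d, hd, C, hC, hinj, γ, hγ, rfl⟩
  rintro _ ⟨m, d, hd, C, -, -, γ, -, rfl⟩
  exact liminf_nonneg fun n => by
    have := Real.log_natCast_nonneg d
    have := Real.log_natCast_nonneg (Fintype.card A)
    positivity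

lemma rho_le {x : ℕ → A} {m d : ℕ} (hd : 2 ≤ d) {C : Comp2 A (Fin d) (Fin m)}
    (hC : C.OneDet) (hinj : C.OneToOne) {γ : _} (hγ : C.IsAccRunOn γ x) :
    rho x ≤ Filter.liminf (fun n : ℕ => (((c2out γ n).length : ℝ) * Real.log d) /
        (((c2in γ n).length : ℝ) * Real.log (Fintype.card A))) atTop := by
  refine csInf_le ⟨0, ?_⟩ ⟨m, d, hd, C, hC, hinj, γ, hγ, rfl⟩
  rintro _ ⟨m, d, hd, C, -, -, γ, -, rfl⟩
  exact liminf_nonneg fun n => by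
    have := Real.log_natCast_nonneg d
    have := Real.log_natCast_nonneg (Fintype.card A)
    positivity

/-- The compressor copying its first input. -/
def copyComp (A B : Type*) [Fintype A] : Comp3 A B (Fin (Fintype.card A)) (Fin 1) where
  init := 0
  trans := {t | ∃ a b, t = (0, (some a, some b), [Fintype.equivFin A a], 0)}

lemma copyComp_out {γ : ℕ → Fin 1 × (Option A × Option B) × List (Fin (Fintype.card A)) × Fin 1}
    (h : ∀ n, γ n ∈ (copyComp A B).trans) (n : ℕ) :
    c3out γ n = (c3in1 γ n).map (Fintype.equivFin A) := by
  rw [c3out_eq, c3in1_eq]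
  induction n with
  | zero => rfl
  | succ n ih =>
    obtain ⟨a, b, hab⟩ := h n
    simp [fl_succ, ih, hab]

lemma exists_copyComp_run (x : ℕ → A) (y : ℕ → B) : (copyComp A B).TwoDet ∧
    (copyComp A B).OneToOne ∧ ∃ γ, (copyComp A B).IsAccRunOn γ x y := by
  set γ : ℕ → Fin 1 × (Option A × Option B) × List (Fin (Fintype.card A)) × Fin 1 :=
    fun n => (0, (some (x n), some (y n)), [Fintype.equivFin A (x n)], 0) with hγdef
  have htr : ∀ n, γ n ∈ (copyComp A B).trans := fun n => ⟨x n, y n, rfl⟩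
  have h1 : ∀ n, c3in1 γ n = pref x n := fun n => by
    rw [c3in1_eq]; exact fl_singleton x n
  have h2 : ∀ n, c3in2 γ n = pref y n := fun n => by
    rw [c3in2_eq]; exact fl_singleton y n
  have ho : ∀ n, (c3out γ n).length = (c3in1 γ n).length := fun n => by
    rw [copyComp_out htr, List.length_map]
  have hlen : Tendsto (fun n => (c3in1 γ n).length) atTop atTop := by
    simp only [h1, pref_length]; exact tendsto_id
  have hγ : (copyComp A B).IsAccRunOn γ x y :=
    ⟨rfl, htr, fun _ => rfl, fun n => by simp [h1], fun n => by simp [h2], hlen,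
      by simp only [h2, pref_length]; exact tendsto_id, by simpa only [ho] using hlen⟩
  refine ⟨?_, ?_, γ, hγ⟩
  · rintro _ ⟨a, b, rfl⟩ _ ⟨a', b', rfl⟩ _
    refine ⟨rfl, fun h => ?_⟩
    simp_all
  · intro x x' y γ γ' hγ hγ' h _
    simp only [copyComp_out hγ.2.1, copyComp_out hγ'.2.1] at h
    exact prefixes_of_map (Fintype.equivFin A).injective hγ.2.2.2.1 hγ'.2.2.2.1 hγ.2.2.2.2.2.1 h

lemma condRho_le_one [Fintype B] (hA : 2 ≤ Fintype.card A) (x : ℕ → A) (y : ℕ → B) :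
    condRho x y ≤ 1 := by
  obtain ⟨h1, h2, γ, hγ⟩ := exists_copyComp_run x y
  exact (condRho_le hA h1 h2 hγ).trans_eq (liminf_ratio_eq_one hA
    (fun n => by rw [copyComp_out hγ.2.1, List.length_map]) hγ.2.2.2.2.2.1).symm

lemma one_le_condRho [Fintype B] (hA : 2 ≤ Fintype.card A) (hB : 2 ≤ Fintype.card B)
    {x : ℕ → A} {y : ℕ → B} (hx : Unpredictable.{u} x y) (hy : Unpredictable.{u} y x) :
    1 ≤ condRho x y := by
  have : Nonempty A := Fintype.card_pos_iff.1 (by omega)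
  have : Nonempty B := Fintype.card_pos_iff.1 (by omega)
  refine le_csInf ?_ ?_
  · obtain ⟨h1, h2, γ, hγ⟩ := exists_copyComp_run x y
    exact ⟨_, _, _, hA, _, h1, h2, γ, hγ, rfl⟩
  · rintro _ ⟨m, d, hd, C, hC, hinj, γ, hγ, rfl⟩
    have : NeZero d := ⟨by omega⟩
    simpa using C.one_le_liminf hA hC hinj hγ (C.equi hC hx hy hγ)

lemma c2in_eq {A : Type*} (γ : ℕ → Q × Option A × List D × Q) :
    c2in γ = fl fun i => (γ i).2.1.toList := funext fun n => reduceOption_eq_fl _ n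

lemma c2out_eq {A : Type*} (γ : ℕ → Q × Option A × List D × Q) :
    c2out γ = fl fun i => (γ i).2.2.1 := rfl

/-- The compressor copying its input. -/
noncomputable def copyComp₂ (A : Type*) [Fintype A] : Comp2 A (Fin (Fintype.card A)) (Fin 1) where
  init := 0
  trans := {t | ∃ a, t = (0, some a, [Fintype.equivFin A a], 0)}

lemma copyComp₂_out {γ : ℕ → Fin 1 × Option A × List (Fin (Fintype.card A)) × Fin 1}
    (h : ∀ n, γ n ∈ (copyComp₂ A).trans) (n : ℕ) :
    c2out γ n = (c2in γ n).map (Fintype.equivFin A) := by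
  rw [c2out_eq, c2in_eq]
  induction n with
  | zero => rfl
  | succ n ih =>
    obtain ⟨a, hab⟩ := h n
    simp [fl_succ, ih, hab]

lemma exists_copyComp₂_run (x : ℕ → A) : (copyComp₂ A).OneDet ∧
    (copyComp₂ A).OneToOne ∧ ∃ γ, (copyComp₂ A).IsAccRunOn γ x := by
  set γ : ℕ → Fin 1 × Option A × List (Fin (Fintype.card A)) × Fin 1 :=
    fun n => (0, some (x n), [Fintype.equivFin A (x n)], 0) with hγdef
  have htr : ∀ n, γ n ∈ (copyComp₂ A).trans := fun n => ⟨x n, rfl⟩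
  have h1 : ∀ n, c2in γ n = pref x n := fun n => by
    rw [c2in_eq]; exact fl_singleton x n
  have ho : ∀ n, (c2out γ n).length = (c2in γ n).length := fun n => by
    rw [copyComp₂_out htr, List.length_map]
  have hlen : Tendsto (fun n => (c2in γ n).length) atTop atTop := by
    simp only [h1, pref_length]; exact tendsto_id
  have hγ : (copyComp₂ A).IsAccRunOn γ x :=
    ⟨rfl, htr, fun _ => rfl, fun n => by simp [h1], hlen, by simpa only [ho] using hlen⟩
  refine ⟨?_, ?_, γ, hγ⟩
  · rintro _ ⟨a, rfl⟩ _ ⟨a', rfl⟩ _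
    refine ⟨rfl, fun h => ?_⟩
    simp_all
  · intro x x' γ γ' hγ hγ' h _
    simp only [copyComp₂_out hγ.2.1, copyComp₂_out hγ'.2.1] at h
    exact prefixes_of_map (Fintype.equivFin A).injective hγ.2.2.2.1 hγ'.2.2.2.1 hγ.2.2.2.2.1 h

lemma rho_le_one (hA : 2 ≤ Fintype.card A) (x : ℕ → A) : rho x ≤ 1 := by
  obtain ⟨h1, h2, γ, hγ⟩ := exists_copyComp₂_run x
  exact (rho_le hA h1 h2 hγ).trans_eq (liminf_ratio_eq_one hA
    (fun n => by rw [copyComp₂_out hγ.2.1, List.length_map]) hγ.2.2.2.2.1).symm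

/-- A compressor, viewed as a conditional compressor that reads the trivial oracle word. -/
def Comp2.toComp3 {A D Q : Type*} (C : Comp2 A D Q) : Comp3 A Unit D Q where
  init := C.init
  trans := {t | t.2.1.2 = some () ∧ (t.1, t.2.1.1, t.2.2) ∈ C.trans}

lemma Comp2.toComp3_in2 {A D Q : Type*} {C : Comp2 A D Q}
    {γ : ℕ → Q × (Option A × Option Unit) × List D × Q} (h : ∀ n, γ n ∈ C.toComp3.trans) (n : ℕ) :
    c3in2 γ n = pref (fun _ => ()) n := by
  rw [c3in2_eq, ← fl_singleton]
  congr 1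
  funext i
  rw [(h i).1]
  rfl

lemma one_le_rho (hA : 2 ≤ Fintype.card A) {x : ℕ → A} (hx : Normal x) : 1 ≤ rho x := by
  have : Nonempty A := Fintype.card_pos_iff.1 (by omega)
  refine le_csInf ?_ ?_
  · obtain ⟨h1, h2, γ, hγ⟩ := exists_copyComp₂_run x
    exact ⟨_, _, _, hA, _, h1, h2, γ, hγ, rfl⟩
  · rintro _ ⟨m, d, hd, C, hC, hinj, γ, hγ, rfl⟩
    have : NeZero d := ⟨by omega⟩
    set γ' : ℕ → Fin m × (Option A × Option Unit) × List (Fin d) × Fin m :=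
      fun n => ((γ n).1, ((γ n).2.1, some ()), (γ n).2.2) with hγ'
    have htr : ∀ n, γ' n ∈ C.toComp3.trans := fun n => ⟨rfl, hγ.2.1 n⟩
    have hacc : C.toComp3.IsAccRunOn γ' x fun _ => () :=
      ⟨hγ.1, htr, hγ.2.2.1, hγ.2.2.2.1, fun n => by simp [C.toComp3_in2 htr], hγ.2.2.2.2.1,
        by simp only [C.toComp3_in2 htr, pref_length]; exact tendsto_id, hγ.2.2.2.2.2⟩
    have hdet : C.toComp3.TwoDet := by
      rintro ⟨p, ⟨a, b⟩, w, q⟩ ⟨h1, h2⟩ ⟨p', ⟨a', b'⟩, w', q'⟩ ⟨h1', h2'⟩ hp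
      dsimp only at h1 h2 h1' h2' hp
      obtain ⟨h3, h4⟩ := hC _ h2 _ h2' hp
      dsimp only at h3 h4
      subst h1 h1' hp
      refine ⟨by simp [lsupp, h3], fun h => ?_⟩
      have := h4 (Prod.mk.inj h).1
      simp_all
    have hproj : ∀ {x' y' δ}, C.toComp3.IsAccRunOn δ x' y' →
        C.IsAccRunOn (fun n => ((δ n).1, (δ n).2.1.1, (δ n).2.2)) x' := fun h =>
      ⟨h.1, fun n => (h.2.1 n).2, h.2.2.1, h.2.2.2.1, h.2.2.2.2.2.1, h.2.2.2.2.2.2.2⟩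
    have hinj' : C.toComp3.OneToOne := fun x₁ x₂ _ δ₁ δ₂ h₁ h₂ h h' =>
      hinj x₁ x₂ _ _ (hproj h₁) (hproj h₂) h h'
    have := C.toComp3.one_le_liminf hA hdet hinj' hacc
      (C.toComp3.equi hdet hx.unpredictable (unpredictable_unit x) hacc)
    simp only [Fintype.card_fin] at this
    exact this

end ratios

end

section

/-! ### Interval coding -/

section coding

/-- The real number in `[0, 1)` with the given binary expansion. -/
noncomputable def binVal : List (Fin 2) → ℝ
  | [] => 0
  | b :: w => ((b : ℕ) + binVal w) / 2

lemma binVal_nonneg (w : List (Fin 2)) : 0 ≤ binVal w := by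
  induction w with
  | nil => exact le_rfl
  | cons b w ih => simp only [binVal]; positivity

lemma binVal_lt_one (w : List (Fin 2)) : binVal w < 1 := by
  induction w with
  | nil => exact one_pos
  | cons b w ih =>
    have : ((b : ℕ) : ℝ) ≤ 1 := by exact_mod_cast Nat.le_of_lt_succ b.2
    simp only [binVal]
    linarith

lemma binVal_append (w u : List (Fin 2)) : binVal (w ++ u) = binVal w + binVal u / 2 ^ w.length := by
  induction w with
  | nil => simp [binVal]
  | cons b w ih =>
    simp only [List.cons_append, binVal, ih, List.length_cons, pow_succ]
    field_simp
    ring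

lemma exists_binVal_eq (m k : ℕ) (hk : k < 2 ^ m) :
    ∃ w : List (Fin 2), w.length = m ∧ binVal w = k / 2 ^ m := by
  induction m generalizing k with
  | zero => exact ⟨[], rfl, by simp_all [binVal]⟩
  | succ m ih =>
    have key : ∀ (b : Fin 2) (k' : ℕ), k' < 2 ^ m → k = b * 2 ^ m + k' →
        ∃ w : List (Fin 2), w.length = m + 1 ∧ binVal w = k / 2 ^ (m + 1) := by
      rintro b k' hk' rfl
      obtain ⟨w, hw, hv⟩ := ih k' hk'
      refine ⟨b :: w, by simp [hw], ?_⟩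
      simp only [binVal, hv, pow_succ]
      push_cast
      field_simp
    rcases lt_or_ge k (2 ^ m) with h | h
    · exact key 0 k h (by simp)
    · exact key 1 (k - 2 ^ m) (by rw [pow_succ] at hk; omega)
        (by simp only [Fin.val_one, one_mul]; omega)

/-- Every subinterval of `[0, 1]` of length `P` contains a dyadic interval given by at most
`log₂ (4 / P)` binary digits. -/
lemma exists_binVal_mem {l P : ℝ} (hl : 0 ≤ l) (hP : 0 < P) (h : l + P ≤ 1) :
    ∃ w : List (Fin 2), w ≠ [] ∧ (w.length : ℝ) * Real.log 2 ≤ Real.log 4 - Real.log P ∧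
      l ≤ binVal w ∧ binVal w + 1 / 2 ^ w.length ≤ l + P := by
  classical
  have hex : ∃ m : ℕ, 2 / P ≤ 2 ^ m :=
    (pow_unbounded_of_one_lt (2 / P) one_lt_two).imp fun _ => le_of_lt
  set m := Nat.find hex with hm
  have hm1 : 2 / P ≤ 2 ^ m := Nat.find_spec hex
  have hm0 : m ≠ 0 := by
    intro h0
    rw [h0, pow_zero, div_le_one hP] at hm1
    linarith
  have hm2 : (2 : ℝ) ^ m ≤ 4 / P := by
    obtain ⟨k, hk⟩ := Nat.exists_eq_succ_of_ne_zero hm0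
    have := Nat.find_min hex (m := k) (by omega)
    rw [hk, pow_succ]
    rw [not_le] at this
    calc (2 : ℝ) ^ k * 2 ≤ 2 / P * 2 := by gcongr
      _ = 4 / P := by ring
  have h2m : (0 : ℝ) < 2 ^ m := by positivity
  rw [div_le_iff₀ hP] at hm1
  have hceil : (⌈l * 2 ^ m⌉₊ : ℝ) < l * 2 ^ m + 1 := Nat.ceil_lt_add_one (by positivity)
  have hceil' : l * 2 ^ m ≤ (⌈l * 2 ^ m⌉₊ : ℝ) := Nat.le_ceil _
  obtain ⟨w, hw, hv⟩ := exists_binVal_eq m ⌈l * 2 ^ m⌉₊ (by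
    have : (⌈l * 2 ^ m⌉₊ : ℝ) < 2 ^ m := by nlinarith
    exact_mod_cast this)
  refine ⟨w, by rintro rfl; simp at hw; omega, ?_, ?_, ?_⟩
  · rw [hw, ← Real.log_pow, ← Real.log_div (by norm_num) hP.ne']
    exact Real.log_le_log h2m hm2
  · rw [hv, le_div_iff₀ h2m]; exact hceil'
  · rw [hv, hw, ← add_div, div_le_iff₀ h2m]
    nlinarith

/-- Probability of a history. -/
noncomputable def histProb (p : Q → A → ℝ) : List (Q × A) → ℝ
  | [] => 1
  | e :: h => p e.1 e.2 * histProb p h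

variable {p : Q → A → ℝ}

lemma histProb_pos (hp : ∀ q a, 0 < p q a) (h : List (Q × A)) : 0 < histProb p h := by
  induction h with
  | nil => exact one_pos
  | cons e h ih => exact mul_pos (hp _ _) ih

lemma log_histProb (hp : ∀ q a, 0 < p q a) (h : List (Q × A)) :
    Real.log (histProb p h) = (h.map fun e => Real.log (p e.1 e.2)).sum := by
  induction h with
  | nil => simp [histProb]
  | cons e h ih =>
    rw [histProb, Real.log_mul (hp _ _).ne' (histProb_pos hp h).ne', ih, List.map_cons,
      List.sum_cons]

variable [Fintype A]

/-- Total probability of the symbols listed before `a`. -/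
noncomputable def cumul (p : Q → A → ℝ) (q : Q) (a : A) : ℝ :=
  ∑ b with Fintype.equivFin A b < Fintype.equivFin A a, p q b

/-- Left endpoint of the coding interval of a history. -/
noncomputable def histLow (p : Q → A → ℝ) : List (Q × A) → ℝ
  | [] => 0
  | e :: h => cumul p e.1 e.2 + p e.1 e.2 * histLow p h

lemma cumul_nonneg (hp : ∀ q a, 0 < p q a) (q : Q) (a : A) : 0 ≤ cumul p q a :=
  Finset.sum_nonneg fun b _ => (hp q b).le

lemma cumul_add_le (hp : ∀ q a, 0 < p q a) {q : Q} {a a' : A} (h : Fintype.equivFin A a < Fintype.equivFin A a') :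
    cumul p q a + p q a ≤ cumul p q a' := by
  classical
  rw [cumul, add_comm, ← Finset.sum_insert (by simp)]
  refine Finset.sum_le_sum_of_subset_of_nonneg (fun b hb => ?_) fun b _ _ => (hp q b).le
  simp only [Finset.mem_insert, Finset.mem_filter, Finset.mem_univ, true_and] at hb ⊢
  rcases hb with rfl | hb
  · exact h
  · exact hb.trans h

lemma cumul_add_le_one (hp : ∀ q a, 0 < p q a) (hsum : ∀ q, ∑ a, p q a = 1) (q : Q) (a : A) : cumul p q a + p q a ≤ 1 := by
  classical
  rw [cumul, add_comm, ← Finset.sum_insert (by simp), ← hsum q]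
  exact Finset.sum_le_sum_of_subset_of_nonneg (Finset.subset_univ _) fun b _ _ => (hp q b).le

lemma histLow_nonneg (hp : ∀ q a, 0 < p q a) (h : List (Q × A)) : 0 ≤ histLow p h := by
  induction h with
  | nil => exact le_rfl
  | cons e h ih => exact add_nonneg (cumul_nonneg hp _ _) (mul_nonneg (hp _ _).le ih)

lemma histLow_add_le (hp : ∀ q a, 0 < p q a) (hsum : ∀ q, ∑ a, p q a = 1) (h : List (Q × A)) : histLow p h + histProb p h ≤ 1 := by
  induction h with
  | nil => simp [histLow, histProb]
  | cons e h ih =>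
    simp only [histLow, histProb]
    nlinarith [cumul_add_le_one hp hsum e.1 e.2, hp e.1 e.2]

lemma histLow_disjoint (hp : ∀ q a, 0 < p q a) (hsum : ∀ q, ∑ a, p q a = 1) (h : List (Q × A)) {q : Q} {a a' : A} (u u' : List (Q × A))
    (haa : Fintype.equivFin A a < Fintype.equivFin A a') :
    histLow p (h ++ (q, a) :: u) + histProb p (h ++ (q, a) :: u) ≤
      histLow p (h ++ (q, a') :: u') := by
  induction h with
  | nil =>
    simp only [List.nil_append, histLow, histProb]
    nlinarith [cumul_add_le hp (q := q) haa, hp q a, histLow_add_le hp hsum u,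
      mul_nonneg (hp q a').le (histLow_nonneg hp u')]
  | cons e h ih =>
    simp only [List.cons_append, histLow, histProb]
    nlinarith [hp e.1 e.2]

/-- Existence of a code of near optimal length for histories, in which the codewords of two
histories that diverge by the symbol read in the same state are not prefixes of one another. -/
lemma exists_code (hp : ∀ q a, 0 < p q a) (hsum : ∀ q, ∑ a, p q a = 1) : ∃ code : List (Q × A) → List (Fin 2),
    (∀ h, code h ≠ []) ∧
    (∀ h, ((code h).length : ℝ) * Real.log 2 ≤
      Real.log 4 - (h.map fun e => Real.log (p e.1 e.2)).sum) ∧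
    ∀ h q a a' u u', code (h ++ (q, a) :: u) <+: code (h ++ (q, a') :: u') → a = a' := by
  choose code h1 h2 h3 h4 using fun h => exists_binVal_mem (histLow_nonneg hp h)
    (histProb_pos hp h) (histLow_add_le hp hsum h)
  refine ⟨code, h1, fun h => ?_, ?_⟩
  · rw [← log_histProb hp]; exact h2 h
  · rintro h q a a' u u' ⟨v, hv⟩
    have hval := binVal_append (code (h ++ (q, a) :: u)) v
    rw [hv] at hval
    have hv1 : 0 ≤ binVal v / 2 ^ (code (h ++ (q, a) :: u)).length :=
      div_nonneg (binVal_nonneg v) (by positivity)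
    have hv2 : binVal v / 2 ^ (code (h ++ (q, a) :: u)).length <
        1 / 2 ^ (code (h ++ (q, a) :: u)).length := by
      gcongr
      exact binVal_lt_one v
    have hpos : (0 : ℝ) < 1 / 2 ^ (code (h ++ (q, a') :: u')).length := by positivity
    rcases lt_trichotomy (Fintype.equivFin A a) (Fintype.equivFin A a') with hlt | heq | hgt
    · have := histLow_disjoint hp hsum h u u' (q := q) hlt
      linarith [h3 (h ++ (q, a') :: u'), h4 (h ++ (q, a) :: u)]
    · exact (Fintype.equivFin A).injective heq
    · have := histLow_disjoint hp hsum h u' u (q := q) hgt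
      linarith [h3 (h ++ (q, a) :: u), h4 (h ++ (q, a') :: u')]

end coding

end

section

/-! ### Machines with output -/

namespace Comp3

/-- Renaming the states of a compressor. -/
def rename {S : Type*} (C : Comp3 A B D Q) (e : Q ≃ S) : Comp3 A B D S where
  init := e C.init
  trans := {t | (e.symm t.1, t.2.1, t.2.2.1, e.symm t.2.2.2) ∈ C.trans}

variable {S : Type*} {C : Comp3 A B D Q} (e : Q ≃ S)

lemma TwoDet.rename (hC : C.TwoDet) : (C.rename e).TwoDet := by
  rintro ⟨p, l, w, q⟩ h ⟨p', l', w', q'⟩ h' hp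
  dsimp only at hp
  subst hp
  refine (hC _ h _ h' rfl).imp_right fun hd hl => ?_
  have := hd hl
  simp_all

lemma OneToOne.rename (hC : C.OneToOne) : (C.rename e).OneToOne := by
  have hproj : ∀ {x' y' δ}, (C.rename e).IsAccRunOn δ x' y' →
      C.IsAccRunOn (fun n => (e.symm (δ n).1, (δ n).2.1, (δ n).2.2.1, e.symm (δ n).2.2.2)) x' y' :=
    fun h => ⟨by simp [h.1, Comp3.rename], h.2.1, fun n => congrArg e.symm (h.2.2.1 n), h.2.2.2⟩
  exact fun x₁ x₂ y δ₁ δ₂ h₁ h₂ h h' => hC x₁ x₂ y _ _ (hproj h₁) (hproj h₂) h h'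

lemma IsAccRunOn.rename {x : ℕ → A} {y : ℕ → B} {γ : ℕ → Q × (Option A × Option B) × List D × Q}
    (h : C.IsAccRunOn γ x y) : (C.rename e).IsAccRunOn
      (fun n => (e (γ n).1, (γ n).2.1, (γ n).2.2.1, e (γ n).2.2.2)) x y :=
  ⟨congrArg e h.1, fun n => by simpa [Comp3.rename] using h.2.1 n,
    fun n => congrArg e (h.2.2.1 n), h.2.2.2⟩

end Comp3

lemma condRho_le_of_finite [Fintype A] [Fintype B] {x : ℕ → A} {y : ℕ → B} [Finite Q] {d : ℕ}
    (hd : 2 ≤ d) {C : Comp3 A B (Fin d) Q} (hC : C.TwoDet) (hinj : C.OneToOne) {γ : _}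
    (hγ : C.IsAccRunOn γ x y) :
    condRho x y ≤ Filter.liminf (fun n : ℕ => (((c3out γ n).length : ℝ) * Real.log d) /
        (((c3in1 γ n).length : ℝ) * Real.log (Fintype.card A))) atTop := by
  obtain ⟨m, ⟨e⟩⟩ := Finite.exists_equiv_fin Q
  have h := condRho_le hd (hC.rename e) (hinj.rename e) (hγ.rename e)
  have ho : c3out (fun n => (e (γ n).1, (γ n).2.1, (γ n).2.2.1, e (γ n).2.2.2)) = c3out γ := rfl
  have hi : c3in1 (fun n => (e (γ n).1, (γ n).2.1, (γ n).2.2.1, e (γ n).2.2.2)) = c3in1 γ := rfl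
  rwa [ho, hi] at h

namespace Mach

variable (M : Mach A B Q) (o : Q → A → List D) (x : ℕ → A) (y : ℕ → B)

/-- The machine with an output written when reading from the first input. -/
def toComp : Comp3 A B D Q where
  init := M.init
  trans := {t | (M.rd t.1 = true ∧ ∃ a, t.2.1 = (some a, none) ∧ t.2.2 = (o t.1 a, M.δa t.1 a)) ∨
    (M.rd t.1 = false ∧ ∃ b, t.2.1 = (none, some b) ∧ t.2.2 = ([], M.δb t.1 b))}

lemma toComp_twoDet : (M.toComp o).TwoDet := by
  rintro ⟨p, l, w⟩ h ⟨p', l', w'⟩ h' hp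
  dsimp only at hp
  subst hp
  rcases h with ⟨h, a, h1, h2⟩ | ⟨h, a, h1, h2⟩ <;>
    rcases h' with ⟨h', a', h1', h2'⟩ | ⟨h', a', h1', h2'⟩ <;> simp_all [lsupp]

/-- Output of the first `n` steps of a machine. -/
def outSeq (n : ℕ) : List D :=
  fl (fun i => if M.rd (M.cfg x y i).1 then o (M.cfg x y i).1 (x (M.cfg x y i).2.1) else []) n

/-- The run of a machine. -/
def run (n : ℕ) : Q × (Option A × Option B) × List D × Q :=
  let c := M.cfg x y n
  if M.rd c.1 then (c.1, (some (x c.2.1), none), o c.1 (x c.2.1), M.δa c.1 (x c.2.1))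
  else (c.1, (none, some (y c.2.2)), [], M.δb c.1 (y c.2.2))

variable {M o x y}

lemma run_of_rd {n : ℕ} (h : M.rd (M.cfg x y n).1 = true) : M.run o x y n =
    ((M.cfg x y n).1, (some (x (M.cfg x y n).2.1), none),
      o (M.cfg x y n).1 (x (M.cfg x y n).2.1), M.δa (M.cfg x y n).1 (x (M.cfg x y n).2.1)) := by
  simp [run, h]

lemma run_of_not_rd {n : ℕ} (h : M.rd (M.cfg x y n).1 = false) : M.run o x y n =
    ((M.cfg x y n).1, (none, some (y (M.cfg x y n).2.2)), [],
      M.δb (M.cfg x y n).1 (y (M.cfg x y n).2.2)) := by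
  simp [run, h]

variable (M o x y) in
lemma c3out_run (n : ℕ) : c3out (M.run o x y) n = M.outSeq o x y n := by
  rw [c3out_eq, outSeq]
  congr 1
  funext i
  unfold run
  dsimp only
  split_ifs <;> rfl

variable (M o x y) in
lemma c3in_run (n : ℕ) : c3in1 (M.run o x y) n = pref x (M.cfg x y n).2.1 ∧
    c3in2 (M.run o x y) n = pref y (M.cfg x y n).2.2 := by
  rw [c3in1_eq, c3in2_eq]
  induction n with
  | zero => exact ⟨rfl, rfl⟩
  | succ n ih =>
    simp only [fl_succ]
    cases h : M.rd (M.cfg x y n).1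
    · simp only [run_of_not_rd h, M.cfg_succ_of_not_rd x y h, pref_succ]
      simp only [ih]
      simp
    · simp only [run_of_rd h, M.cfg_succ_of_rd x y h, pref_succ]
      simp only [ih]
      simp

variable (M o x y) in
lemma run_step (n : ℕ) : M.run o x y n ∈ (M.toComp o).trans ∧
    (M.run o x y n).1 = (M.cfg x y n).1 ∧
    (M.run o x y n).2.2.2 = (M.cfg x y (n + 1)).1 := by
  cases h : M.rd (M.cfg x y n).1
  · rw [run_of_not_rd h, M.cfg_succ_of_not_rd x y h]
    exact ⟨Or.inr ⟨h, _, rfl, rfl⟩, rfl, rfl⟩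
  · rw [run_of_rd h, M.cfg_succ_of_rd x y h]
    exact ⟨Or.inl ⟨h, _, rfl, rfl⟩, rfl, rfl⟩

lemma isAccRunOn_run (h1 : Tendsto (fun n => (M.cfg x y n).2.1) atTop atTop)
    (h2 : Tendsto (fun n => (M.cfg x y n).2.2) atTop atTop)
    (ho : Tendsto (fun n => (M.outSeq o x y n).length) atTop atTop) :
    (M.toComp o).IsAccRunOn (M.run o x y) x y := by
  refine ⟨(run_step M o x y 0).2.1, fun n => (run_step M o x y n).1, fun n => ?_, fun n => ?_,
    fun n => ?_, ?_, ?_, ?_⟩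
  · rw [(run_step M o x y n).2.2, (run_step M o x y (n + 1)).2.1]
  · simp [(c3in_run M o x y n).1]
  · simp [(c3in_run M o x y n).2]
  · simpa only [(c3in_run M o x y _).1, pref_length] using h1
  · simpa only [(c3in_run M o x y _).2, pref_length] using h2
  · simpa only [c3out_run M o x y] using ho

lemma getLast_of_eq_pref {x : ℕ → A} {l : List A} {a : A} {k : ℕ} (hl : l = pref x k)
    (h : l ++ [a] = pref x (l ++ [a]).length) : a = x k := by
  subst hl
  rw [List.length_append, pref_length, List.length_singleton, pref_succ] at h
  simpa using h

/-- Every accepting run is the run of the machine. -/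
lemma eq_run {γ : ℕ → Q × (Option A × Option B) × List D × Q}
    (h : (M.toComp o).IsAccRunOn γ x y) : γ = M.run o x y := by
  obtain ⟨h0, htr, hs, h1, h2, -⟩ := h
  rw [c3in1_eq] at h1
  rw [c3in2_eq] at h2
  have hin := fun n => c3in_run M o x y n
  simp only [c3in1_eq, c3in2_eq] at hin
  have key : ∀ n, (∀ i < n, γ i = M.run o x y i) → (γ n).1 = (M.cfg x y n).1 → γ n = M.run o x y n := by
    intro n hlt hst
    have e1 : fl (fun i => (γ i).2.1.1.toList) n = pref x (M.cfg x y n).2.1 := by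
      rw [← (hin n).1]
      simp only [fl]
      exact congrArg List.flatten (List.map_congr_left fun i hi => by rw [hlt i (List.mem_range.1 hi)])
    have e2 : fl (fun i => (γ i).2.1.2.toList) n = pref y (M.cfg x y n).2.2 := by
      rw [← (hin n).2]
      simp only [fl]
      exact congrArg List.flatten (List.map_congr_left fun i hi => by rw [hlt i (List.mem_range.1 hi)])
    have g1 := h1 (n + 1)
    have g2 := h2 (n + 1)
    rw [fl_succ] at g1 g2
    generalize hγn : γ n = t at *
    obtain ⟨p, l, w⟩ := t
    have htn := htr n
    rw [hγn] at htn
    dsimp only at hst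
    subst hst
    rcases htn with ⟨hr, a, ha, hw⟩ | ⟨hr, b, hb, hw⟩
    · dsimp only at hr ha hw
      subst ha hw
      obtain rfl := getLast_of_eq_pref e1 (by simpa using g1)
      rw [run_of_rd hr]
    · dsimp only at hr hb hw
      subst hb hw
      obtain rfl := getLast_of_eq_pref e2 (by simpa using g2)
      rw [run_of_not_rd hr]
  funext n
  induction n using Nat.strong_induction_on with
  | _ n ih =>
    refine key n ih ?_
    cases n with
    | zero => exact h0
    | succ n => rw [← hs n, ih n n.lt_succ_self, (run_step M o x y n).2.2]

end Mach

end

section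

/-! ### Block coding of the symbols read by a machine -/

namespace Mach

lemma exists_next_read (M : Mach A B Q) {x : ℕ → A} {y : ℕ → B}
    (h : Tendsto (fun n => (M.cfg x y n).2.1) atTop atTop) (n : ℕ) :
    ∃ k, M.rd (M.cfg x y (n + k)).1 = true ∧ ∀ i < k, M.rd (M.cfg x y (n + i)).1 = false := by
  classical
  have hex : ∃ k, M.rd (M.cfg x y (n + k)).1 = true := by
    by_contra! hno
    have hc : ∀ k, (M.cfg x y (n + k)).2.1 = (M.cfg x y n).2.1 := by
      intro k
      induction k with
      | zero => rfl
      | succ k ih => rw [← add_assoc, M.cfg_succ_of_not_rd x y (by simpa using hno k), ih]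
    obtain ⟨N, hN⟩ := (h.eventually_gt_atTop (M.cfg x y n).2.1).exists_forall_of_atTop
    exact absurd (hN (n + N) (by omega)) (by rw [hc]; exact lt_irrefl _)
  exact ⟨Nat.find hex, Nat.find_spec hex, fun i hi => by simpa using Nat.find_min hex hi⟩

variable {L : ℕ} (hL : 0 < L)

/-- Append an entry to a buffer, emptying the buffer when it is full. -/
def push (h : {h : List (Q × A) // h.length < L}) (e : Q × A) :
    {h : List (Q × A) // h.length < L} :=
  if H : (h.1 ++ [e]).length < L then ⟨h.1 ++ [e], H⟩ else ⟨[], hL⟩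

/-- The machine keeping in a buffer the last states and symbols read from the first input. -/
def buffer (M : Mach A B Q) : Mach A B (Q × {h : List (Q × A) // h.length < L}) where
  init := (M.init, ⟨[], hL⟩)
  rd s := M.rd s.1
  δa s a := (M.δa s.1 a, push hL s.2 (s.1, a))
  δb s b := (M.δb s.1 b, s.2)

/-- Output of the code of the buffer each time it is full. -/
def bufferOut (code : List (Q × A) → List D) (s : Q × {h : List (Q × A) // h.length < L}) (a : A) :
    List D :=
  if s.2.1.length + 1 < L then [] else code (s.2.1 ++ [(s.1, a)])

variable (M : Mach A B Q) (code : List (Q × A) → List D) (x : ℕ → A) (y : ℕ → B)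

lemma buffer_cfg (n : ℕ) : ((M.buffer hL).cfg x y n).1.1 = (M.cfg x y n).1 ∧
    ((M.buffer hL).cfg x y n).2 = (M.cfg x y n).2 := by
  induction n with
  | zero => exact ⟨rfl, rfl⟩
  | succ n ih =>
    obtain ⟨h1, h2⟩ := ih
    have hrd : (M.buffer hL).rd ((M.buffer hL).cfg x y n).1 = M.rd (M.cfg x y n).1 := by
      rw [← h1]; rfl
    cases h : M.rd (M.cfg x y n).1
    · rw [cfg_succ_of_not_rd _ _ _ h, cfg_succ_of_not_rd _ _ _ (hrd.trans h), h2]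
      exact ⟨by rw [← h1]; rfl, rfl⟩
    · rw [cfg_succ_of_rd _ _ _ h, cfg_succ_of_rd _ _ _ (hrd.trans h), h2]
      exact ⟨by rw [← h1]; rfl, rfl⟩

/-- Content of the buffer after `n` steps. -/
def bufferAt (n : ℕ) : List (Q × A) := ((M.buffer hL).cfg x y n).1.2.1

/-- Output of the block code during the first `n` steps. -/
def blockOut (n : ℕ) : List D := (M.buffer hL).outSeq (bufferOut code) x y n

variable {M x y}

lemma buffer_step_of_not_rd {n : ℕ} (h : M.rd (M.cfg x y n).1 = false) :
    M.bufferAt hL x y (n + 1) = M.bufferAt hL x y n ∧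
    M.blockOut hL code x y (n + 1) = M.blockOut hL code x y n := by
  have h' : (M.buffer hL).rd ((M.buffer hL).cfg x y n).1 = false := by
    rw [← h, ← (M.buffer_cfg hL x y n).1]; rfl
  refine ⟨?_, ?_⟩
  · rw [bufferAt, cfg_succ_of_not_rd _ _ _ h']; rfl
  · simp [blockOut, outSeq, fl_succ, h']

lemma buffer_step_of_rd {n : ℕ} (h : M.rd (M.cfg x y n).1 = true) :
    (M.bufferAt hL x y (n + 1) =
        M.bufferAt hL x y n ++ [((M.cfg x y n).1, x (M.cfg x y n).2.1)] ∧
      M.blockOut hL code x y (n + 1) = M.blockOut hL code x y n) ∨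
    (M.bufferAt hL x y (n + 1) = [] ∧ (M.bufferAt hL x y n).length + 1 = L ∧
      M.blockOut hL code x y (n + 1) = M.blockOut hL code x y n ++
        code (M.bufferAt hL x y n ++ [((M.cfg x y n).1, x (M.cfg x y n).2.1)])) := by
  obtain ⟨h1, h2⟩ := M.buffer_cfg hL x y n
  have h' : (M.buffer hL).rd ((M.buffer hL).cfg x y n).1 = true := by
    rw [← h, ← h1]; rfl
  have hb : M.bufferAt hL x y (n + 1) = (push hL ((M.buffer hL).cfg x y n).1.2
      ((M.cfg x y n).1, x (M.cfg x y n).2.1)).1 := by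
    rw [bufferAt, cfg_succ_of_rd _ _ _ h', ← h1, ← h2]; rfl
  have ho : M.blockOut hL code x y (n + 1) = M.blockOut hL code x y n ++
      bufferOut code ((M.buffer hL).cfg x y n).1 (x (M.cfg x y n).2.1) := by
    rw [← h2]
    simp [blockOut, outSeq, fl_succ, h']
  have hlt := ((M.buffer hL).cfg x y n).1.2.2
  rw [hb, ho]
  simp only [push, bufferOut, bufferAt, List.length_append, List.length_singleton]
  split_ifs with hif
  · exact Or.inl ⟨rfl, by simp⟩
  · exact Or.inr ⟨rfl, by omega, by rw [h1]⟩

lemma buffer_steps {n k : ℕ} (h : ∀ i < k, M.rd (M.cfg x y (n + i)).1 = false) :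
    M.bufferAt hL x y (n + k) = M.bufferAt hL x y n ∧
    M.blockOut hL code x y (n + k) = M.blockOut hL code x y n := by
  induction k with
  | zero => exact ⟨rfl, rfl⟩
  | succ k ih =>
    have h1 := ih fun i hi => h i (by omega)
    have h2 := buffer_step_of_not_rd hL code (h k (by omega))
    exact ⟨h2.1.trans h1.1, h2.2.trans h1.2⟩

/-- The block in progress is eventually completed. -/
lemma exists_blockOut_eq (hx : Tendsto (fun n => (M.cfg x y n).2.1) atTop atTop) (n : ℕ) :
    ∃ t u, M.blockOut hL code x y t =
      M.blockOut hL code x y n ++ code (M.bufferAt hL x y n ++ u) := by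
  obtain ⟨k, hk⟩ : ∃ k, L - (M.bufferAt hL x y n).length = k := ⟨_, rfl⟩
  induction k using Nat.strong_induction_on generalizing n with
  | _ k ih =>
    obtain ⟨j, hj, hj'⟩ := M.exists_next_read hx n
    obtain ⟨h1, h2⟩ := buffer_steps hL code hj'
    have hlt : (M.bufferAt hL x y n).length < L := ((M.buffer hL).cfg x y n).1.2.2
    rcases buffer_step_of_rd hL code hj with ⟨h3, h4⟩ | ⟨-, -, h4⟩
    · obtain ⟨t, u, ht⟩ := ih (L - (M.bufferAt hL x y (n + j + 1)).length)
        (by rw [h3, h1, List.length_append, List.length_singleton]; omega) (n + j + 1) rfl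
      exact ⟨t, [((M.cfg x y (n + j)).1, x (M.cfg x y (n + j)).2.1)] ++ u,
        by rw [ht, h4, h2, h3, h1, List.append_assoc]⟩
    · exact ⟨n + j + 1, _, by rw [h4, h2, h1]⟩

variable {code}

lemma tendsto_blockOut (hcode : ∀ h, code h ≠ [])
    (hx : Tendsto (fun n => (M.cfg x y n).2.1) atTop atTop) :
    Tendsto (fun n => (M.blockOut hL code x y n).length) atTop atTop := by
  refine tendsto_atTop_atTop_of_monotone (fl_length_mono _) fun b => ?_
  induction b with
  | zero => exact ⟨0, Nat.zero_le _⟩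
  | succ b ih =>
    obtain ⟨n, hn⟩ := ih
    obtain ⟨t, u, ht⟩ := exists_blockOut_eq hL code hx n
    refine ⟨t, ?_⟩
    have := List.length_pos_iff.2 (hcode (M.bufferAt hL x y n ++ u))
    rw [ht, List.length_append]
    omega

/-- A block being coded starts at the given entries. -/
lemma exists_blockOut_eq_of_rd (hx : Tendsto (fun n => (M.cfg x y n).2.1) atTop atTop) {n : ℕ}
    (h : M.rd (M.cfg x y n).1 = true) : ∃ t u, M.blockOut hL code x y t =
      M.blockOut hL code x y n ++
        code (M.bufferAt hL x y n ++ ((M.cfg x y n).1, x (M.cfg x y n).2.1) :: u) := by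
  rcases buffer_step_of_rd hL code h with ⟨h3, h4⟩ | ⟨-, -, h4⟩
  · obtain ⟨t, u, ht⟩ := exists_blockOut_eq hL code hx (n + 1)
    exact ⟨t, u, by rw [ht, h4, h3, List.append_assoc]; rfl⟩
  · exact ⟨n + 1, [], h4⟩

/-- Two inputs that are not distinguished by the run of a machine are equal. -/
lemma eq_or_exists_ne {x x' : ℕ → A} (hx : Tendsto (fun n => (M.cfg x y n).2.1) atTop atTop) :
    x = x' ∨ ∃ n, (∀ i ≤ n, M.cfg x y i = M.cfg x' y i) ∧ M.rd (M.cfg x y n).1 = true ∧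
      x (M.cfg x y n).2.1 ≠ x' (M.cfg x y n).2.1 ∧
      ∀ i < n, M.rd (M.cfg x y i).1 = true → x (M.cfg x y i).2.1 = x' (M.cfg x y i).2.1 := by
  classical
  by_cases hex : ∃ n, M.rd (M.cfg x y n).1 = true ∧ x (M.cfg x y n).2.1 ≠ x' (M.cfg x y n).2.1
  · right
    have hlt : ∀ i < Nat.find hex, M.rd (M.cfg x y i).1 = true →
        x (M.cfg x y i).2.1 = x' (M.cfg x y i).2.1 := fun i hi hr => by
      have := Nat.find_min hex hi
      push Not at this
      exact this hr
    refine ⟨Nat.find hex, fun i hi => ?_, (Nat.find_spec hex).1, (Nat.find_spec hex).2, hlt⟩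
    induction i with
    | zero => rfl
    | succ i ih =>
      have ih := ih (by omega)
      cases hr : M.rd (M.cfg x y i).1
      · rw [cfg_succ_of_not_rd _ _ _ hr, cfg_succ_of_not_rd _ _ _ (by rw [← ih, hr]), ih]
      · rw [cfg_succ_of_rd _ _ _ hr, cfg_succ_of_rd _ _ _ (by rw [← ih, hr]),
          hlt i (by omega) hr, ih]
  · left
    push Not at hex
    have hpref : ∀ n, pref x (M.cfg x y n).2.1 = pref x' (M.cfg x y n).2.1 := by
      intro n
      induction n with
      | zero => rfl
      | succ n ih =>
        cases hr : M.rd (M.cfg x y n).1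
        · rw [cfg_succ_of_not_rd _ _ _ hr]; exact ih
        · rw [cfg_succ_of_rd _ _ _ hr]
          simp only [pref_succ, ih, hex n hr]
    refine eq_of_prefixes fun n => ?_
    obtain ⟨k, hk⟩ := (hx.eventually_ge_atTop n).exists
    exact ⟨_, (hpref k) ▸ pref_isPrefix x hk⟩

lemma outSeq_congr {o : Q → A → List D} {x x' : ℕ → A} {n : ℕ}
    (h : ∀ i < n, M.cfg x y i = M.cfg x' y i)
    (h' : ∀ i < n, M.rd (M.cfg x y i).1 = true → x (M.cfg x y i).2.1 = x' (M.cfg x y i).2.1) :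
    M.outSeq o x y n = M.outSeq o x' y n := by
  simp only [outSeq, fl]
  refine congrArg List.flatten (List.map_congr_left fun i hi => ?_)
  have hi := List.mem_range.1 hi
  rw [← h i hi]
  split_ifs with hr
  · rw [h' i hi hr]
  · rfl

lemma oneToOne_buffer (hcode : ∀ h q a a' u u',
      code (h ++ (q, a) :: u) <+: code (h ++ (q, a') :: u') → a = a') :
    ((M.buffer hL).toComp (bufferOut code)).OneToOne := by
  intro x x' y γ γ' hγ hγ' hpre _
  obtain rfl := eq_run hγ
  obtain rfl := eq_run hγ'
  simp only [c3out_run] at hpre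
  have hx := hγ.2.2.2.2.2.1
  have hx' := hγ'.2.2.2.2.2.1
  simp only [(c3in_run _ _ _ _ _).1, pref_length] at hx hx'
  rcases eq_or_exists_ne (x' := x') hx with h | ⟨n, heq, hrd, hne, hlt⟩
  · exact h
  exfalso
  have hout : M.blockOut hL code x y n = M.blockOut hL code x' y n :=
    outSeq_congr (fun i hi => heq i hi.le) hlt
  have hbuf : M.bufferAt hL x y n = M.bufferAt hL x' y n := by rw [bufferAt, heq n le_rfl, bufferAt]
  have hb := M.buffer_cfg hL x y
  have hb' := M.buffer_cfg hL x' y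
  have hcfg : M.cfg x y n = M.cfg x' y n := by
    have h1 := heq n le_rfl
    refine Prod.ext ?_ ?_
    · rw [← (hb n).1, ← (hb' n).1, h1]
    · rw [← (hb n).2, ← (hb' n).2, h1]
  simp only [(hb _).2, (hb' _).2] at hx hx' hne
  have hrdM : M.rd (M.cfg x y n).1 = true := by rw [← hrd, ← (hb n).1]; rfl
  obtain ⟨t, u, ht⟩ := exists_blockOut_eq_of_rd (code := code) hL hx hrdM
  obtain ⟨t', u', ht'⟩ := exists_blockOut_eq_of_rd (code := code) hL hx' (hcfg ▸ hrdM)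
  rw [← hcfg, ← hout, ← hbuf] at ht'
  obtain ⟨m, hm⟩ := hpre t
  change M.blockOut hL code x y t <+: M.blockOut hL code x' y m at hm
  rw [ht] at hm
  have h1 : _ <+: M.blockOut hL code x' y (max m t') := hm.trans (fl_isPrefix _ (le_max_left m t'))
  have h2 : M.blockOut hL code x' y t' <+: M.blockOut hL code x' y (max m t') :=
    fl_isPrefix _ (le_max_right m t')
  rw [ht'] at h2
  rcases (le_total _ _).imp (List.prefix_of_prefix_length_le h1 h2)
      (List.prefix_of_prefix_length_le h2 h1) with h | h
  · exact hne (hcode _ _ _ _ _ _ ((List.prefix_append_right_inj _).1 h))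
  · exact hne (hcode _ _ _ _ _ _ ((List.prefix_append_right_inj _).1 h)).symm

/-- Bound for the length of the output of a block code by the sum of the costs of the symbols. -/
lemma blockOut_length_le {w : Q → A → ℝ} {c e : ℝ} (hw : ∀ q a, 0 ≤ w q a) (he : 0 ≤ e)
    (hcode : ∀ h, ((code h).length : ℝ) * c ≤ e + (h.map fun s => w s.1 s.2).sum) (n : ℕ) :
    ((M.blockOut hL code x y n).length : ℝ) * c ≤ ∑ i ∈ Finset.range n,
      if M.rd (M.cfg x y i).1 then w (M.cfg x y i).1 (x (M.cfg x y i).2.1) + e / L else 0 := by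
  have hL' : (0 : ℝ) < L := by exact_mod_cast hL
  suffices h : ((M.blockOut hL code x y n).length : ℝ) * c +
      ((M.bufferAt hL x y n).map fun s => w s.1 s.2 + e / L).sum ≤ ∑ i ∈ Finset.range n,
      if M.rd (M.cfg x y i).1 then w (M.cfg x y i).1 (x (M.cfg x y i).2.1) + e / L else 0 by
    refine le_trans (le_add_of_nonneg_right (List.sum_nonneg ?_)) h
    intro r hr
    obtain ⟨s, -, rfl⟩ := List.mem_map.1 hr
    have := hw s.1 s.2
    positivity
  induction n with
  | zero => simp [blockOut, outSeq, bufferAt, cfg, buffer]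
  | succ n ih =>
    rw [Finset.sum_range_succ]
    cases hr : M.rd (M.cfg x y n).1
    · obtain ⟨h1, h2⟩ := buffer_step_of_not_rd hL code hr
      rw [h1, h2]
      simpa using ih
    · rcases buffer_step_of_rd hL code hr with ⟨h1, h2⟩ | ⟨h1, h2, h3⟩
      · rw [h1, h2]
        simp only [List.map_append, List.sum_append, List.map_cons, List.map_nil, List.sum_cons,
          List.sum_nil, if_true]
        linarith
      · rw [h1, h3, List.length_append]
        have h4 := hcode (M.bufferAt hL x y n ++ [((M.cfg x y n).1, x (M.cfg x y n).2.1)])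
        have h5 : e = (((M.bufferAt hL x y n).length : ℝ) + 1) * (e / L) := by
          have : ((M.bufferAt hL x y n).length : ℝ) + 1 = L := by exact_mod_cast h2
          rw [this]
          field_simp
        have h6 : ((M.bufferAt hL x y n).map fun s => w s.1 s.2 + e / L).sum =
            ((M.bufferAt hL x y n).map fun s => w s.1 s.2).sum +
              (M.bufferAt hL x y n).length * (e / L) := by
          rw [List.sum_map_add]
          simp
        simp only [List.map_append, List.sum_append, List.map_cons, List.map_nil, List.sum_cons,
          List.sum_nil, if_true] at h4 ⊢
        push_cast
        nlinarith

end Mach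

end

section

/-! ### Incompressibility implies unpredictability -/

section predict

lemma sub_two_mul_sq_le_log_one_add {u : ℝ} (hu : -(1 / 2) ≤ u) :
    u - 2 * u ^ 2 ≤ Real.log (1 + u) := by
  have hpos : 0 < 1 + u := by linarith
  refine le_trans ?_ (Real.one_sub_inv_le_log_of_pos hpos)
  rw [← sub_nonneg]
  have : 1 - (1 + u)⁻¹ - (u - 2 * u ^ 2) = u ^ 2 * (1 + 2 * u) / (1 + u) := by
    field_simp
    ring
  rw [this]
  have : 0 ≤ 1 + 2 * u := by linarith
  positivity

namespace Mach

variable (M : Mach A B Q) (x : ℕ → A) (y : ℕ → B)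

lemma cfg_mono : Monotone (fun n => (M.cfg x y n).2.1) ∧ Monotone fun n => (M.cfg x y n).2.2 := by
  refine ⟨monotone_nat_of_le_succ fun n => ?_, monotone_nat_of_le_succ fun n => ?_⟩ <;>
    cases hr : M.rd (M.cfg x y n).1 <;>
    simp [cfg_succ_of_rd, cfg_succ_of_not_rd, hr]

lemma cfg_fst_le (n : ℕ) : (M.cfg x y n).2.1 ≤ n := by
  induction n with
  | zero => exact le_rfl
  | succ n ih =>
    cases hr : M.rd (M.cfg x y n).1
    · rw [cfg_succ_of_not_rd _ _ _ hr]; dsimp only; omega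
    · rw [cfg_succ_of_rd _ _ _ hr]; dsimp only; omega

lemma sum_rd_const (c : ℝ) (n : ℕ) :
    (∑ i ∈ Finset.range n, if M.rd (M.cfg x y i).1 then c else 0) = (M.cfg x y n).2.1 * c := by
  induction n with
  | zero => simp [cfg]
  | succ n ih =>
    rw [Finset.sum_range_succ, ih]
    cases hr : M.rd (M.cfg x y n).1
    · simp [cfg_succ_of_not_rd _ _ _ hr]
    · rw [cfg_succ_of_rd _ _ _ hr]; push_cast; simp only [if_true]; ring

end Mach

variable [Fintype A]

lemma sum_sub_avg (f : A → ℝ) : ∑ a, (f a - avg Finset.univ f) = 0 := by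
  cases isEmpty_or_nonempty A
  · simp
  · simp only [Finset.sum_sub_distrib, Finset.sum_const, nsmul_eq_mul, avg, Finset.card_univ]
    field_simp
    simp

namespace Mach

variable (M : Mach A B Q) {x : ℕ → A} {y : ℕ → B}

lemma exists_dev_bound [Finite Q] (F : Q → A → ℝ) :
    ∃ K, 1 ≤ K ∧ ∀ q a, |F q a - avg Finset.univ (F q)| ≤ K := by
  obtain ⟨K, hK⟩ := (Set.finite_range
    fun p : Q × A => |F p.1 p.2 - avg Finset.univ (F p.1)|).bddAbove
  exact ⟨max K 1, le_max_right _ _, fun q a => (hK ⟨(q, a), rfl⟩).trans (le_max_left _ _)⟩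

lemma tendsto_dev_of_bounded_fst [Finite Q] (F : Q → A → ℝ) {b : ℕ}
    (hb : ∀ n, (M.cfg x y n).2.1 ≤ b) :
    Tendsto (fun n : ℕ => (∑ i ∈ Finset.range n, M.dev x y F i) / n) atTop (𝓝 0) := by
  obtain ⟨K, hK1, hK⟩ := exists_dev_bound F
  refine tendsto_bounded_div (C := b * K) fun n => ?_
  calc |∑ i ∈ Finset.range n, M.dev x y F i| ≤ ∑ i ∈ Finset.range n, |M.dev x y F i| :=
        Finset.abs_sum_le_sum_abs _ _
    _ ≤ ∑ i ∈ Finset.range n, if M.rd (M.cfg x y i).1 then K else 0 := by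
        refine Finset.sum_le_sum fun i _ => ?_
        simp only [dev]
        split_ifs
        · exact hK _ _
        · simp
    _ = (M.cfg x y n).2.1 * K := M.sum_rd_const x y K n
    _ ≤ b * K := by
        gcongr
        exact hb n

lemma tendsto_dev_of_bounded_snd [Finite Q] (hx : Normal x) (F : Q → A → ℝ) {b : ℕ}
    (hb : ∀ n, (M.cfg x y n).2.2 ≤ b) :
    Tendsto (fun n : ℕ => (∑ i ∈ Finset.range n, M.dev x y F i) / n) atTop (𝓝 0) := by
  obtain ⟨T, hT⟩ : ∃ T, ∀ n, (M.cfg x y n).2.2 ≤ (M.cfg x y T).2.2 := by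
    obtain ⟨_, ⟨T, rfl⟩, hT⟩ := wellFounded_lt.has_min
      (Set.range fun n => b - (M.cfg x y n).2.2) ⟨_, 0, rfl⟩
    refine ⟨T, fun n => ?_⟩
    have : ¬ b - (M.cfg x y n).2.2 < b - (M.cfg x y T).2.2 := hT _ ⟨n, rfl⟩
    have := hb n
    have := hb T
    omega
  have hrd : ∀ k, M.rd (M.cfg x y (T + k)).1 = true := by
    intro k
    by_contra hr
    rw [Bool.not_eq_true] at hr
    have h1 := hT (T + k + 1)
    have h2 := (M.cfg_mono x y).2 (Nat.le_add_right T k)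
    rw [cfg_succ_of_not_rd _ _ _ hr] at h1
    dsimp only at h1 h2
    omega
  set j₀ := (M.cfg x y T).2.1 with hj₀
  have hpos : ∀ k, (M.cfg x y (T + k)).2.1 = j₀ + k := by
    intro k
    induction k with
    | zero => rfl
    | succ k ih =>
      rw [← add_assoc, cfg_succ_of_rd _ _ _ (hrd k)]
      dsimp only
      omega
  set r : ℕ → Fin (j₀ + 1) × Q := fun n => (⟨min n j₀, by omega⟩, (M.cfg x y (T + (n - j₀))).1)
    with hr
  set δ : Fin (j₀ + 1) × Q → A → Fin (j₀ + 1) × Q := fun s a =>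
    if h : s.1.1 < j₀ then (⟨s.1.1 + 1, by omega⟩, s.2) else (s.1, M.δa s.2 a) with hδ
  set G : Fin (j₀ + 1) × Q → A → ℝ := fun s a =>
    if s.1.1 < j₀ then 0 else F s.2 a - avg Finset.univ (F s.2) with hG
  have hlim := hx.tendsto_runSum (δ := δ) (r := r) (G := G) (fun n => ?_) (fun s => ?_)
  · have hsum : ∀ k, ∑ j ∈ Finset.range (j₀ + k), G (r j) (x j) =
        ∑ i ∈ Finset.range k, M.dev x y F (T + i) := by
      intro k
      rw [Finset.sum_range_add, Finset.sum_eq_zero, zero_add]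
      · refine Finset.sum_congr rfl fun i _ => ?_
        simp [hG, hr, dev, hrd, hpos]
      · intro j hj
        have := Finset.mem_range.1 hj
        simp [hG, hr, this]
    have h1 := tendsto_comp_div hlim (c := fun n => j₀ + n - T) (K := 1) fun n => by
      have := M.cfg_fst_le x y T
      omega
    have h2 : Tendsto (fun n : ℕ => (∑ i ∈ Finset.range T, M.dev x y F i) / (n : ℝ)) atTop (𝓝 0) :=
      tendsto_const_div_atTop_nhds_zero_nat _
    have h3 := h2.add h1
    rw [add_zero] at h3
    refine h3.congr' ?_
    filter_upwards [eventually_ge_atTop T] with n hn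
    obtain ⟨k, rfl⟩ := Nat.exists_eq_add_of_le hn
    rw [show j₀ + (T + k) - T = j₀ + k by omega, hsum, Finset.sum_range_add, add_div]
  · rcases lt_or_ge n j₀ with h | h
    · have h1 : n + 1 - j₀ = n - j₀ := by omega
      have h2 : min n j₀ = n := by omega
      simp [hr, hδ, h1, h, h2]
    · have h1 : n + 1 - j₀ = n - j₀ + 1 := by omega
      have h2 : ¬ n < j₀ := by omega
      have h4 := hpos (n - j₀)
      rw [show j₀ + (n - j₀) = n by omega] at h4
      simp only [hr, hδ, h1, ← add_assoc, cfg_succ_of_rd _ _ _ (hrd (n - j₀)), h4]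
      rw [dif_neg (by omega)]
      congr 2
      omega
  · by_cases h : s.1.1 < j₀
    · simp [hG, h]
    · simpa [hG, h] using sum_sub_avg (F s.2)

lemma dev_neg (F : Q → A → ℝ) (n : ℕ) :
    M.dev x y (fun q a => -F q a) n = -M.dev x y F n := by
  simp only [dev, avg_neg]
  split_ifs
  · ring
  · simp

variable [Fintype B]

lemma eventually_sum_dev_lt [Finite Q] (hA : 2 ≤ Fintype.card A) (h : 1 ≤ condRho x y)
    (h1 : Tendsto (fun n => (M.cfg x y n).2.1) atTop atTop)
    (h2 : Tendsto (fun n => (M.cfg x y n).2.2) atTop atTop) (F : Q → A → ℝ) {η : ℝ} (hη : 0 < η) :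
    ∀ᶠ n : ℕ in atTop, ∑ i ∈ Finset.range n, M.dev x y F i < η * n := by
  by_contra hnot
  have hfreq : ∃ᶠ n : ℕ in atTop, η * n ≤ ∑ i ∈ Finset.range n, M.dev x y F i := by
    simpa [Filter.Frequently, not_le] using hnot
  have hcard : (0 : ℝ) < Fintype.card A := by exact_mod_cast (by omega : 0 < Fintype.card A)
  have hlogA : 0 < Real.log (Fintype.card A) := Real.log_pos (by exact_mod_cast hA)
  obtain ⟨K, hK1, hK⟩ := exists_dev_bound F
  set f : Q → A → ℝ := fun q a => F q a - avg Finset.univ (F q) with hf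
  have hK0 : 0 < K := by linarith
  set ε : ℝ := min (1 / (2 * K)) (η / (8 * K ^ 2)) with hε
  have hε0 : 0 < ε := by positivity
  have hε1 : ε * K ≤ 1 / 2 := by
    calc ε * K ≤ 1 / (2 * K) * K := by gcongr; exact min_le_left _ _
      _ = 1 / 2 := by field_simp
  have hε2 : 2 * (ε * K) ^ 2 ≤ ε * η / 4 := by
    calc 2 * (ε * K) ^ 2 = 2 * K ^ 2 * ε * ε := by ring
      _ ≤ 2 * K ^ 2 * ε * (η / (8 * K ^ 2)) := by gcongr; exact min_le_right _ _
      _ = ε * η / 4 := by field_simp; ring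
  have hfb : ∀ q a, |ε * f q a| ≤ ε * K := fun q a => by
    rw [abs_mul, abs_of_pos hε0]
    exact mul_le_mul_of_nonneg_left (hK q a) hε0.le
  have hfl : ∀ q a, -(1 / 2) ≤ ε * f q a := fun q a => by
    linarith [neg_le_of_abs_le (hfb q a)]
  set p : Q → A → ℝ := fun q a => (1 + ε * f q a) / Fintype.card A with hp
  have hp0 : ∀ q a, 0 < p q a := fun q a => div_pos (by linarith [hfl q a]) hcard
  have hp1 : ∀ q, ∑ a, p q a = 1 := fun q => by
    rw [hp]
    simp only [← Finset.sum_div, Finset.sum_add_distrib, ← Finset.mul_sum, hf]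
    rw [sum_sub_avg]
    simp [hcard.ne']
  obtain ⟨L, hL, hLe⟩ : ∃ L : ℕ, 0 < L ∧ Real.log 4 / L ≤ ε * η / 4 := by
    have := (tendsto_const_div_atTop_nhds_zero_nat (Real.log 4)).eventually_le_const
      (show 0 < ε * η / 4 by positivity)
    obtain ⟨L, hL1, hL2⟩ := ((eventually_gt_atTop 0).and this).exists
    exact ⟨L, hL1, hL2⟩
  obtain ⟨code, hc1, hc2, hc3⟩ := exists_code hp0 hp1
  have hfin : Finite {h : List (Q × A) // h.length < L} := (List.finite_length_lt _ L).to_subtype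
  have hw0 : ∀ q a, 0 ≤ -Real.log (p q a) := fun q a => by
    rw [neg_nonneg]
    refine Real.log_nonpos (hp0 q a).le ?_
    rw [← hp1 q]
    exact Finset.single_le_sum (fun b _ => (hp0 q b).le) (Finset.mem_univ a)
  have hlen := blockOut_length_le (M := M) (x := x) (y := y) hL (code := code)
    (w := fun q a => -Real.log (p q a)) (c := Real.log 2) (e := Real.log 4) hw0
    (Real.log_nonneg (by norm_num)) fun h => by
      refine (hc2 h).trans_eq ?_
      rw [sub_eq_add_neg, List.sum_neg, List.map_map]
      rfl
  have hcost : ∀ q a, -Real.log (p q a) + Real.log 4 / L ≤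
      Real.log (Fintype.card A) + ε * η / 2 - ε * f q a := fun q a => by
    rw [hp]
    dsimp only
    rw [Real.log_div (by linarith [hfl q a]) hcard.ne']
    have h3 := sub_two_mul_sq_le_log_one_add (hfl q a)
    have h4 : (ε * f q a) ^ 2 ≤ (ε * K) ^ 2 := sq_le_sq.2 ((hfb q a).trans (le_abs_self _))
    linarith
  have hsum : ∀ n, ((M.blockOut hL code x y n).length : ℝ) * Real.log 2 ≤
      (M.cfg x y n).2.1 * (Real.log (Fintype.card A) + ε * η / 2) -
        ε * ∑ i ∈ Finset.range n, M.dev x y F i := fun n => by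
    refine (hlen n).trans ?_
    rw [← M.sum_rd_const x y, Finset.mul_sum, ← Finset.sum_sub_distrib]
    refine Finset.sum_le_sum fun i _ => ?_
    simp only [dev]
    split_ifs
    · exact hcost _ _
    · simp
  have hacc := isAccRunOn_run (M := M.buffer hL) (o := bufferOut code) (x := x) (y := y)
    (by simpa only [(M.buffer_cfg hL x y _).2] using h1)
    (by simpa only [(M.buffer_cfg hL x y _).2] using h2) (tendsto_blockOut hL hc1 h1)
  have hrho := h.trans (condRho_le_of_finite le_rfl (toComp_twoDet _ _) (oneToOne_buffer hL hc3) hacc)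
  have hle : liminf (fun n : ℕ =>
      (((c3out ((M.buffer hL).run (bufferOut code) x y) n).length : ℝ) * Real.log (2 : ℕ)) /
        (((c3in1 ((M.buffer hL).run (bufferOut code) x y) n).length : ℝ) *
          Real.log (Fintype.card A))) atTop ≤ 1 - ε * η / (2 * Real.log (Fintype.card A)) := by
    refine liminf_le_of_frequently_le ?_ ⟨0, eventually_map.2 (Eventually.of_forall fun n => ?_)⟩
    · refine (hfreq.and_eventually (h1.eventually_gt_atTop 0)).mono fun n hn => ?_
      have hpos : (0 : ℝ) < (M.cfg x y n).2.1 := by exact_mod_cast hn.2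
      have hle' : ((M.cfg x y n).2.1 : ℝ) ≤ n := by exact_mod_cast M.cfg_fst_le x y n
      rw [c3out_run, (c3in_run _ _ _ _ _).1, pref_length, (M.buffer_cfg hL x y n).2,
        div_le_iff₀ (by positivity)]
      refine (hsum n).trans ?_
      have h5 : η * (M.cfg x y n).2.1 ≤ ∑ i ∈ Finset.range n, M.dev x y F i :=
        (mul_le_mul_of_nonneg_left hle' hη.le).trans hn.1
      have h6 := mul_le_mul_of_nonneg_left h5 hε0.le
      have h7 : (1 - ε * η / (2 * Real.log (Fintype.card A))) *
          ((M.cfg x y n).2.1 * Real.log (Fintype.card A)) =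
          (M.cfg x y n).2.1 * Real.log (Fintype.card A) - ε * η / 2 * (M.cfg x y n).2.1 := by
        field_simp
      rw [h7]
      linarith
    · have := Real.log_natCast_nonneg 2
      exact div_nonneg (mul_nonneg (Nat.cast_nonneg _) this)
        (mul_nonneg (Nat.cast_nonneg _) hlogA.le)
  have : 0 < ε * η / (2 * Real.log (Fintype.card A)) := by positivity
  linarith

end Mach

universe w in
/-- A normal word that cannot be compressed with an oracle is unpredictable with this oracle. -/
lemma unpredictable_of_one_le_condRho [Fintype B] (hA : 2 ≤ Fintype.card A) {x : ℕ → A}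
    {y : ℕ → B} (hx : Normal x) (h : 1 ≤ condRho x y) : Unpredictable.{w} x y := by
  intro Q _ M F
  by_cases h1 : ∀ b, ∃ n, b ≤ (M.cfg x y n).2.1
  swap
  · push Not at h1
    obtain ⟨b, hb⟩ := h1
    exact M.tendsto_dev_of_bounded_fst F fun n => (hb n).le
  by_cases h2 : ∀ b, ∃ n, b ≤ (M.cfg x y n).2.2
  swap
  · push Not at h2
    obtain ⟨b, hb⟩ := h2
    exact M.tendsto_dev_of_bounded_snd hx F fun n => (hb n).le
  have h1 := tendsto_atTop_atTop_of_monotone (M.cfg_mono x y).1 h1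
  have h2 := tendsto_atTop_atTop_of_monotone (M.cfg_mono x y).2 h2
  rw [Metric.tendsto_atTop']
  intro η hη
  obtain ⟨N, hN⟩ := ((M.eventually_sum_dev_lt hA h h1 h2 F hη).and
    (M.eventually_sum_dev_lt hA h h1 h2 (fun q a => -F q a) hη)).exists_forall_of_atTop
  refine ⟨N, fun n hn => ?_⟩
  obtain ⟨h3, h4⟩ := hN n hn.le
  have hn0 : (0 : ℝ) < n := by exact_mod_cast (by omega : 0 < n)
  simp only [Mach.dev_neg, Finset.sum_neg_distrib] at h4
  rw [Real.dist_eq, sub_zero, abs_div, Nat.abs_cast, div_lt_iff₀ hn0, abs_lt]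
  exact ⟨by linarith, h3⟩

end predict

end

/-- Two normal words `x` and `y` are finite-state independent if and
only if every oblivious selector with infinite output applied to `(x,y)` produces a
normal word, and likewise for `(y,x)`. -/
theorem normal_fsIndep_iff_selectors {A B : Type*} [Fintype A] [Fintype B]
    (hA : 2 ≤ Fintype.card A) (hB : 2 ≤ Fintype.card B)
    (x : ℕ → A) (y : ℕ → B) (hx : Normal x) (hy : Normal y) :
    FSIndep x y ↔
      ((∀ S : Sel2 A B,
          Tendsto (fun n => (S.outList x y n).length) atTop atTop →
          ∀ z : ℕ → A, (∀ n, S.outList x y n = pref z (S.outList x y n).length) →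
            Normal z) ∧
       (∀ S : Sel2 B A,
          Tendsto (fun n => (S.outList y x n).length) atTop atTop →
          ∀ z : ℕ → B, (∀ n, S.outList y x n = pref z (S.outList y x n).length) →
            Normal z)) := by
  have hρx : rho x = 1 := le_antisymm (rho_le_one hA x) (one_le_rho hA hx)
  have hρy : rho y = 1 := le_antisymm (rho_le_one hB y) (one_le_rho hB hy)
  constructor
  · rintro ⟨h₁, h₂, -, -⟩
    have ux : Unpredictable.{0} x y := unpredictable_of_one_le_condRho hA hx (h₁.trans hρx).ge
    have uy : Unpredictable.{0} y x := unpredictable_of_one_le_condRho hB hy (h₂.trans hρy).ge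
    exact ⟨fun S hinf z hz => normal_of_unpredictable ux uy S hinf hz,
      fun S hinf z hz => normal_of_unpredictable uy ux S hinf hz⟩
  · rintro ⟨h₁, h₂⟩
    have hxy : condRho x y = 1 := le_antisymm (condRho_le_one hA x y)
      (one_le_condRho hA hB (unpredictable_of_selectors h₁) (unpredictable_of_selectors h₂))
    have hyx : condRho y x = 1 := le_antisymm (condRho_le_one hB y x)
      (one_le_condRho hB hA (unpredictable_of_selectors h₂) (unpredictable_of_selectors h₁))
    exact ⟨hxy.trans hρx.symm, hyx.trans hρy.symm, hρx ▸ one_pos, hρy ▸ one_pos⟩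

end FSI
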